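/- For every positive integer n, the number of representations of n by x1^2+x2^2+x3^2 + 2x4^2+2x5^2 + 3x6^2+3x7^2 + 4x8^2 equals (7/5)σ3(n) − (7/5)σ3(n/2) − (27/5)σ3(n/3) + (27/5)σ3(n/6) + (28/5)σ3(n/8) − (448/5)σ3(n/16) − (108/5)σ3(n/24) + (1728/5)σ3(n/48) − (2/5)a6(n) − 24a6(n/4) − (448/5)a6(n/8) − (1/2)a8(n) − a8(n/2) − (27/2)a8(n/3) − 27a8(n/6) + 2a12(n) + 2a12(n/2) + 20a12(n/4) + (1/2)a16(n) − (27/2)a16(n/3) + (3/2)χ4(n)a24(n) + 3χ4(n/2)a24(n/2) + 3χ−4(n)a6(n) − (3/2)χ−4(n)a24(n), with all terms whose argument is not a positive integer interpreted as 0. -/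

import Mathlib

open Complex Real Finset

/-- The Dedekind eta function `η(z) = q^{1/24} ∏ (1 - q^m)`, `q = e^{2πiz}`. -/
noncomputable def dedekindEta (z : ℂ) : ℂ :=
  Complex.exp (Real.pi * Complex.I * z / 12) *
    ∏' m : ℕ, (1 - Complex.exp (2 * Real.pi * Complex.I * (m + 1) * z))

/-- `repCount a n` is the number of `(x₁,…,x₈) ∈ ℤ⁸` with `∑ aᵢ xᵢ² = n`. -/
noncomputable def repCount (a : Fin 8 → ℕ) (n : ℕ) : ℕ :=
  Nat.card {x : Fin 8 → ℤ // ∑ i, (a i : ℤ) * x i ^ 2 = (n : ℤ)}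

/-- `σ₃(n) = ∑_{d ∣ n} d³`. -/
def sigma3 (n : ℕ) : ℤ := ∑ d ∈ n.divisors, (d : ℤ) ^ 3

/-- `σ_{3;χ₋₄,χ₋₄}(n) = ∑_{d ∣ n} χ₋₄(d) χ₋₄(n/d) d³`. -/
def sigmaChi4Chi4 (n : ℕ) : ℤ :=
  ∑ d ∈ n.divisors, ZMod.χ₄ (d : ZMod 4) * ZMod.χ₄ ((n / d : ℕ) : ZMod 4) * (d : ℤ) ^ 3

/-- `χ₋₄ = (−4/·)`, the nontrivial character mod 4, as an integer-valued function on `ℕ`. -/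
def chiMinus4 (n : ℕ) : ℤ := ZMod.χ₄ (n : ZMod 4)

/-- `χ₄ = (4/·)`: `1` on odd integers, `0` on even integers. -/
def chi4 (n : ℕ) : ℤ := if n % 2 = 1 then 1 else 0

/-- `f(n/k)` when `k ∣ n`, and `0` otherwise. -/
def Dv (f : ℕ → ℤ) (k n : ℕ) : ℚ := if k ∣ n then (f (n / k) : ℚ) else 0

lemma hasSum_cong {ι : Type*} {f g : ι → ℂ} {a b : ℂ} (h : HasSum f a) (hf : ∀ i, f i = g i)
    (ha : a = b) : HasSum g b := by
  have : f = g := funext hf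
  rw [← this, ← ha]; exact h

noncomputable def poch (x q : ℂ) : ℂ := ∏' k : ℕ, (1 - x * q ^ k)

lemma multipliable_poch {q : ℂ} (x : ℂ) (hq : ‖q‖ < 1) :
    Multipliable fun k : ℕ => (1 - x * q ^ k) := by
  have h : Summable fun k : ℕ => ‖-(x * q ^ k)‖ := by
    simp only [norm_neg, norm_mul, norm_pow]
    exact (summable_geometric_of_lt_one (norm_nonneg _) hq).mul_left _
  simpa [sub_eq_add_neg] using multipliable_one_add_of_summable h

lemma poch_tendsto {q : ℂ} (x : ℂ) (hq : ‖q‖ < 1) :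
    Filter.Tendsto (fun N : ℕ => ∏ k ∈ range N, (1 - x * q ^ k)) Filter.atTop (nhds (poch x q)) :=
  (multipliable_poch x hq).hasProd.tendsto_prod_nat

lemma poch_ne_zero {q x : ℂ} (hq : ‖q‖ < 1) (hx : ∀ k : ℕ, x * q ^ k ≠ 1) : poch x q ≠ 0 := by
  have h : Summable fun k : ℕ => ‖-(x * q ^ k)‖ := by
    simp only [norm_neg, norm_mul, norm_pow]
    exact (summable_geometric_of_lt_one (norm_nonneg _) hq).mul_left _
  have := tprod_one_add_ne_zero_of_summable (f := fun k : ℕ => -(x * q ^ k)) (by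
    intro k hk
    apply hx k
    linear_combination -hk) h
  simpa [poch, sub_eq_add_neg] using this

lemma poch_ne_zero' {q x : ℂ} (hq : ‖q‖ < 1) (hx : ‖x‖ < 1) : poch x q ≠ 0 := by
  apply poch_ne_zero hq
  intro k hk
  have : ‖x * q ^ k‖ < 1 := by
    rw [norm_mul, norm_pow]
    calc ‖x‖ * ‖q‖ ^ k ≤ ‖x‖ * 1 := by
          gcongr
          exact pow_le_one₀ (norm_nonneg _) hq.le
      _ < 1 := by simpa using hx
  rw [hk] at this
  simp at this

lemma norm_pow_lt {q : ℂ} (hq : ‖q‖ < 1) {n : ℕ} (hn : n ≠ 0) : ‖q ^ n‖ < 1 := by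
  rw [norm_pow]; exact pow_lt_one₀ (norm_nonneg _) hq hn

lemma poch_succ {q : ℂ} (x : ℂ) (hq : ‖q‖ < 1) : poch x q = (1 - x) * poch (x * q) q := by
  have h1 := (poch_tendsto x hq).comp (Filter.tendsto_add_atTop_nat 1)
  have h2 := (poch_tendsto (x * q) hq).const_mul (1 - x)
  refine tendsto_nhds_unique h1 (h2.congr fun N => ?_)
  simp only [Function.comp]
  rw [prod_range_succ', mul_comm]
  congr 1
  · exact prod_congr rfl fun k _ => by ring
  · simp

lemma poch_two {q : ℂ} (x : ℂ) (hq : ‖q‖ < 1) :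
    poch x q = poch x (q ^ 2) * poch (x * q) (q ^ 2) := by
  have hq2 := norm_pow_lt hq (n := 2) (by norm_num)
  have h1 := (poch_tendsto x hq).comp (Filter.tendsto_id.nsmul_atTop (n := 2) (by norm_num))
  have h2 := (poch_tendsto x hq2).mul (poch_tendsto (x * q) hq2)
  refine tendsto_nhds_unique h1 (h2.congr fun N => ?_)
  simp only [Function.comp, id, smul_eq_mul]
  induction N with
  | zero => simp
  | succ N ih =>
    rw [prod_range_succ, prod_range_succ, show 2 * (N + 1) = 2 * N + 1 + 1 by ring,
      prod_range_succ, prod_range_succ, ← ih]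
    ring

lemma poch_three {q : ℂ} (x : ℂ) (hq : ‖q‖ < 1) :
    poch x q = poch x (q ^ 3) * poch (x * q) (q ^ 3) * poch (x * q ^ 2) (q ^ 3) := by
  have hq2 := norm_pow_lt hq (n := 3) (by norm_num)
  have h1 := (poch_tendsto x hq).comp (Filter.tendsto_id.nsmul_atTop (n := 3) (by norm_num))
  have h2 := ((poch_tendsto x hq2).mul (poch_tendsto (x * q) hq2)).mul
    (poch_tendsto (x * q ^ 2) hq2)
  refine tendsto_nhds_unique h1 (h2.congr fun N => ?_)
  simp only [Function.comp, id, smul_eq_mul]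
  induction N with
  | zero => simp
  | succ N ih =>
    rw [prod_range_succ, prod_range_succ, prod_range_succ,
      show 3 * (N + 1) = 3 * N + 1 + 1 + 1 by ring,
      prod_range_succ, prod_range_succ, prod_range_succ, ← ih]
    ring

lemma poch_neg {q : ℂ} (x : ℂ) (hq : ‖q‖ < 1) :
    poch x q * poch (-x) q = poch (x ^ 2) (q ^ 2) := by
  have hq2 := norm_pow_lt hq (n := 2) (by norm_num)
  have h1 := (poch_tendsto x hq).mul (poch_tendsto (-x) hq)
  have h2 := poch_tendsto (x ^ 2) hq2
  refine tendsto_nhds_unique h1 (h2.congr fun N => ?_)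
  rw [← prod_mul_distrib]
  exact prod_congr rfl fun k _ => by ring

lemma poch_omega {q : ℂ} (x w : ℂ) (hq : ‖q‖ < 1) (hw : w ^ 2 + w + 1 = 0) :
    poch x q * poch (w * x) q * poch (w ^ 2 * x) q = poch (x ^ 3) (q ^ 3) := by
  have hq2 := norm_pow_lt hq (n := 3) (by norm_num)
  have h1 := ((poch_tendsto x hq).mul (poch_tendsto (w * x) hq)).mul (poch_tendsto (w ^ 2 * x) hq)
  have h2 := poch_tendsto (x ^ 3) hq2
  refine tendsto_nhds_unique h1 (h2.congr fun N => ?_)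
  rw [← prod_mul_distrib, ← prod_mul_distrib]
  refine prod_congr rfl fun k _ => ?_
  have h3 : w ^ 3 = 1 := by linear_combination (w - 1) * hw
  have : (1 - x * q ^ k) * (1 - w * x * q ^ k) * (1 - w ^ 2 * x * q ^ k)
    = 1 - (x * q ^ k) * (w^2 + w + 1) + (x * q ^ k) ^ 2 * (w * (w ^ 2 + w + 1)) - w ^ 3 * (x * q ^ k) ^ 3 := by
    ring
  rw [this, hw, h3]; ring

/-! Jacobi triple product -/

noncomputable def jP (Q : ℂ) (m : ℕ) : ℂ := ∏ k ∈ range m, (1 - Q ^ (k + 1))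

noncomputable def jI (Q : ℂ) (m : ℤ) : ℂ := if 0 ≤ m then (jP Q m.toNat)⁻¹ else 0

lemma one_sub_pow_ne {Q : ℂ} (hQ : ‖Q‖ < 1) (k : ℕ) : 1 - Q ^ (k + 1) ≠ 0 := by
  intro h
  have := norm_pow_lt hQ (n := k + 1) (by omega)
  rw [show Q ^ (k + 1) = 1 by linear_combination -h] at this
  simp at this

lemma jP_ne {Q : ℂ} (hQ : ‖Q‖ < 1) (m : ℕ) : jP Q m ≠ 0 :=
  prod_ne_zero_iff.2 fun k _ => one_sub_pow_ne hQ k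

lemma jI_rec {Q : ℂ} (hQ : ‖Q‖ < 1) (m : ℤ) : jI Q (m - 1) = (1 - Q ^ m) * jI Q m := by
  rcases lt_trichotomy m 0 with h | h | h
  · simp [jI, show ¬ (0 ≤ m) by omega, show ¬ (1 ≤ m) by omega]
  · subst h; simp [jI]
  · obtain ⟨k, rfl⟩ : ∃ k : ℕ, m = (k : ℤ) + 1 := ⟨(m - 1).toNat, by omega⟩
    have h2 : (Q : ℂ) ^ ((k : ℤ) + 1) = Q ^ (k + 1) := by exact_mod_cast zpow_natCast Q (k + 1)
    have := one_sub_pow_ne hQ k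
    have := jP_ne hQ k
    simp only [jI, add_sub_cancel_right, h2, show (0 : ℤ) ≤ (k : ℤ) by omega,
      show (0 : ℤ) ≤ (k : ℤ) + 1 by omega, if_true, show ((k : ℤ) + 1).toNat = k + 1 by omega,
      Int.toNat_natCast]
    rw [jP, jP, prod_range_succ]
    rw [jP] at this
    field_simp

lemma jtp_finite {q x : ℂ} (hq0 : q ≠ 0) (hx : x ≠ 0) (hq : ‖q‖ < 1) (N : ℕ) :
    HasSum (fun j : ℤ => jP (q ^ 2) (2 * N) * jI (q ^ 2) (N - j) * jI (q ^ 2) (N + j) *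
      (q ^ (j ^ 2) * x ^ j))
      (∏ k ∈ range N, ((1 + x * q ^ (2 * k + 1)) * (1 + x⁻¹ * q ^ (2 * k + 1)))) := by
  have hQ := norm_pow_lt hq (n := 2) (by norm_num)
  induction N with
  | zero =>
    convert hasSum_single (0 : ℤ) ?_ using 1
    · simp [jP, jI]
    · intro j hj
      rcases lt_or_gt_of_ne hj with h | h
      · simp [jI, show ¬ (0 ≤ j) by omega]
      · simp [jI, show ¬ (j ≤ 0) by omega]
  | succ N ih =>
    have e1 := (Equiv.addRight (-1 : ℤ)).hasSum_iff.2 ih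
    have e2 := (Equiv.addRight (1 : ℤ)).hasSum_iff.2 ih
    have := ((ih.mul_left (1 + q ^ (4 * N + 2))).add (e1.mul_left (x * q ^ (2 * N + 1)))).add
      (e2.mul_left (x⁻¹ * q ^ (2 * N + 1)))
    refine hasSum_cong this (fun j => ?_) ?_
    · symm
      simp only [Function.comp, Equiv.coe_addRight]
      set Q := q ^ 2 with hQd
      have hQ0 : Q ≠ 0 := pow_ne_zero _ hq0
      have a1 : jI Q (N - j) = (1 - Q ^ ((N : ℤ) + 1 - j)) * jI Q (N + 1 - j) := by
        rw [← jI_rec hQ]; congr 1; ring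
      have a2 : jI Q (N + j) = (1 - Q ^ ((N : ℤ) + 1 + j)) * jI Q (N + 1 + j) := by
        rw [← jI_rec hQ]; congr 1; ring
      have a3 : jI Q (N + (j + -1)) = (1 - Q ^ ((N : ℤ) + j)) * jI Q (N + j) := by
        rw [← jI_rec hQ]; congr 1; ring
      have a4 : jI Q (N - (j + 1)) = (1 - Q ^ ((N : ℤ) - j)) * jI Q (N - j) := by
        rw [← jI_rec hQ]; congr 1; ring
      have a5 : jI Q (N - (j + -1)) = jI Q (N + 1 - j) := by congr 1; ring
      have a6 : jI Q (N + (j + 1)) = jI Q (N + 1 + j) := by congr 1; ring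
      have a7 : jP Q (2 * (N + 1)) = jP Q (2 * N) * (1 - Q ^ (2 * N + 1)) * (1 - Q ^ (2 * N + 2)) := by
        rw [jP, show 2 * (N + 1) = 2 * N + 1 + 1 by ring, prod_range_succ, prod_range_succ]; rfl
      rw [a7, a3, a4, a5, a6, a1, a2]
      push_cast
      set I := jI Q (N + 1 - j)
      set J := jI Q (N + 1 + j)
      have hz : q ^ j ≠ 0 := zpow_ne_zero _ hq0
      have b1 : Q ^ ((N : ℤ) + 1 - j) = (q ^ N) ^ 2 * q ^ 2 / (q ^ j) ^ 2 := by
        rw [zpow_sub₀ hQ0, zpow_add₀ hQ0, hQd]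
        simp only [zpow_natCast, zpow_one, ← pow_mul]
        rw [← zpow_natCast (q ^ j) 2, ← zpow_mul, ← zpow_natCast q 2, ← zpow_mul]
        congr 2 <;> ring
      have b2 : Q ^ ((N : ℤ) + 1 + j) = (q ^ N) ^ 2 * q ^ 2 * (q ^ j) ^ 2 := by
        rw [zpow_add₀ hQ0, zpow_add₀ hQ0, hQd]
        simp only [zpow_natCast, zpow_one, ← pow_mul]
        rw [← zpow_natCast (q ^ j) 2, ← zpow_mul, ← zpow_natCast q 2, ← zpow_mul]
        congr 2 <;> ring
      have b3 : Q ^ ((N : ℤ) - j) = (q ^ N) ^ 2 / (q ^ j) ^ 2 := by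
        rw [zpow_sub₀ hQ0, hQd]
        simp only [zpow_natCast, ← pow_mul]
        rw [← zpow_natCast (q ^ j) 2, ← zpow_mul, ← zpow_natCast q 2, ← zpow_mul]
        congr 2 <;> ring
      have b4 : Q ^ ((N : ℤ) + j) = (q ^ N) ^ 2 * (q ^ j) ^ 2 := by
        rw [zpow_add₀ hQ0, hQd]
        simp only [zpow_natCast, ← pow_mul]
        rw [← zpow_natCast (q ^ j) 2, ← zpow_mul, ← zpow_natCast q 2, ← zpow_mul]
        congr 2 <;> ring
      have c1 : q ^ ((j + -1) ^ 2) = q ^ (j ^ 2) * q / (q ^ j) ^ 2 := by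
        rw [show (j + -1) ^ 2 = j ^ 2 + 1 - j * 2 by ring, zpow_sub₀ hq0, zpow_add₀ hq0, zpow_mul]
        simp only [zpow_one]; norm_cast
      have c2 : q ^ ((j + 1) ^ 2) = q ^ (j ^ 2) * q * (q ^ j) ^ 2 := by
        rw [show (j + 1) ^ 2 = j ^ 2 + 1 + j * 2 by ring, zpow_add₀ hq0, zpow_add₀ hq0, zpow_mul]
        simp only [zpow_one]; norm_cast
      have c3 : x ^ (j + -1) = x ^ j / x := by rw [zpow_add₀ hx, zpow_neg_one]; rfl
      have c4 : x ^ (j + 1) = x ^ j * x := by rw [zpow_add₀ hx, zpow_one]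
      rw [b1, b2, b3, b4, c1, c2, c3, c4, hQd]
      simp only [← pow_mul]
      have d1 : q ^ (2 * (2 * N + 1)) = (q ^ N) ^ 4 * q ^ 2 := by ring
      have d2 : q ^ (2 * (2 * N + 2)) = (q ^ N) ^ 4 * q ^ 4 := by ring
      have d3 : q ^ (4 * N + 2) = (q ^ N) ^ 4 * q ^ 2 := by ring
      have d4 : q ^ (2 * N + 1) = (q ^ N) ^ 2 * q := by ring
      have d5 : q ^ (N * 2) = (q ^ N) ^ 2 := by ring
      rw [d1, d2, d3, d4, d5]
      generalize q ^ N = A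
      generalize q ^ j = z at hz ⊢
      field_simp
      ring
    · rw [prod_range_succ]
      have : x * x⁻¹ = 1 := mul_inv_cancel₀ hx
      linear_combination (-(∏ k ∈ range N, ((1 + x * q ^ (2 * k + 1)) * (1 + x⁻¹ * q ^ (2 * k + 1)))) * q ^ (4 * N + 2)) * this

lemma jP_tendsto {Q : ℂ} (hQ : ‖Q‖ < 1) :
    Filter.Tendsto (jP Q) Filter.atTop (nhds (poch Q Q)) := by
  refine (poch_tendsto Q hQ).congr fun N => ?_
  exact prod_congr rfl fun k _ => by ring

lemma summable_theta {q x : ℂ} (hq : ‖q‖ < 1) : 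
    Summable fun j : ℤ => ‖q ^ (j ^ 2) * x ^ j‖ := by
  have key : ∀ y : ℝ, 0 ≤ y → Summable fun n : ℕ => ‖q‖ ^ (n ^ 2) * y ^ n := by
    intro y hy
    have ht : Filter.Tendsto (fun n : ℕ => ‖q‖ ^ n * y) Filter.atTop (nhds 0) := by
      simpa using (tendsto_pow_atTop_nhds_zero_of_lt_one (norm_nonneg q) hq).mul_const y
    have hev : ∀ᶠ n : ℕ in Filter.atTop, ‖q‖ ^ n * y < 1 / 2 := ht.eventually_lt_const (by norm_num)
    refine Summable.of_norm_bounded_eventually_nat (g := fun n : ℕ => (1 / 2 : ℝ) ^ n)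
      summable_geometric_two ?_
    filter_upwards [hev] with n hn
    rw [show ‖q‖ ^ (n ^ 2) * y ^ n = (‖q‖ ^ n * y) ^ n by rw [mul_pow, ← pow_mul, sq]]
    rw [norm_pow, Real.norm_of_nonneg (by positivity)]
    exact pow_le_pow_left₀ (by positivity) hn.le n
  apply Summable.of_nat_of_neg
  · refine (key ‖x‖ (norm_nonneg _)).congr fun n => ?_
    rw [norm_mul, norm_zpow, norm_zpow, zpow_natCast]
    congr 1
  · refine (key ‖x⁻¹‖ (norm_nonneg _)).congr fun n => ?_
    rw [norm_mul, norm_zpow, norm_zpow, neg_sq, zpow_neg, zpow_natCast, norm_inv, inv_pow]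
    congr 1

theorem jtp {q x : ℂ} (hq0 : q ≠ 0) (hx : x ≠ 0) (hq : ‖q‖ < 1) :
    ∑' j : ℤ, q ^ (j ^ 2) * x ^ j =
      poch (q ^ 2) (q ^ 2) * poch (-x * q) (q ^ 2) * poch (-x⁻¹ * q) (q ^ 2) := by
  have hQ := norm_pow_lt hq (n := 2) (by norm_num)
  set E := poch (q ^ 2) (q ^ 2) with hE
  have hE0 : E ≠ 0 := poch_ne_zero' hQ hQ
  have t1 := jP_tendsto hQ
  have t2 : Filter.Tendsto (fun m => (jP (q ^ 2) m)⁻¹) Filter.atTop (nhds E⁻¹) := t1.inv₀ hE0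
  obtain ⟨C1, hC1⟩ := (Metric.isBounded_range_of_tendsto _ t1).exists_norm_le
  obtain ⟨C2, hC2⟩ := (Metric.isBounded_range_of_tendsto _ t2).exists_norm_le
  have hC1' : ∀ m, ‖jP (q ^ 2) m‖ ≤ C1 := fun m => hC1 _ ⟨m, rfl⟩
  have hC20 : 0 ≤ C2 := (norm_nonneg _).trans (hC2 _ ⟨0, rfl⟩)
  have hC10 : 0 ≤ C1 := (norm_nonneg _).trans (hC1' 0)
  have hC2' : ∀ m, ‖jI (q ^ 2) m‖ ≤ C2 := by
    intro m
    unfold jI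
    split_ifs
    · exact hC2 _ ⟨_, rfl⟩
    · simpa using hC20
  have lim : Filter.Tendsto (fun N : ℕ => ∑' j : ℤ, jP (q ^ 2) (2 * N) * jI (q ^ 2) (N - j) *
      jI (q ^ 2) (N + j) * (q ^ (j ^ 2) * x ^ j)) Filter.atTop
      (nhds (∑' j : ℤ, E * E⁻¹ * E⁻¹ * (q ^ (j ^ 2) * x ^ j))) := by
    refine tendsto_tsum_of_dominated_convergence
      (bound := fun j : ℤ => C1 * C2 * C2 * ‖q ^ (j ^ 2) * x ^ j‖)
      ((summable_theta hq).mul_left _) (fun j => ?_) (Filter.Eventually.of_forall fun N j => ?_)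
    · refine Filter.Tendsto.mul_const _ (Filter.Tendsto.mul (Filter.Tendsto.mul ?_ ?_) ?_)
      · exact t1.comp (Filter.tendsto_id.nsmul_atTop (n := 2) (by norm_num))
      · have : Filter.Tendsto (fun N : ℕ => ((N : ℤ) - j).toNat) Filter.atTop Filter.atTop := by
          refine Filter.tendsto_atTop.2 fun b => ?_
          filter_upwards [Filter.eventually_ge_atTop (b + j.toNat)] with N hN
          omega
        refine (t2.comp this).congr' ?_
        filter_upwards [Filter.eventually_ge_atTop j.toNat] with N hN
        simp [jI, show j ≤ (N : ℤ) by omega]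
      · have : Filter.Tendsto (fun N : ℕ => ((N : ℤ) + j).toNat) Filter.atTop Filter.atTop := by
          refine Filter.tendsto_atTop.2 fun b => ?_
          filter_upwards [Filter.eventually_ge_atTop (b + (-j).toNat)] with N hN
          omega
        refine (t2.comp this).congr' ?_
        filter_upwards [Filter.eventually_ge_atTop (-j).toNat] with N hN
        simp [jI, show 0 ≤ (N : ℤ) + j by omega]
    · rw [norm_mul, norm_mul, norm_mul]
      gcongr
      · exact hC1' _
      · exact hC2' _
      · exact hC2' _
  have lim2 : Filter.Tendsto (fun N : ℕ => ∑' j : ℤ, jP (q ^ 2) (2 * N) * jI (q ^ 2) (N - j) *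
      jI (q ^ 2) (N + j) * (q ^ (j ^ 2) * x ^ j)) Filter.atTop
      (nhds (poch (-x * q) (q ^ 2) * poch (-x⁻¹ * q) (q ^ 2))) := by
    refine ((poch_tendsto (-x * q) hQ).mul (poch_tendsto (-x⁻¹ * q) hQ)).congr fun N => ?_
    rw [(jtp_finite hq0 hx hq N).tsum_eq, ← prod_mul_distrib]
    refine prod_congr rfl fun k _ => ?_
    ring
  have := tendsto_nhds_unique lim lim2
  rw [tsum_mul_left, mul_inv_cancel₀ hE0, one_mul] at this
  rw [mul_assoc, ← this, mul_inv_cancel_left₀ hE0]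

lemma tsum_int_mod {f : ℤ → ℂ} (hf : Summable f) (m : ℕ) [NeZero m] :
    ∑' j, f j = ∑ i : Fin m, ∑' k : ℤ, f (k * m + (i : ℕ)) := by
  have h2 : Summable (f ∘ (Int.divModEquiv m).symm) := (Int.divModEquiv m).symm.summable_iff.2 hf
  rw [← (Int.divModEquiv m).symm.tsum_eq f]
  change ∑' c, (f ∘ (Int.divModEquiv m).symm) c = _
  rw [h2.tsum_prod, ← Summable.tsum_comm (f := fun (b : ℤ) (c : Fin m) => (f ∘ (Int.divModEquiv m).symm) (b, c)) (h2.congr fun p => rfl), tsum_fintype]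
  refine sum_congr rfl fun i _ => tsum_congr fun k => ?_
  simp

lemma tsum_int_two {f : ℤ → ℂ} (hf : Summable f) :
    ∑' j, f j = ∑' k : ℤ, f (2 * k) + ∑' k : ℤ, f (2 * k + 1) := by
  rw [tsum_int_mod hf 2, Fin.sum_univ_two]
  congr 1 <;> refine tsum_congr fun k => ?_ <;> congr 1 <;> simp [mul_comm]

lemma tsum_int_three {f : ℤ → ℂ} (hf : Summable f) :
    ∑' j, f j = ∑' k : ℤ, f (3 * k) + ∑' k : ℤ, f (3 * k + 1) + ∑' k : ℤ, f (3 * k + 2) := by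
  rw [tsum_int_mod hf 3, Fin.sum_univ_three]
  congr 1
  · congr 1 <;> refine tsum_congr fun k => ?_ <;> congr 1 <;> simp [mul_comm]
  · refine tsum_congr fun k => ?_
    congr 1
    simp [mul_comm]

noncomputable def EE (q : ℂ) : ℂ := poch q q
noncomputable def phi (q : ℂ) : ℂ := ∑' j : ℤ, q ^ (j ^ 2)
noncomputable def TT (r : ℂ) : ℂ := ∑' k : ℤ, r ^ (k ^ 2 + k)
noncomputable def ff (q : ℂ) : ℂ := ∑' j : ℤ, (-1 : ℂ) ^ j * q ^ (3 * j ^ 2 + 2 * j)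

lemma EE_ne {q : ℂ} (hq : ‖q‖ < 1) : EE q ≠ 0 := poch_ne_zero' hq hq

lemma EE_neg {q : ℂ} (hq : ‖q‖ < 1) : EE (-q) * EE q * EE (q ^ 4) = EE (q ^ 2) ^ 3 := by
  have hq2 := norm_pow_lt hq (n := 2) (by norm_num)
  have h1 := poch_two (-q) (q := -q) (by simpa using hq)
  have h2 := poch_two q hq
  have h3 := poch_two (q ^ 2) hq2
  have h4 := poch_neg q hq2
  rw [show (-q) ^ 2 = q ^ 2 by ring, show -q * -q = q ^ 2 by ring] at h1
  rw [show q * q = q ^ 2 by ring] at h2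
  rw [show q ^ 2 * q ^ 2 = q ^ 4 by ring, show (q ^ 2) ^ 2 = q ^ 4 by ring] at h3
  rw [show (q ^ 2) ^ 2 = q ^ 4 by ring] at h4
  simp only [EE]
  calc poch (-q) (-q) * poch q q * poch (q ^ 4) (q ^ 4) =
      (poch q (q ^ 2) * poch (-q) (q ^ 2)) * poch (q ^ 4) (q ^ 4) * poch (q ^ 2) (q ^ 2) ^ 2 := by
        rw [h1, h2]; ring
    _ = (poch (q ^ 2) (q ^ 4) * poch (q ^ 4) (q ^ 4)) * poch (q ^ 2) (q ^ 2) ^ 2 := by rw [h4]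
    _ = _ := by rw [← h3]; ring

lemma phi_EE {q : ℂ} (hq0 : q ≠ 0) (hq : ‖q‖ < 1) : phi q * EE (q ^ 2) = EE (-q) ^ 2 := by
  have h1 := poch_two (-q) (q := -q) (by simpa using hq)
  rw [show (-q) ^ 2 = q ^ 2 by ring, show -q * -q = q ^ 2 by ring] at h1
  have h := jtp hq0 one_ne_zero hq
  simp only [one_zpow, mul_one, inv_one, neg_mul, one_mul] at h
  rw [phi, h, EE, EE, h1]
  ring

lemma phi_neg_EE {q : ℂ} (hq0 : q ≠ 0) (hq : ‖q‖ < 1) : phi (-q) * EE (q ^ 2) = EE q ^ 2 := by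
  have := phi_EE (q := -q) (neg_ne_zero.2 hq0) (by simpa using hq)
  simpa using this

lemma TT_EE {r : ℂ} (hr0 : r ≠ 0) (hr : ‖r‖ < 1) : TT r * EE (r ^ 2) = 2 * EE (r ^ 4) ^ 2 := by
  have hr2 := norm_pow_lt hr (n := 2) (by norm_num)
  have h := jtp hr0 hr0 hr
  have h1 := poch_succ (-1) hr2
  have h2 := poch_neg (r ^ 2) hr2
  rw [show (r ^ 2) ^ 2 = r ^ 4 by ring] at h2
  have e : TT r = ∑' j : ℤ, r ^ (j ^ 2) * r ^ j := tsum_congr fun j => zpow_add₀ hr0 _ _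
  rw [e, h, EE, EE, ← h2]
  rw [show -r⁻¹ * r = -1 by field_simp, h1, show -r * r = - r ^ 2 by ring, show -1 * r ^ 2 = - r ^ 2 by ring]
  ring

lemma ff_EE {q : ℂ} (hq0 : q ≠ 0) (hq : ‖q‖ < 1) :
    ff q * EE (q ^ 2) * EE (q ^ 3) = EE q * EE (q ^ 6) ^ 2 := by
  have hq2 := norm_pow_lt hq (n := 2) (by norm_num)
  have hq3 := norm_pow_lt hq (n := 3) (by norm_num)
  have h := jtp (q := q ^ 3) (x := - q ^ 2) (pow_ne_zero _ hq0)
    (neg_ne_zero.2 (pow_ne_zero _ hq0)) hq3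
  have e : ff q = ∑' j : ℤ, (q ^ 3) ^ (j ^ 2) * (- q ^ 2) ^ j := by
    refine tsum_congr fun j => ?_
    rw [zpow_add₀ hq0, zpow_mul, zpow_mul, neg_eq_neg_one_mul (q ^ 2), mul_zpow]
    norm_cast
    ring
  have h1 := poch_two q hq
  have h2 := poch_three q hq2
  have h3 := poch_two (q ^ 3) hq3
  rw [e, h, EE, EE, EE, EE, h1, h3]
  rw [show q * q = q ^ 2 by ring, h2]
  have i1 : -(- q ^ 2)⁻¹ * q ^ 3 = q := by field_simp
  rw [i1]
  simp only [← pow_mul, ← pow_add, neg_neg]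
  norm_num only
  rw [show q * q ^ 2 = q ^ 3 by ring, show q * q ^ 4 = q ^ 5 by ring]
  ring

lemma phi_mul_neg {q : ℂ} (hq0 : q ≠ 0) (hq : ‖q‖ < 1) :
    phi q * phi (-q) = phi (-q ^ 2) ^ 2 := by
  have h1 := phi_EE hq0 hq
  have h2 := phi_neg_EE hq0 hq
  have hq2 := norm_pow_lt hq (n := 2) (by norm_num)
  have h3 := phi_neg_EE (q := q ^ 2) (pow_ne_zero _ hq0) hq2
  have h4 := EE_neg hq
  rw [show (q ^ 2) ^ 2 = q ^ 4 by ring] at h3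
  have n2 := EE_ne hq2
  have n4 := EE_ne (norm_pow_lt hq (n := 4) (by norm_num))
  have : (phi q * phi (-q)) * (EE (q ^ 2) ^ 2 * EE (q ^ 4) ^ 2) =
      phi (-q ^ 2) ^ 2 * (EE (q ^ 2) ^ 2 * EE (q ^ 4) ^ 2) := by
    calc _ = (phi q * EE (q ^ 2)) * (phi (-q) * EE (q ^ 2)) * EE (q ^ 4) ^ 2 := by ring
      _ = (EE (-q) * EE q * EE (q ^ 4)) ^ 2 := by rw [h1, h2]; ring
      _ = (EE (q ^ 2) ^ 2) ^ 2 * EE (q ^ 2) ^ 2 := by rw [h4]; ring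
      _ = _ := by rw [← h3]; ring
  exact mul_right_cancel₀ (by positivity) this

lemma TT_sq {r : ℂ} (hr0 : r ≠ 0) (hr : ‖r‖ < 1) : TT r ^ 2 = 2 * phi (r ^ 2) * TT (r ^ 2) := by
  have hr2 := norm_pow_lt hr (n := 2) (by norm_num)
  have h1 := TT_EE hr0 hr
  have h2 := TT_EE (pow_ne_zero 2 hr0) hr2
  have h3 := phi_EE (pow_ne_zero 2 hr0) hr2
  have h4 := EE_neg hr2
  simp only [← pow_mul] at h2 h3 h4
  norm_num only at h2 h3 h4
  have n2 := EE_ne hr2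
  have n4 := EE_ne (norm_pow_lt hr (n := 4) (by norm_num))
  have : TT r ^ 2 * (EE (r ^ 2) ^ 2 * EE (r ^ 4) ^ 2) =
     (2 * phi (r ^ 2) * TT (r ^ 2)) * (EE (r ^ 2) ^ 2 * EE (r ^ 4) ^ 2) := by
    calc _ = (TT r * EE (r ^ 2)) ^ 2 * EE (r ^ 4) ^ 2 := by ring
      _ = 4 * (EE (r ^ 4) ^ 3) ^ 2 := by rw [h1]; ring
      _ = (2 * (EE (-r ^ 2) ^ 2) * (2 * EE (r ^ 8) ^ 2)) * EE (r ^ 2) ^ 2 := by rw [← h4]; ring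
      _ = _ := by rw [← h2, ← h3]; ring
  exact mul_right_cancel₀ (by positivity) this

lemma summable_phi {q : ℂ} (hq : ‖q‖ < 1) : Summable fun j : ℤ => ‖q ^ (j ^ 2)‖ := by
  simpa using summable_theta (x := 1) hq

lemma summable_TT {q : ℂ} (hq0 : q ≠ 0) (hq : ‖q‖ < 1) :
    Summable fun j : ℤ => ‖q ^ (j ^ 2 + j)‖ := by
  refine (summable_theta (x := q) hq).congr fun j => by rw [zpow_add₀ hq0]

/-- S1 -/
lemma phi_split {q : ℂ} (hq0 : q ≠ 0) (hq : ‖q‖ < 1) : phi q = phi (q ^ 4) + q * TT (q ^ 4) := by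
  rw [phi, tsum_int_two (summable_phi hq).of_norm, phi, TT, ← tsum_mul_left]
  congr 1 <;> refine tsum_congr fun k => ?_
  · rw [← zpow_natCast q 4, ← zpow_mul]; congr 1; push_cast; ring
  · rw [← zpow_natCast q 4, ← zpow_mul]
    nth_rewrite 2 [← zpow_one q]
    rw [← zpow_add₀ hq0]; congr 1; push_cast; ring

/-- L5 -/
lemma phi_cubic {r : ℂ} (hr0 : r ≠ 0) (hr : ‖r‖ < 1) :
    phi (-r) = phi (-r ^ 9) - 2 * r * ff (r ^ 3) := by
  have hs : ∀ j : ℤ, (-1 : ℂ) ^ (j ^ 2) = (-1) ^ j := by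
    intro j
    rcases Int.even_or_odd j with h | h
    · rw [h.neg_one_zpow, (h.pow_of_ne_zero (by norm_num)).neg_one_zpow]
    · rw [h.neg_one_zpow, h.pow.neg_one_zpow]
  have hp : ∀ (x : ℂ) (j : ℤ), (-x) ^ (j ^ 2) = (-1) ^ j * x ^ (j ^ 2) := by
    intro x j
    rw [neg_eq_neg_one_mul, mul_zpow, hs]
  have hm : (-1 : ℂ) ≠ 0 := by norm_num
  have e3 : ∀ k : ℤ, (-1 : ℂ) ^ (3 * k) = (-1) ^ k := by
    intro k; rw [zpow_mul]; norm_num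
  rw [phi, tsum_int_three (summable_phi (by simpa using hr)).of_norm]
  have t1 : ∑' k : ℤ, (-r) ^ ((3 * k) ^ 2) = phi (-r ^ 9) := by
    refine tsum_congr fun k => ?_
    rw [hp, hp, e3, ← zpow_natCast r 9, ← zpow_mul]
    congr 2; push_cast; ring
  have t2 : ∑' k : ℤ, (-r) ^ ((3 * k + 1) ^ 2) = - r * ff (r ^ 3) := by
    rw [ff, ← tsum_mul_left]
    refine tsum_congr fun k => ?_
    rw [hp, zpow_add₀ hm, e3, ← zpow_natCast r 3, ← zpow_mul]
    rw [show (3 * k + 1) ^ 2 = 1 + ((3 : ℕ) : ℤ) * (3 * k ^ 2 + 2 * k) by push_cast; ring, zpow_add₀ hr0]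
    simp only [zpow_one]; ring
  have t3 : ∑' k : ℤ, (-r) ^ ((3 * k + 2) ^ 2) = ∑' k : ℤ, (-r) ^ ((3 * k + 1) ^ 2) := by
    rw [← (Equiv.subLeft (-1 : ℤ)).tsum_eq]
    refine tsum_congr fun k => ?_
    congr 1
    simp only [Equiv.subLeft_apply]; ring
  rw [t3, t1, t2]; ring

lemma TT_two {r : ℂ} (hr0 : r ≠ 0) (hr : ‖r‖ < 1) (n : ℤ) :
    TT r = 2 * ∑' k : ℤ, r ^ ((n + 2 * k) ^ 2 + (n + 2 * k)) := by
  have hs := (summable_TT hr0 hr).of_norm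
  have hs' : Summable fun j : ℤ => r ^ ((j + n) ^ 2 + (j + n)) := by
    have := (Equiv.addRight n).summable_iff.2 hs
    simpa only [Function.comp_def, Equiv.coe_addRight] using this
  rw [TT, ← (Equiv.addRight n).tsum_eq (fun k : ℤ => r ^ (k ^ 2 + k))]
  simp only [Equiv.coe_addRight]
  rw [tsum_int_two hs', two_mul]
  congr 1
  · refine tsum_congr fun k => ?_
    congr 1; ring
  · rw [← (Equiv.subLeft (-1 - n : ℤ)).tsum_eq (fun k : ℤ => r ^ ((n + 2 * k) ^ 2 + (n + 2 * k)))]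
    refine tsum_congr fun k => ?_
    congr 1
    simp only [Equiv.subLeft_apply]; ring

/-- S3 -/
lemma TT_mul {r : ℂ} (hr0 : r ≠ 0) (hr : ‖r‖ < 1) :
    TT r * TT (r ^ 3) = 2 * (phi (r ^ 12) * TT (r ^ 4) + r ^ 2 * phi (r ^ 4) * TT (r ^ 12)) := by
  have hr3 := norm_pow_lt hr (n := 3) (by norm_num)
  have s1 := summable_TT hr0 hr
  have s3 := summable_TT (pow_ne_zero 3 hr0) hr3
  have s := summable_mul_of_summable_norm s1 s3
  have hinj : Function.Injective (fun p : ℤ × ℤ => (p.1 + 2 * p.2, p.1)) := by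
    rintro ⟨a, b⟩ ⟨c, d⟩ h
    simp only [Prod.mk.injEq] at h ⊢
    omega
  have s' := s.comp_injective hinj
  have s2 : Summable (Function.uncurry fun n k : ℤ =>
      r ^ ((n + 2 * k) ^ 2 + (n + 2 * k)) * (r ^ 3) ^ (n ^ 2 + n)) := by
    refine s'.congr fun p => ?_
    simp only [Function.comp_def, Function.uncurry]
  have s4 : Summable fun k : ℤ => ∑' n : ℤ,
      r ^ ((n + 2 * k) ^ 2 + (n + 2 * k)) * (r ^ 3) ^ (n ^ 2 + n) := s2.prod_symm.prod
  have h1 : TT r * TT (r ^ 3) = 2 * ∑' n : ℤ, ∑' k : ℤ,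
      r ^ ((n + 2 * k) ^ 2 + (n + 2 * k)) * (r ^ 3) ^ (n ^ 2 + n) := by
    rw [← tsum_mul_left, mul_comm, TT, ← tsum_mul_right]
    refine tsum_congr fun n => ?_
    rw [TT_two hr0 hr n, tsum_mul_right]; ring
  rw [h1, ← Summable.tsum_comm s2, tsum_int_two s4]
  congr 2
  · rw [phi, ← tsum_mul_right]
    refine tsum_congr fun k => ?_
    rw [TT, ← (Equiv.addRight k).tsum_eq (fun k : ℤ => (r ^ 4) ^ (k ^ 2 + k)), ← tsum_mul_left]
    refine tsum_congr fun n => ?_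
    simp only [Equiv.coe_addRight, ← zpow_natCast, ← zpow_mul, ← zpow_add₀ hr0]
    congr 1; push_cast; ring
  · rw [TT, ← tsum_mul_left]
    refine tsum_congr fun k => ?_
    rw [phi, ← (Equiv.addRight (k + 1)).tsum_eq (fun k : ℤ => (r ^ 4) ^ (k ^ 2)), ← tsum_mul_left, ← tsum_mul_right]
    refine tsum_congr fun n => ?_
    simp only [Equiv.coe_addRight, ← zpow_natCast, ← zpow_mul, ← zpow_add₀ hr0]
    congr 1; push_cast; ring

lemma mlemma_core {s w P R : ℝ} (hs : 0 < s) (hw : 0 < w) (hP : 0 < P) (hR : 0 < R)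
    (h1 : s + w = 1) (h2 : P * s + R * w = 1) (h3 : R * s ^ 3 + P * w ^ 3 = P * R)
    (hlt : P * (P * s) < s ^ 3) :
    √R = 1 + √P ∧ P < 1 ∧ w * (1 + 2 * √P) = 1 - P := by
  have hPs : P < s := by
    have : P ^ 2 < s ^ 2 := by
      have : P ^ 2 * s < s ^ 2 * s := by nlinarith
      exact lt_of_mul_lt_mul_right this hs.le
    exact lt_of_pow_lt_pow_left₀ 2 hs.le this
  have hP1 : P < 1 := by linarith
  have hR1 : 1 < R := by
    have : w * 1 < w * R := by nlinarith
    exact lt_of_mul_lt_mul_left this hw.le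
  have hw' : (R - P) * w = 1 - P := by linear_combination h2 - P * h1
  have hs' : (R - P) * s = R - 1 := by linear_combination -h2 + R * h1
  have key : (R - P) * (R - 1) * (1 - P) * (R ^ 2 + P ^ 2 + 1 - 2 * R * P - 2 * R - 2 * P) = 0 := by
    have e1 : R * (R - 1) ^ 3 + P * (1 - P) ^ 3 - P * R * (R - P) ^ 3 = 0 := by
      rw [← hs', ← hw']
      linear_combination (R - P) ^ 3 * h3
    linear_combination e1
  have key2 : R ^ 2 + P ^ 2 + 1 - 2 * R * P - 2 * R - 2 * P = 0 := by
    have hne : (R - P) * (R - 1) * (1 - P) ≠ 0 := by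
      have : 0 < (R - P) * (R - 1) * (1 - P) :=
        mul_pos (mul_pos (by linarith) (by linarith)) (by linarith)
      exact this.ne'
    exact (mul_eq_zero.1 key).resolve_left hne
  set p := √P with hp
  set r := √R with hr
  have hp0 : 0 < p := Real.sqrt_pos.2 hP
  have hp2 : p ^ 2 = P := Real.sq_sqrt hP.le
  have hr2 : r ^ 2 = R := Real.sq_sqrt hR.le
  have hr0 : 0 < r := Real.sqrt_pos.2 hR
  have hp1 : p < 1 := by nlinarith
  have hr1 : 1 < r := by nlinarith
  have hrp : r = 1 + p := by
    have e : (r - p - 1) * ((r + p + 1) * (r + p - 1) * (r - p + 1)) = 0 := by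
      rw [← hp2, ← hr2] at key2
      linear_combination key2
    have hne : (r + p + 1) * (r + p - 1) * (r - p + 1) ≠ 0 := by
      have : 0 < (r + p + 1) * (r + p - 1) * (r - p + 1) :=
        mul_pos (mul_pos (by linarith) (by linarith)) (by linarith)
      exact this.ne'
    have := (mul_eq_zero.1 e).resolve_right hne
    linarith
  refine ⟨hrp, hP1, ?_⟩
  rw [← hw', ← hr2, ← hp2, hrp]; ring

lemma mlemma_alg {X Y Z X3 Y3 Z3 : ℝ} (hX : 0 < X) (hY : 0 < Y) (hZ : 0 < Z) (hX3 : 0 < X3)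
    (hY3 : 0 < Y3) (hZ3 : 0 < Z3) (h1 : X ^ 4 = Y ^ 4 + Z ^ 4) (h2 : X3 ^ 4 = Y3 ^ 4 + Z3 ^ 4)
    (h3 : X * X3 = Y * Y3 + Z * Z3) (hXX : X3 ≤ X) (hYY : Y < Y3)
    (hc : (Y3 ^ 4 - Y ^ 4) ^ 2 * (X * Z) = 16 * Y ^ 2 * Y3 ^ 2 * X3 ^ 3 * Z3 ^ 3) :
    ∃ p : ℝ, 0 < p ∧ p < 1 ∧ X ^ 2 = (1 + 2 * p) * X3 ^ 2 ∧ p * Z ^ 2 = (2 + p) * Z3 ^ 2 ∧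
      (1 + p) * Y ^ 2 = (1 - p) * Y3 ^ 2 ∧ X * Z * Z3 = p * (2 + p) * X3 ^ 3 ∧
      X * Y * Y3 = (1 - p ^ 2) * X3 ^ 3 ∧ p ^ 2 * (Z * X3 ^ 3) = Z3 ^ 3 * X ∧
      (1 + p) ^ 2 * (Y * X3 ^ 3) = Y3 ^ 3 * X := by
  set P := Z3 ^ 3 * X / (Z * X3 ^ 3) with hPd
  set R := Y3 ^ 3 * X / (Y * X3 ^ 3) with hRd
  set s := Z * Z3 / (X * X3) with hsd
  set w := Y * Y3 / (X * X3) with hwd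
  have hP : 0 < P := by positivity
  have hR : 0 < R := by positivity
  have hs : 0 < s := by positivity
  have hw : 0 < w := by positivity
  have ePs : P * s = Z3 ^ 4 / X3 ^ 4 := by rw [hPd, hsd]; field_simp
  have eRw : R * w = Y3 ^ 4 / X3 ^ 4 := by rw [hRd, hwd]; field_simp
  have es : s ^ 3 = P * (Z ^ 4 / X ^ 4) := by rw [hPd, hsd]; field_simp
  have ew : w ^ 3 = R * (Y ^ 4 / X ^ 4) := by rw [hRd, hwd]; field_simp
  have a1 : s + w = 1 := by
    rw [hsd, hwd, ← add_div, div_eq_one_iff_eq (by positivity)]; linarith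
  have a2 : P * s + R * w = 1 := by
    rw [ePs, eRw, ← add_div, div_eq_one_iff_eq (by positivity)]; linarith
  have a3 : R * s ^ 3 + P * w ^ 3 = P * R := by
    have : Z ^ 4 / X ^ 4 + Y ^ 4 / X ^ 4 = 1 := by
      rw [← add_div, div_eq_one_iff_eq (by positivity)]; linarith
    rw [es, ew]; linear_combination P * R * this
  have a4 : P * (P * s) < s ^ 3 := by
    rw [es, ePs]
    apply mul_lt_mul_of_pos_left _ hP
    have e1 : Z3 ^ 4 / X3 ^ 4 = 1 - Y3 ^ 4 / X3 ^ 4 := by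
      rw [eq_sub_iff_add_eq, ← add_div, div_eq_one_iff_eq (by positivity)]; linarith
    have e2 : Z ^ 4 / X ^ 4 = 1 - Y ^ 4 / X ^ 4 := by
      rw [eq_sub_iff_add_eq, ← add_div, div_eq_one_iff_eq (by positivity)]; linarith
    rw [e1, e2]
    have : Y ^ 4 / X ^ 4 < Y3 ^ 4 / X3 ^ 4 := by
      calc Y ^ 4 / X ^ 4 < Y3 ^ 4 / X ^ 4 := by gcongr
        _ ≤ Y3 ^ 4 / X3 ^ 4 := by gcongr
    linarith
  obtain ⟨hr, hP1, hwp⟩ := mlemma_core hs hw hP hR a1 a2 a3 a4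
  set p := √P with hp
  have hp0 : 0 < p := Real.sqrt_pos.2 hP
  have hp2 : p ^ 2 = P := Real.sq_sqrt hP.le
  have hR2 : (1 + p) ^ 2 = R := by rw [← hr]; exact Real.sq_sqrt hR.le
  have hp1 : p < 1 := by nlinarith
  have hPe : P * (Z * X3 ^ 3) = Z3 ^ 3 * X := by rw [hPd]; field_simp
  have hRe : R * (Y * X3 ^ 3) = Y3 ^ 3 * X := by rw [hRd]; field_simp
  have hwe : w * (X * X3) = Y * Y3 := by rw [hwd]; field_simp
  have hse : s * (X * X3) = Z * Z3 := by rw [hsd]; field_simp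
  -- the cubic
  have c1 : (Y3 ^ 4 - Y ^ 4) ^ 2 = (4 * w * p * X3 ^ 4) ^ 2 := by
    have : (Y3 ^ 4 - Y ^ 4) ^ 2 * (X * Z) = (4 * w * p * X3 ^ 4) ^ 2 * (X * Z) := by
      rw [hc]
      have : 16 * Y ^ 2 * Y3 ^ 2 * X3 ^ 3 * Z3 ^ 3 = 16 * (Y * Y3) ^ 2 * X3 ^ 3 * Z3 ^ 3 := by ring
      rw [this, ← hwe]
      have e : (4 * w * p * X3 ^ 4) ^ 2 * (X * Z) = 16 * w ^ 2 * (p ^ 2 * (Z * X3 ^ 3)) * X * X3 ^ 5 := by ring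
      rw [e, hp2, hPe]; ring
    exact mul_right_cancel₀ (by positivity) this
  have c2 : Y3 ^ 4 - Y ^ 4 = 4 * w * p * X3 ^ 4 := by
    have : 0 < Y3 ^ 4 - Y ^ 4 := by
      have := pow_lt_pow_left₀ hYY hY.le (n := 4) (by norm_num)
      linarith
    exact (sq_eq_sq₀ this.le (by positivity)).1 c1
  have c3 : Y3 ^ 4 = R * w * X3 ^ 4 := by rw [eRw]; field_simp
  have c4 : R * Y ^ 4 = w ^ 3 * X ^ 4 := by rw [ew]; field_simp
  have c5 : (w * X ^ 2) ^ 2 = ((1 - P) * X3 ^ 2) ^ 2 := by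
    have : w * (w * X ^ 2) ^ 2 = w * ((1 - P) * X3 ^ 2) ^ 2 := by
      have : R * (R * w * X3 ^ 4 - 4 * w * p * X3 ^ 4) = w ^ 3 * X ^ 4 := by
        rw [← c4, ← c3, ← c2]; ring
      rw [← hp2]
      rw [← hR2] at this
      linear_combination -this
    exact mul_left_cancel₀ hw.ne' this
  have c6 : w * X ^ 2 = (1 - P) * X3 ^ 2 := by
    have h0 : 0 < (1 - P) * X3 ^ 2 := mul_pos (by linarith) (by positivity)
    exact (sq_eq_sq₀ (by positivity) h0.le).1 c5
  have m1 : X ^ 2 = (1 + 2 * p) * X3 ^ 2 := by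
    have : w * X ^ 2 = w * ((1 + 2 * p) * X3 ^ 2) := by rw [c6, ← hwp]; ring
    exact mul_left_cancel₀ hw.ne' this
  have m3 : X * Y * Y3 = (1 - p ^ 2) * X3 ^ 3 := by
    rw [hp2, mul_assoc, ← hwe]; linear_combination X3 * c6
  have hsp : s * (1 + 2 * p) = p * (2 + p) := by
    rw [← hp2] at hwp
    linear_combination (1 + 2 * p) * a1 - hwp
  have m2 : X * Z * Z3 = p * (2 + p) * X3 ^ 3 := by
    rw [mul_assoc, ← hse]
    linear_combination s * X3 * m1 + X3 ^ 3 * hsp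
  refine ⟨p, hp0, hp1, m1, ?_, ?_, m2, m3, by rw [hp2]; exact hPe, by rw [hR2]; exact hRe⟩
  · have : (p * X3 ^ 3) * (p * Z ^ 2) = (p * X3 ^ 3) * ((2 + p) * Z3 ^ 2) := by
      rw [← hp2] at hPe
      linear_combination Z * hPe + Z3 ^ 2 * m2
    exact mul_left_cancel₀ (by positivity) this
  · have : ((1 + p) * X3 ^ 3) * ((1 + p) * Y ^ 2) = ((1 + p) * X3 ^ 3) * ((1 - p) * Y3 ^ 2) := by
      rw [← hR2] at hRe
      linear_combination Y * hRe + Y3 ^ 2 * m3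
    exact mul_left_cancel₀ (by positivity) this

/-! real versions -/

noncomputable def er (y : ℝ) : ℝ := ∏' k : ℕ, (1 - y * y ^ k)

lemma norm_real_lt {y : ℝ} (h0 : 0 < y) (h1 : y < 1) : ‖(y : ℂ)‖ < 1 := by
  rw [Complex.norm_real, Real.norm_of_nonneg h0.le]; exact h1

lemma er_mult {y : ℝ} (h0 : 0 < y) (h1 : y < 1) : Multipliable fun k : ℕ => (1 - y * y ^ k) := by
  have h : Summable fun k : ℕ => ‖-(y * y ^ k)‖ := by
    simp only [norm_neg, norm_mul, norm_pow]
    refine (summable_geometric_of_lt_one (norm_nonneg _) ?_).mul_left _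
    rwa [Real.norm_of_nonneg h0.le]
  simpa [sub_eq_add_neg] using multipliable_one_add_of_summable h

lemma er_cast {y : ℝ} (h0 : 0 < y) (h1 : y < 1) : EE (y : ℂ) = (er y : ℂ) := by
  have h2 := poch_tendsto (y : ℂ) (norm_real_lt h0 h1)
  have h3 := (Complex.continuous_ofReal.tendsto _).comp (er_mult h0 h1).hasProd.tendsto_prod_nat
  refine tendsto_nhds_unique h2 (h3.congr fun N => ?_)
  simp

lemma er_pos {y : ℝ} (h0 : 0 < y) (h1 : y < 1) : 0 < er y := by
  have hne : er y ≠ 0 := by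
    intro h
    apply EE_ne (norm_real_lt h0 h1)
    rw [er_cast h0 h1, h]; simp
  have hm := er_mult h0 h1
  have : 0 ≤ er y := ge_of_tendsto' hm.hasProd.tendsto_prod_nat fun N => by
    refine prod_nonneg fun k _ => ?_
    rw [sub_nonneg, ← pow_succ']
    exact pow_le_one₀ h0.le h1.le
  exact lt_of_le_of_ne this (Ne.symm hne)

noncomputable def fP (y : ℝ) : ℝ := er (y ^ 2) ^ 5 / (er y ^ 2 * er (y ^ 4) ^ 2)
noncomputable def fM (y : ℝ) : ℝ := er y ^ 2 / er (y ^ 2)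
noncomputable def fT (y : ℝ) : ℝ := 2 * er (y ^ 4) ^ 2 / er (y ^ 2)
noncomputable def fF (y : ℝ) : ℝ := er y * er (y ^ 6) ^ 2 / (er (y ^ 2) * er (y ^ 3))

lemma erp_pos {y : ℝ} (h0 : 0 < y) (h1 : y < 1) {n : ℕ} (hn : n ≠ 0) : 0 < er (y ^ n) :=
  er_pos (pow_pos h0 n) (pow_lt_one₀ h0.le h1 hn)

lemma fP_pos {y : ℝ} (h0 : 0 < y) (h1 : y < 1) : 0 < fP y := by
  have := er_pos h0 h1
  have := erp_pos h0 h1 (n := 2) (by norm_num)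
  have := erp_pos h0 h1 (n := 4) (by norm_num)
  unfold fP; positivity

lemma fM_pos {y : ℝ} (h0 : 0 < y) (h1 : y < 1) : 0 < fM y := by
  have := er_pos h0 h1
  have := erp_pos h0 h1 (n := 2) (by norm_num)
  unfold fM; positivity

lemma fT_pos {y : ℝ} (h0 : 0 < y) (h1 : y < 1) : 0 < fT y := by
  have := erp_pos h0 h1 (n := 2) (by norm_num)
  have := erp_pos h0 h1 (n := 4) (by norm_num)
  unfold fT; positivity

lemma fF_pos {y : ℝ} (h0 : 0 < y) (h1 : y < 1) : 0 < fF y := by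
  have := er_pos h0 h1
  have := erp_pos h0 h1 (n := 2) (by norm_num)
  have := erp_pos h0 h1 (n := 3) (by norm_num)
  have := erp_pos h0 h1 (n := 6) (by norm_num)
  unfold fF; positivity

lemma er_castp {y : ℝ} (h0 : 0 < y) (h1 : y < 1) {n : ℕ} (hn : n ≠ 0) : EE ((y : ℂ) ^ n) = (er (y ^ n) : ℂ) := by
  rw [← er_cast (pow_pos h0 n) (pow_lt_one₀ h0.le h1 hn)]; push_cast; rfl

lemma er_ne_castp {y : ℝ} (h0 : 0 < y) (h1 : y < 1) {n : ℕ} (hn : n ≠ 0) : (er (y ^ n) : ℂ) ≠ 0 := by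
  exact_mod_cast (erp_pos h0 h1 hn).ne'

lemma phi_cast {y : ℝ} (h0 : 0 < y) (h1 : y < 1) : phi (y : ℂ) = (fP y : ℂ) := by
  have hy0 : (y : ℂ) ≠ 0 := by exact_mod_cast h0.ne'
  have hy := norm_real_lt h0 h1
  have a := phi_EE hy0 hy
  have b := EE_neg hy
  have n1 : (er y : ℂ) ≠ 0 := by exact_mod_cast (er_pos h0 h1).ne'
  have n2 := er_ne_castp h0 h1 (n := 2) (by norm_num)
  have n4 := er_ne_castp h0 h1 (n := 4) (by norm_num)
  rw [er_castp h0 h1 (by norm_num)] at a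
  rw [er_castp h0 h1 (by norm_num), er_castp h0 h1 (by norm_num), er_cast h0 h1] at b
  have e : EE (-(y : ℂ)) = er (y ^ 2) ^ 3 / (er y * er (y ^ 4)) := by
    rw [eq_div_iff (by positivity)]; linear_combination b
  rw [e] at a
  have : phi (y : ℂ) = (er (y ^ 2) ^ 3 / (er y * er (y ^ 4))) ^ 2 / er (y ^ 2) := by
    rw [eq_div_iff n2]; exact a
  rw [this, fP]; push_cast
  field_simp

lemma phi_neg_cast {y : ℝ} (h0 : 0 < y) (h1 : y < 1) : phi (-(y : ℂ)) = (fM y : ℂ) := by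
  have hy0 : (y : ℂ) ≠ 0 := by exact_mod_cast h0.ne'
  have hy := norm_real_lt h0 h1
  have a := phi_neg_EE hy0 hy
  have n2 := er_ne_castp h0 h1 (n := 2) (by norm_num)
  rw [er_castp h0 h1 (by norm_num), er_cast h0 h1] at a
  rw [fM]; push_cast
  rw [eq_div_iff n2, a]

lemma TT_cast {y : ℝ} (h0 : 0 < y) (h1 : y < 1) : TT (y : ℂ) = (fT y : ℂ) := by
  have hy0 : (y : ℂ) ≠ 0 := by exact_mod_cast h0.ne'
  have hy := norm_real_lt h0 h1
  have a := TT_EE hy0 hy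
  have n2 := er_ne_castp h0 h1 (n := 2) (by norm_num)
  rw [er_castp h0 h1 (by norm_num), er_castp h0 h1 (by norm_num)] at a
  rw [fT]; push_cast
  rw [eq_div_iff n2, a]

lemma ff_cast {y : ℝ} (h0 : 0 < y) (h1 : y < 1) : ff (y : ℂ) = (fF y : ℂ) := by
  have hy0 : (y : ℂ) ≠ 0 := by exact_mod_cast h0.ne'
  have hy := norm_real_lt h0 h1
  have a := ff_EE hy0 hy
  have n2 := er_ne_castp h0 h1 (n := 2) (by norm_num)
  have n3 := er_ne_castp h0 h1 (n := 3) (by norm_num)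
  rw [er_castp h0 h1 (by norm_num), er_castp h0 h1 (by norm_num), er_castp h0 h1 (by norm_num), er_cast h0 h1] at a
  rw [fF]; push_cast
  rw [eq_div_iff (mul_ne_zero n2 n3), ← mul_assoc, a]

lemma fP_split {y : ℝ} (h0 : 0 < y) (h1 : y < 1) : fP y = fP (y ^ 4) + y * fT (y ^ 4) := by
  have hy0 : (y : ℂ) ≠ 0 := by exact_mod_cast h0.ne'
  have h := phi_split hy0 (norm_real_lt h0 h1)
  have h4 : 0 < y ^ 4 := pow_pos h0 4
  have h4' : y ^ 4 < 1 := pow_lt_one₀ h0.le h1 (by norm_num)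
  rw [← Complex.ofReal_pow, phi_cast h0 h1, phi_cast h4 h4', TT_cast h4 h4'] at h
  exact_mod_cast h

lemma fM_split {y : ℝ} (h0 : 0 < y) (h1 : y < 1) : fM y = fP (y ^ 4) - y * fT (y ^ 4) := by
  have hy0 : (y : ℂ) ≠ 0 := by exact_mod_cast h0.ne'
  have h := phi_split (neg_ne_zero.2 hy0) (by simpa using norm_real_lt h0 h1)
  have h4 : 0 < y ^ 4 := pow_pos h0 4
  have h4' : y ^ 4 < 1 := pow_lt_one₀ h0.le h1 (by norm_num)
  rw [show (-(y : ℂ)) ^ 4 = (y : ℂ) ^ 4 by ring] at h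
  rw [← Complex.ofReal_pow, phi_neg_cast h0 h1, phi_cast h4 h4', TT_cast h4 h4'] at h
  rw [sub_eq_add_neg, ← neg_mul]
  exact_mod_cast h

lemma phi_I {y : ℝ} (h0 : 0 < y) (h1 : y < 1) :
    phi (I * y) = fP (y ^ 4) + I * (y * fT (y ^ 4)) := by
  have hy0 : (y : ℂ) ≠ 0 := by exact_mod_cast h0.ne'
  have h := phi_split (mul_ne_zero I_ne_zero hy0) (by simpa using norm_real_lt h0 h1)
  have h4 : 0 < y ^ 4 := pow_pos h0 4
  have h4' : y ^ 4 < 1 := pow_lt_one₀ h0.le h1 (by norm_num)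
  rw [show (I * (y : ℂ)) ^ 4 = (y : ℂ) ^ 4 by rw [mul_pow, I_pow_four, one_mul]] at h
  rw [← Complex.ofReal_pow, phi_cast h4 h4', TT_cast h4 h4'] at h
  rw [h]; ring

lemma phi_negI {y : ℝ} (h0 : 0 < y) (h1 : y < 1) :
    phi (-(I * y)) = fP (y ^ 4) - I * (y * fT (y ^ 4)) := by
  have hy0 : (y : ℂ) ≠ 0 := by exact_mod_cast h0.ne'
  have h := phi_split (neg_ne_zero.2 (mul_ne_zero I_ne_zero hy0)) (by simpa using norm_real_lt h0 h1)
  have h4 : 0 < y ^ 4 := pow_pos h0 4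
  have h4' : y ^ 4 < 1 := pow_lt_one₀ h0.le h1 (by norm_num)
  rw [show (-(I * (y : ℂ))) ^ 4 = (y : ℂ) ^ 4 by rw [neg_pow, mul_pow, I_pow_four]; ring] at h
  rw [← Complex.ofReal_pow, phi_cast h4 h4', TT_cast h4 h4'] at h
  rw [h]; ring

lemma fPM {y : ℝ} (h0 : 0 < y) (h1 : y < 1) : fP y * fM y = fM (y ^ 2) ^ 2 := by
  have hy0 : (y : ℂ) ≠ 0 := by exact_mod_cast h0.ne'
  have h := phi_mul_neg hy0 (norm_real_lt h0 h1)
  have h4 : 0 < y ^ 2 := pow_pos h0 2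
  have h4' : y ^ 2 < 1 := pow_lt_one₀ h0.le h1 (by norm_num)
  rw [← Complex.ofReal_pow, phi_cast h0 h1, phi_neg_cast h0 h1, phi_neg_cast h4 h4'] at h
  exact_mod_cast h

lemma fP_sq {y : ℝ} (h0 : 0 < y) (h1 : y < 1) :
    fP (y ^ 2) ^ 2 = fP (y ^ 4) ^ 2 + (y * fT (y ^ 4)) ^ 2 := by
  have hy0 : (y : ℂ) ≠ 0 := by exact_mod_cast h0.ne'
  have h := phi_mul_neg (mul_ne_zero I_ne_zero hy0) (by simpa using norm_real_lt h0 h1)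
  have h4 : 0 < y ^ 2 := pow_pos h0 2
  have h4' : y ^ 2 < 1 := pow_lt_one₀ h0.le h1 (by norm_num)
  rw [phi_I h0 h1, phi_negI h0 h1, show -(I * (y : ℂ)) ^ 2 = ((y ^ 2 : ℝ) : ℂ) by
    rw [mul_pow, I_sq]; push_cast; ring, phi_cast h4 h4'] at h
  have : ((fP (y ^ 2) : ℝ) : ℂ) ^ 2 = fP (y ^ 4) ^ 2 + (y * fT (y ^ 4)) ^ 2 := by
    rw [← h]; linear_combination (-(y * fT (y ^ 4)) ^ 2 : ℂ) * I_sq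
  exact_mod_cast this

lemma fT_sq {y : ℝ} (h0 : 0 < y) (h1 : y < 1) : fT y ^ 2 = 2 * fP (y ^ 2) * fT (y ^ 2) := by
  have hy0 : (y : ℂ) ≠ 0 := by exact_mod_cast h0.ne'
  have h := TT_sq hy0 (norm_real_lt h0 h1)
  have h4 : 0 < y ^ 2 := pow_pos h0 2
  have h4' : y ^ 2 < 1 := pow_lt_one₀ h0.le h1 (by norm_num)
  rw [← Complex.ofReal_pow, TT_cast h0 h1, phi_cast h4 h4', TT_cast h4 h4'] at h
  exact_mod_cast h

lemma fT_mul {y : ℝ} (h0 : 0 < y) (h1 : y < 1) :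
    fT y * fT (y ^ 3) = 2 * (fP (y ^ 12) * fT (y ^ 4) + y ^ 2 * fP (y ^ 4) * fT (y ^ 12)) := by
  have hy0 : (y : ℂ) ≠ 0 := by exact_mod_cast h0.ne'
  have h := TT_mul hy0 (norm_real_lt h0 h1)
  have h3 : 0 < y ^ 3 := pow_pos h0 3
  have h3' : y ^ 3 < 1 := pow_lt_one₀ h0.le h1 (by norm_num)
  have h4 : 0 < y ^ 4 := pow_pos h0 4
  have h4' : y ^ 4 < 1 := pow_lt_one₀ h0.le h1 (by norm_num)
  have h12 : 0 < y ^ 12 := pow_pos h0 12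
  have h12' : y ^ 12 < 1 := pow_lt_one₀ h0.le h1 (by norm_num)
  rw [← Complex.ofReal_pow, ← Complex.ofReal_pow, ← Complex.ofReal_pow, TT_cast h0 h1,
    TT_cast h3 h3', phi_cast h4 h4', TT_cast h4 h4', phi_cast h12 h12', TT_cast h12 h12'] at h
  exact_mod_cast h

lemma fP_mono {q : ℝ} (h0 : 0 < q) (h1 : q < 1) : fP (q ^ 3) ≤ fP q := by
  have h3 : 0 < q ^ 3 := pow_pos h0 3
  have h3' : q ^ 3 < 1 := pow_lt_one₀ h0.le h1 (by norm_num)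
  have key : ∀ y : ℝ, 0 < y → y < 1 → HasSum (fun j : ℤ => y ^ (j ^ 2)) (fP y) := by
    intro y h0 h1
    have h := (summable_phi (norm_real_lt h0 h1)).of_norm.hasSum
    change HasSum _ (phi (y : ℂ)) at h
    rw [phi_cast h0 h1] at h
    have h' : HasSum (fun j : ℤ => ((y ^ (j ^ 2) : ℝ) : ℂ)) (fP y : ℂ) := by
      refine hasSum_cong h (fun j => ?_) rfl
      push_cast; rfl
    exact_mod_cast h'
  refine hasSum_le (fun j => ?_) (key _ h3 h3') (key _ h0 h1)
  obtain ⟨n, hn⟩ := Int.eq_ofNat_of_zero_le (sq_nonneg j)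
  rw [hn]
  simp only [zpow_natCast]
  rw [← pow_mul]
  exact pow_le_pow_of_le_one h0.le h1.le (by omega)

lemma EE_omega {r w : ℂ} (hr : ‖r‖ < 1) (hw : w ^ 2 + w + 1 = 0) :
    EE r * EE (w * r) * EE (w ^ 2 * r) * EE (r ^ 9) = EE (r ^ 3) ^ 4 := by
  have h3 : w ^ 3 = 1 := by linear_combination (w - 1) * hw
  have nw : ‖w‖ = 1 := by
    have : ‖w‖ ^ 3 = 1 := by rw [← norm_pow, h3, norm_one]
    exact (pow_eq_one_iff_of_nonneg (norm_nonneg w) (by norm_num)).1 this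
  have hr3 := norm_pow_lt hr (n := 3) (by norm_num)
  have hw' : (w ^ 2) ^ 2 + w ^ 2 + 1 = 0 := by linear_combination (w ^ 2 - w + 1) * hw
  have a0 := poch_three r hr
  have a1 := poch_three (w * r) (q := w * r) (by simpa [nw] using hr)
  have a2 := poch_three (w ^ 2 * r) (q := w ^ 2 * r) (by simpa [nw] using hr)
  have b1 := poch_omega r w hr3 hw
  have b2 := poch_omega (r ^ 2) (w ^ 2) hr3 hw'
  have b3 := poch_three (r ^ 3) hr3
  rw [show (r * r) = r ^ 2 by ring, show r * r ^ 2 = r ^ 3 by ring] at a0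
  rw [show (w * r) ^ 3 = r ^ 3 by rw [mul_pow, h3, one_mul],
    show w * r * (w * r) = w ^ 2 * r ^ 2 by ring,
    show w * r * (w * r) ^ 2 = r ^ 3 by linear_combination r ^ 3 * h3] at a1
  rw [show (w ^ 2 * r) ^ 3 = r ^ 3 by linear_combination (w ^ 3 + 1) * r ^ 3 * h3,
    show w ^ 2 * r * (w ^ 2 * r) = (w ^ 2) ^ 2 * r ^ 2 by ring,
    show w ^ 2 * r * (w ^ 2 * r) ^ 2 = r ^ 3 by linear_combination (w ^ 3 + 1) * r ^ 3 * h3] at a2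
  rw [show (r ^ 3) ^ 3 = r ^ 9 by ring] at b1
  rw [show (r ^ 3) ^ 3 = r ^ 9 by ring, show (r ^ 2) ^ 3 = r ^ 6 by ring] at b2
  rw [show (r ^ 3) ^ 3 = r ^ 9 by ring, show r ^ 3 * r ^ 3 = r ^ 6 by ring,
    show r ^ 3 * (r ^ 3) ^ 2 = r ^ 9 by ring] at b3
  simp only [EE]
  calc _ = (poch r (r ^ 3) * poch (w * r) (r ^ 3) * poch (w ^ 2 * r) (r ^ 3)) *
        (poch (r ^ 2) (r ^ 3) * poch (w ^ 2 * r ^ 2) (r ^ 3) * poch ((w ^ 2) ^ 2 * r ^ 2) (r ^ 3)) *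
        poch (r ^ 9) (r ^ 9) * poch (r ^ 3) (r ^ 3) ^ 3 := by rw [a0, a1, a2]; ring
    _ = _ := by rw [b1, b2, ← b3]; ring

lemma phi_quartic {r : ℂ} (hr0 : r ≠ 0) (hr : ‖r‖ < 1) :
    phi (-r ^ 9) ^ 4 - phi (-r ^ 3) ^ 4 = 8 * r ^ 3 * phi (-r ^ 9) * ff (r ^ 3) ^ 3 := by
  obtain ⟨w, hw⟩ : ∃ w : ℂ, w ^ 2 + w + 1 = 0 := by
    refine ⟨(-1 + I * (√3 : ℝ)) / 2, ?_⟩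
    have : ((√3 : ℝ) : ℂ) ^ 2 = 3 := by
      exact_mod_cast congrArg (fun x : ℝ => (x : ℂ)) (Real.sq_sqrt (show (0 : ℝ) ≤ 3 by norm_num))
    linear_combination (1 / 4) * ((√3 : ℝ) : ℂ) ^ 2 * I_sq - 1 / 4 * this
  have h3 : w ^ 3 = 1 := by linear_combination (w - 1) * hw
  have hw0 : w ≠ 0 := by rintro rfl; norm_num at h3
  have nw : ‖w‖ = 1 := by
    have : ‖w‖ ^ 3 = 1 := by rw [← norm_pow, h3, norm_one]
    exact (pow_eq_one_iff_of_nonneg (norm_nonneg w) (by norm_num)).1 this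
  have hw' : (w ^ 2) ^ 2 + w ^ 2 + 1 = 0 := by linear_combination (w ^ 2 - w + 1) * hw
  have h9 : w ^ 9 = 1 := by rw [show w ^ 9 = (w ^ 3) ^ 3 by ring, h3, one_pow]
  have h6 : w ^ 6 = 1 := by rw [show w ^ 6 = (w ^ 3) ^ 2 by ring, h3, one_pow]
  have hr1 : ‖w * r‖ < 1 := by simpa [nw] using hr
  have hr2 : ‖w ^ 2 * r‖ < 1 := by simpa [nw] using hr
  have c0 := phi_cubic hr0 hr
  have c1 := phi_cubic (mul_ne_zero hw0 hr0) hr1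
  have c2 := phi_cubic (mul_ne_zero (pow_ne_zero 2 hw0) hr0) hr2
  rw [mul_pow w r 9, mul_pow w r 3, h9, h3, one_mul, one_mul] at c1
  rw [mul_pow (w ^ 2) r 9, mul_pow (w ^ 2) r 3, ← pow_mul, ← pow_mul,
    show w ^ (2 * 9) = 1 by rw [show w ^ (2 * 9) = (w ^ 9) ^ 2 by ring, h9, one_pow],
    show w ^ (2 * 3) = 1 by rw [show w ^ (2 * 3) = (w ^ 3) ^ 2 by ring, h3, one_pow], one_mul, one_mul] at c2
  have prod : phi (-r) * phi (-(w * r)) * phi (-(w ^ 2 * r)) = phi (-r ^ 9) ^ 3 - 8 * r ^ 3 * ff (r ^ 3) ^ 3 := by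
    rw [c0, c1, c2]
    generalize phi (-r ^ 9) = A
    generalize ff (r ^ 3) = B
    linear_combination (-2 * r * A ^ 2 * B + 4 * r ^ 2 * A * B ^ 2 * w) * hw - 8 * r ^ 3 * B ^ 3 * h3
  have e0 := phi_neg_EE hr0 hr
  have e1 := phi_neg_EE (mul_ne_zero hw0 hr0) hr1
  have e2 := phi_neg_EE (mul_ne_zero (pow_ne_zero 2 hw0) hr0) hr2
  have hs2 := norm_pow_lt hr (n := 2) (by norm_num)
  have o1 := EE_omega hr hw
  have o2 := EE_omega (r := r ^ 2) hs2 hw'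
  have p3 := phi_neg_EE (q := r ^ 3) (pow_ne_zero 3 hr0) (norm_pow_lt hr (by norm_num))
  have p9 := phi_neg_EE (q := r ^ 9) (pow_ne_zero 9 hr0) (norm_pow_lt hr (by norm_num))
  simp only [mul_pow, ← pow_mul] at e1 e2 o2 p3 p9
  norm_num only at e1 e2 o2 p3 p9
  have n2 := EE_ne hs2
  have m1 : EE (w ^ 2 * r ^ 2) ≠ 0 := EE_ne (by simpa [nw] using hs2)
  have m2 : EE (w ^ 4 * r ^ 2) ≠ 0 := EE_ne (by simpa [nw] using hs2)
  have n9 := EE_ne (norm_pow_lt hr (n := 9) (by norm_num))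
  have n18 := EE_ne (norm_pow_lt hr (n := 18) (by norm_num))
  have n6 := EE_ne (norm_pow_lt hr (n := 6) (by norm_num))
  have n3 := EE_ne (norm_pow_lt hr (n := 3) (by norm_num))
  have fin : phi (-r ^ 9) * (phi (-r) * phi (-(w * r)) * phi (-(w ^ 2 * r))) = phi (-r ^ 3) ^ 4 := by
    have q0 : phi (-r) = EE r ^ 2 / EE (r ^ 2) := by rw [eq_div_iff n2, e0]
    have q1 : phi (-(w * r)) = EE (w * r) ^ 2 / EE (w ^ 2 * r ^ 2) := by rw [eq_div_iff m1, e1]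
    have q2 : phi (-(w ^ 2 * r)) = EE (w ^ 2 * r) ^ 2 / EE (w ^ 4 * r ^ 2) := by
      rw [eq_div_iff m2, e2]
    have q3 : phi (-r ^ 3) = EE (r ^ 3) ^ 2 / EE (r ^ 6) := by rw [eq_div_iff n6, p3]
    have q9 : phi (-r ^ 9) = EE (r ^ 9) ^ 2 / EE (r ^ 18) := by rw [eq_div_iff n18, p9]
    rw [q0, q1, q2, q3, q9]
    rw [div_pow, ← pow_mul, show EE (r ^ 3) ^ (2 * 4) = (EE (r ^ 3) ^ 4) ^ 2 by ring, ← o1, ← o2]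
    field_simp
  rw [← fin, prod]; ring

lemma fM_cubic {q : ℝ} (h0 : 0 < q) (h1 : q < 1) :
    fM (q ^ 3) ^ 4 - fM q ^ 4 = 8 * q * fM (q ^ 3) * fF q ^ 3 := by
  obtain ⟨r, hr0, hr1, rfl⟩ : ∃ r : ℝ, 0 < r ∧ r < 1 ∧ r ^ 3 = q := by
    refine ⟨q ^ ((3 : ℝ)⁻¹), Real.rpow_pos_of_pos h0 _, Real.rpow_lt_one h0.le h1 (by norm_num), ?_⟩
    exact_mod_cast Real.rpow_inv_natCast_pow h0.le (n := 3) (by norm_num)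
  have h9 : 0 < r ^ 9 := pow_pos hr0 9
  have h9' : r ^ 9 < 1 := pow_lt_one₀ hr0.le hr1 (by norm_num)
  have h := phi_quartic (r := (r : ℂ)) (by exact_mod_cast hr0.ne') (norm_real_lt hr0 hr1)
  rw [← Complex.ofReal_pow, ← Complex.ofReal_pow, phi_neg_cast h9 h9', phi_neg_cast h0 h1,
    ff_cast h0 h1] at h
  rw [← pow_mul]
  norm_num only
  exact_mod_cast h

lemma Mlemma {y : ℝ} (h0 : 0 < y) (h1 : y < 1) {X Y Z X3 Y3 Z3 : ℝ} (hX : X = fP (y ^ 4))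
    (hY : Y = fM (y ^ 4)) (hZ : Z = y * fT (y ^ 4)) (hX3 : X3 = fP (y ^ 12))
    (hY3 : Y3 = fM (y ^ 12)) (hZ3 : Z3 = y ^ 3 * fT (y ^ 12)) :
    ∃ p : ℝ, 0 < p ∧ p < 1 ∧ X ^ 2 = (1 + 2 * p) * X3 ^ 2 ∧ p * Z ^ 2 = (2 + p) * Z3 ^ 2 ∧
      (1 + p) * Y ^ 2 = (1 - p) * Y3 ^ 2 ∧ X * Z * Z3 = p * (2 + p) * X3 ^ 3 ∧
      X * Y * Y3 = (1 - p ^ 2) * X3 ^ 3 ∧ p ^ 2 * (Z * X3 ^ 3) = Z3 ^ 3 * X ∧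
      (1 + p) ^ 2 * (Y * X3 ^ 3) = Y3 ^ 3 * X := by
  have quart : ∀ t : ℝ, 0 < t → t < 1 → fP (t ^ 4) ^ 4 = fM (t ^ 4) ^ 4 + (t * fT (t ^ 4)) ^ 4 := by
    intro t h0 h1
    have k0 : 0 < t ^ 4 := pow_pos h0 4
    have k1 : t ^ 4 < 1 := pow_lt_one₀ h0.le h1 (by norm_num)
    have a1 := fP_split k0 k1
    have a2 := fM_split k0 k1
    have a3 := fP_sq k0 k1
    have a4 := fT_sq k0 k1
    have a5 := fT_sq (pow_pos k0 2) (pow_lt_one₀ k0.le k1 (n := 2) (by norm_num))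
    rw [← pow_mul _ 2 2] at a5
    norm_num only at a5
    rw [a1, a2, mul_pow]
    have e : fT (t ^ 4) ^ 4 = 8 * fP ((t ^ 4) ^ 2) ^ 2 * (fP ((t ^ 4) ^ 4) * fT ((t ^ 4) ^ 4)) := by
      calc fT (t ^ 4) ^ 4 = (fT (t ^ 4) ^ 2) ^ 2 := by ring
        _ = 4 * fP ((t ^ 4) ^ 2) ^ 2 * fT ((t ^ 4) ^ 2) ^ 2 := by rw [a4]; ring
        _ = _ := by rw [a5]; ring
    rw [e, a3]; ring
  have k0 : 0 < y ^ 4 := pow_pos h0 4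
  have k1 : y ^ 4 < 1 := pow_lt_one₀ h0.le h1 (by norm_num)
  have j0 : 0 < y ^ 12 := pow_pos h0 12
  have j1 : y ^ 12 < 1 := pow_lt_one₀ h0.le h1 (by norm_num)
  have i0 : 0 < y ^ 3 := pow_pos h0 3
  have i1 : y ^ 3 < 1 := pow_lt_one₀ h0.le h1 (by norm_num)
  have e43 : (y ^ 4) ^ 3 = y ^ 12 := by ring
  have pX : 0 < X := hX ▸ fP_pos k0 k1
  have pY : 0 < Y := hY ▸ fM_pos k0 k1
  have pZ : 0 < Z := hZ ▸ mul_pos h0 (fT_pos k0 k1)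
  have pX3 : 0 < X3 := hX3 ▸ fP_pos j0 j1
  have pY3 : 0 < Y3 := hY3 ▸ fM_pos j0 j1
  have pZ3 : 0 < Z3 := hZ3 ▸ mul_pos i0 (fT_pos j0 j1)
  have cub := fM_cubic k0 k1
  rw [e43, ← hY, ← hY3] at cub
  have pF := fF_pos k0 k1
  have hYY : Y < Y3 := by
    have : 0 < 8 * y ^ 4 * Y3 * fF (y ^ 4) ^ 3 := by positivity
    rw [← cub] at this
    exact lt_of_pow_lt_pow_left₀ 4 pY3.le (by linarith)
  refine mlemma_alg pX pY pZ pX3 pY3 pZ3 (by rw [hX, hY, hZ]; exact quart y h0 h1) ?_ ?_ ?_ hYY ?_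
  · have := quart (y ^ 3) i0 i1
    rw [← pow_mul] at this
    norm_num only at this
    rw [hX3, hY3, hZ3, this]
  · have a := fT_mul k0 k1
    have b1 := fP_split k0 k1
    have b2 := fM_split k0 k1
    have b3 := fP_split j0 j1
    have b4 := fM_split j0 j1
    simp only [← pow_mul] at a b1 b2 b3 b4
    norm_num only at a b1 b2 b3 b4
    rw [hX, hY, hZ, hX3, hY3, hZ3, b1, b2, b3, b4]
    linear_combination (-y ^ 4) * a
  · rw [hX, hX3, ← e43]; exact fP_mono k0 k1
  · rw [cub]
    have q1 := er_pos k0 k1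
    have q2 := erp_pos h0 h1 (n := 8) (by norm_num)
    have q3 := erp_pos h0 h1 (n := 12) (by norm_num)
    have q4 := erp_pos h0 h1 (n := 16) (by norm_num)
    have q6 := erp_pos h0 h1 (n := 24) (by norm_num)
    have q12 := erp_pos h0 h1 (n := 48) (by norm_num)
    rw [hX, hY, hZ, hX3, hY3, hZ3]
    simp only [fP, fM, fT, fF, ← pow_mul]
    norm_num only
    field_simp
    try ring

lemma jth_phi (τ : ℂ) : jacobiTheta τ = phi (cexp (π * I * τ)) := by
  rw [jacobiTheta, phi]
  refine tsum_congr fun n => ?_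
  rw [← Complex.exp_int_mul]
  congr 1; push_cast; ring

lemma jth2_half (τ : ℂ) : jacobiTheta₂ (1 / 2) τ = jacobiTheta (τ + 1) := by
  rw [jacobiTheta, jacobiTheta₂]
  refine tsum_congr fun n => ?_
  rw [jacobiTheta₂_term]
  have h : cexp (π * I * (n : ℂ) ^ 2) = cexp (π * I * (n : ℂ)) := by
    obtain ⟨k, hk⟩ : ∃ k : ℤ, n ^ 2 = n + 2 * k := by
      have := Int.even_mul_pred_self n
      obtain ⟨k, hk⟩ := this
      exact ⟨k, by linarith [hk, show n ^ 2 = n * (n - 1) + n by ring]⟩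
    have hk' : (n : ℂ) ^ 2 = n + 2 * k := by exact_mod_cast hk
    rw [hk', Complex.exp_eq_exp_iff_exists_int]
    exact ⟨k, by ring⟩
  rw [show (π * I * (n : ℂ) ^ 2 * (τ + 1)) = π * I * (n : ℂ) ^ 2 + π * I * (n : ℂ) ^ 2 * τ by ring,
    Complex.exp_add (π * I * (n : ℂ) ^ 2), h, ← Complex.exp_add]
  congr 1; ring

/-- the theta constant `θ₂`. -/
noncomputable def th2 (τ : ℂ) : ℂ := jacobiTheta (τ / 4) - jacobiTheta τ

lemma norm_cexp_lt {τ : ℂ} (h : 0 < τ.im) : ‖cexp (π * I * τ)‖ < 1 := by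
  rw [Complex.norm_exp, Real.exp_lt_one_iff]
  have : (π * I * τ).re = - (π * τ.im) := by simp
  rw [this]; have := mul_pos Real.pi_pos h; linarith

lemma th2_eq_TT {τ : ℂ} (h : 0 < τ.im) :
    th2 τ = cexp (π * I * (τ / 4)) * TT (cexp (π * I * τ)) := by
  have h4 : 0 < (τ / 4).im := by
    rw [show τ / 4 = τ / ((4 : ℝ) : ℂ) by norm_num, Complex.div_ofReal_im]; linarith
  have := phi_split (Complex.exp_ne_zero (π * I * (τ / 4))) (norm_cexp_lt h4)
  rw [← Complex.exp_nat_mul, show ((4 : ℕ) : ℂ) * (π * I * (τ / 4)) = π * I * τ by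
    push_cast; ring] at this
  rw [th2, jth_phi, jth_phi, this]; ring

lemma th2_eq_jth2 {τ : ℂ} (h : 0 < τ.im) :
    th2 τ = cexp (π * I * (τ / 4)) * jacobiTheta₂ (τ / 2) τ := by
  rw [th2_eq_TT h, jacobiTheta₂, TT]
  congr 1
  refine tsum_congr fun n => ?_
  rw [jacobiTheta₂_term, ← Complex.exp_int_mul]
  congr 1; push_cast; ring

lemma th2_T {τ : ℂ} (h : 0 < τ.im) : th2 (τ + 1) ^ 8 = th2 τ ^ 8 := by
  have h1 : 0 < (τ + 1).im := by simpa using h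
  rw [th2_eq_TT h, th2_eq_TT h1, mul_pow, mul_pow]
  congr 1
  · rw [← Complex.exp_nat_mul, ← Complex.exp_nat_mul, Complex.exp_eq_exp_iff_exists_int]
    exact ⟨1, by push_cast; ring⟩
  · congr 1
    rw [TT, TT]
    refine tsum_congr fun k => ?_
    rw [← Complex.exp_int_mul, ← Complex.exp_int_mul, Complex.exp_eq_exp_iff_exists_int]
    obtain ⟨m, hm⟩ := Int.even_mul_succ_self k
    have hm' : (k : ℂ) * (k + 1) = m + m := by exact_mod_cast hm
    exact ⟨m, by push_cast; linear_combination (π * I) * hm'⟩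

lemma im_S_pos {τ : ℂ} (h : 0 < τ.im) : 0 < (-1 / τ).im := by
  rw [neg_div, neg_im, one_div, inv_im]
  have : 0 < normSq τ := normSq_pos.2 (by rintro rfl; simp at h)
  rw [neg_div, neg_neg]; positivity

lemma cpow_half8 (τ : ℂ) : (1 / (-I * τ) ^ (1 / 2 : ℂ)) ^ 8 = 1 / τ ^ 4 := by
  rw [div_pow, one_pow, ← Complex.cpow_nat_mul]
  norm_num
  rw [mul_pow]; simp

lemma th3_S {τ : ℂ} (h : 0 < τ.im) : jacobiTheta τ ^ 8 = 1 / τ ^ 4 * jacobiTheta (-1 / τ) ^ 8 := by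
  have := jacobiTheta₂_functional_equation 0 τ
  rw [← jacobiTheta_eq_jacobiTheta₂, zero_div, ← jacobiTheta_eq_jacobiTheta₂] at this
  rw [this, mul_pow, mul_pow, cpow_half8 τ]; simp

lemma th2_S {τ : ℂ} (h : 0 < τ.im) : th2 τ ^ 8 = 1 / τ ^ 4 * jacobiTheta (-1 / τ + 1) ^ 8 := by
  have h0 : τ ≠ 0 := by rintro rfl; simp at h
  have := jacobiTheta₂_functional_equation (τ / 2) τ
  rw [show τ / 2 / τ = 1 / 2 by field_simp, jth2_half] at this
  rw [th2_eq_jth2 h, this, mul_pow, mul_pow, mul_pow, cpow_half8 τ]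
  have e : cexp (π * I * (τ / 4)) * cexp (-π * I * (τ / 2) ^ 2 / τ) = 1 := by
    rw [← Complex.exp_add, Complex.exp_eq_one_iff]
    exact ⟨0, by field_simp; ring⟩
  calc _ = (cexp (π * I * (τ / 4)) * cexp (-π * I * (τ / 2) ^ 2 / τ)) ^ 8 *
        (1 / τ ^ 4 * jacobiTheta (-1 / τ + 1) ^ 8) := by ring
    _ = _ := by rw [e]; ring

lemma th4_S {τ : ℂ} (h : 0 < τ.im) : jacobiTheta (τ + 1) ^ 8 = 1 / τ ^ 4 * th2 (-1 / τ) ^ 8 := by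
  have h0 : τ ≠ 0 := by rintro rfl; simp at h
  have := jacobiTheta₂_functional_equation (1 / 2) τ
  rw [← jacobiTheta₂_neg_left (1 / 2 / τ), jth2_half] at this
  rw [th2_eq_jth2 (im_S_pos h), this, mul_pow, mul_pow, mul_pow, cpow_half8 τ]
  rw [show -1 / τ / 2 = -(1 / 2 / τ) by field_simp,
    show π * I * (-1 / τ / 4) = -π * I * (1 / 2) ^ 2 / τ by field_simp; ring]
  ring

/-- Sum of eighth powers of theta constants. -/
noncomputable def FF (τ : ℂ) : ℂ := jacobiTheta τ ^ 8 + jacobiTheta (τ + 1) ^ 8 + th2 τ ^ 8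

lemma FF_T {τ : ℂ} (h : 0 < τ.im) : FF (τ + 1) = FF τ := by
  rw [FF, FF, th2_T h, show τ + 1 + 1 = 2 + τ by ring, jacobiTheta_two_add]; ring

lemma FF_S {τ : ℂ} (h : 0 < τ.im) : FF τ = 1 / τ ^ 4 * FF (-1 / τ) := by
  rw [FF, FF, th2_S h, th3_S h, th4_S h]; ring

lemma FF_diff {τ : ℂ} (h : 0 < τ.im) : DifferentiableAt ℂ FF τ := by
  have h1 : 0 < (τ + 1).im := by simpa using h
  have h4 : 0 < (τ / 4).im := by
    rw [show τ / 4 = τ / ((4 : ℝ) : ℂ) by norm_num, Complex.div_ofReal_im]; linarith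
  have d := differentiableAt_jacobiTheta h
  have d1 : DifferentiableAt ℂ (fun z => jacobiTheta (z + 1)) τ :=
    (differentiableAt_jacobiTheta h1).comp τ (f := fun z => z + 1) (by fun_prop)
  have d4 : DifferentiableAt ℂ (fun z => jacobiTheta (z / 4)) τ :=
    (differentiableAt_jacobiTheta h4).comp τ (f := fun z => z / 4) (by fun_prop)
  exact ((d.pow 8).add (d1.pow 8)).add ((d4.sub d).pow 8)

open UpperHalfPlane Filter Topology in
lemma jth_tendsto (g : ℂ → ℂ) (c : ℝ) (hc : 0 < c) (hg : ∀ τ, (g τ).im = c * τ.im) :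
    Tendsto (fun τ : ℍ => jacobiTheta (g τ)) atImInfty (𝓝 1) := by
  have h1 : Tendsto (fun τ : ℍ => (g τ).im) atImInfty atTop := by
    have : Tendsto (fun τ : ℍ => c * τ.im) atImInfty atTop :=
      Tendsto.const_mul_atTop hc tendsto_comap
    refine this.congr fun τ => ?_
    rw [hg]; rfl
  have h2 : Tendsto (fun τ : ℍ => g τ) atImInfty (comap Complex.im atTop) := tendsto_comap_iff.2 h1
  have h3 := isBigO_at_im_infty_jacobiTheta_sub_one
  have h4 : Tendsto (fun τ : ℂ => rexp (-π * τ.im)) (comap Complex.im atTop) (𝓝 0) := by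
    have : Tendsto (fun x : ℝ => rexp (-π * x)) atTop (𝓝 0) := by
      refine Real.tendsto_exp_atBot.comp ?_
      exact Tendsto.const_mul_atTop_of_neg (by linarith [Real.pi_pos]) tendsto_id
    exact this.comp tendsto_comap
  have h5 := (h3.trans_tendsto h4).comp h2
  have := h5.add_const 1
  simpa [Function.comp_def] using this

open UpperHalfPlane Filter Topology in
lemma FF_tendsto : Tendsto (fun τ : ℍ => FF τ) atImInfty (𝓝 2) := by
  have a := jth_tendsto (fun τ => τ) 1 one_pos (by simp)
  have b := jth_tendsto (fun τ => τ + 1) 1 one_pos (by simp)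
  have c := jth_tendsto (fun τ => τ / 4) (1 / 4) (by norm_num) (fun τ => by
    rw [show τ / 4 = τ / ((4 : ℝ) : ℂ) by norm_num, Complex.div_ofReal_im]; ring)
  have := ((a.pow 8).add (b.pow 8)).add ((c.sub a).pow 8)
  norm_num at this
  exact this

open UpperHalfPlane MatrixGroups ModularForm SlashInvariantForm in
lemma FF_slash_S : ((fun τ : ℍ => FF τ) ∣[(4 : ℤ)] ModularGroup.S) = fun τ : ℍ => FF τ := by
  ext z
  suffices FF (-(↑z)⁻¹) * ((z : ℂ) ^ 4)⁻¹ = FF z by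
    rw [SL_slash_apply, UpperHalfPlane.modular_S_smul]
    rw [ModularGroup.denom_S]
    simpa using this
  rw [FF_S (τ := z) z.2]
  field_simp

open UpperHalfPlane MatrixGroups ModularForm SlashInvariantForm in
lemma FF_slash_T : ((fun τ : ℍ => FF τ) ∣[(4 : ℤ)] ModularGroup.T) = fun τ : ℍ => FF τ := by
  ext z
  have hd : denom (ModularGroup.T : GL (Fin 2) ℝ) z = 1 := by
    rw [ModularGroup.denom_apply]; simp [ModularGroup.T]
  rw [SL_slash_apply, modular_T_smul, hd]
  simpa [add_comm] using FF_T z.2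

open UpperHalfPlane MatrixGroups ModularForm SlashInvariantForm in
/-- `FF` as a modular form. -/
noncomputable def FFform : ModularForm 𝒮ℒ 4 where
  toFun := fun τ : ℍ => FF τ
  slash_action_eq' A hA := by
    obtain ⟨A, rfl⟩ := hA
    exact slash_action_generators_SL2Z FF_slash_S FF_slash_T A
  holo' := by
    rw [UpperHalfPlane.mdifferentiable_iff]
    refine .congr (fun z hz ↦ (FF_diff hz).differentiableWithinAt) fun z hz ↦ ?_
    simp [ofComplex_apply_of_im_pos hz]
  bdd_at_cusps' hc := by
    rw [Subgroup.IsArithmetic.isCusp_iff_isCusp_SL2Z] at hc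
    rw [OnePoint.isBoundedAt_iff_forall_SL2Z hc]
    intro γ _
    rw [slash_action_generators_SL2Z FF_slash_S FF_slash_T]
    exact FF_tendsto.isBigO_one ℝ

open UpperHalfPlane MatrixGroups ModularForm EisensteinSeries Filter Topology in
lemma FF_E4 (τ : ℍ) : FF τ = 2 * E₄ τ := by
  obtain ⟨c, hc⟩ : ∃ c : ℂ, c • E₄ = FFform :=
    (finrank_eq_one_iff_of_nonzero' E₄ (E_ne_zero _ ⟨2, rfl⟩)).mp
      (Module.rank_eq_one_iff_finrank_eq_one.mp levelOne_weight_four_rank_one) _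
  have h : ∀ τ : ℍ, c * E₄ τ = FF τ := fun τ => by
    have := congrArg (fun f : ModularForm 𝒮ℒ 4 => f τ) hc
    exact this
  have h0 : (qExpansion 1 FFform).coeff 0 = 2 := by
    rw [qExpansion_coeff_zero one_pos
      (ModularFormClass.analyticAt_cuspFunction_zero _ one_pos one_mem_strictPeriods_SL)
      (SlashInvariantFormClass.periodic_comp_ofComplex FFform one_mem_strictPeriods_SL)]
    exact FF_tendsto.limUnder_eq
  have h1 : c • qExpansion 1 (E₄ : ℍ → ℂ) = qExpansion 1 (FFform : ℍ → ℂ) := by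
    rw [← ModularForm.qExpansion_smul one_pos one_mem_strictPeriods_SL c E₄,
      show (c • E₄ : ℍ → ℂ) = FFform from congrArg DFunLike.coe hc]
  have h2 : c = 2 := by
    have e := congrArg (fun p : PowerSeries ℂ => p.coeff 0) h1
    have e1 : (qExpansion 1 (E₄ : ℍ → ℂ)).coeff 0 = 1 := E_qExpansion_coeff_zero _ ⟨2, rfl⟩
    simp only [PowerSeries.coeff_smul, e1, h0] at e
    simpa using e
  rw [← h, h2]

lemma sigma3_bound (n : ℕ) : (ArithmeticFunction.sigma 3 n : ℝ) ≤ (n : ℝ) ^ 4 := by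
  exact_mod_cast ArithmeticFunction.sigma_le_pow_succ 3 n

open MatrixGroups ModularForm EisensteinSeries Filter Topology in
lemma E4_series {r : ℝ} (h0 : 0 < r) (h1 : r < 1) :
    HasSum (fun n : ℕ => (ArithmeticFunction.sigma 3 n : ℂ) * ((r : ℂ) ^ 2) ^ n)
      ((((fP r ^ 8 + fM r ^ 8 + r ^ 2 * fT r ^ 8) / 2 - 1) / 240 : ℝ) : ℂ) := by
  have hl := Real.log_neg h0 h1
  set τ : UpperHalfPlane := ⟨((-Real.log r / π : ℝ) : ℂ) * I, by
    simp only [mul_im, ofReal_re, I_im, ofReal_im, I_re, mul_one, mul_zero, add_zero]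
    exact div_pos (by linarith) Real.pi_pos⟩ with hτ
  have hq : cexp (π * I * τ) = r := by
    have : (π * I * (τ : ℂ)) = ((Real.log r : ℝ) : ℂ) := by
      rw [hτ]; push_cast
      have : (π : ℂ) ≠ 0 := by exact_mod_cast Real.pi_ne_zero
      field_simp
      rw [I_sq]; ring
    rw [this, ← Complex.ofReal_exp, Real.exp_log h0]
  have hF : FF τ = ((fP r ^ 8 + fM r ^ 8 + r ^ 2 * fT r ^ 8 : ℝ) : ℂ) := by
    rw [FF, th2_eq_TT τ.2, mul_pow, ← Complex.exp_nat_mul, jth_phi, jth_phi,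
      show ((8 : ℕ) : ℂ) * (π * I * ((τ : ℂ) / 4)) = ((2 : ℕ) : ℂ) * (π * I * τ) by push_cast; ring,
      Complex.exp_nat_mul, mul_add, Complex.exp_add, mul_one, Complex.exp_pi_mul_I, hq, mul_neg_one,
      phi_cast h0 h1, phi_neg_cast h0 h1, TT_cast h0 h1]
    push_cast; ring
  have hE := q_expansion_bernoulli (k := 4) (by norm_num) ⟨2, rfl⟩ τ
  have hq2 : cexp (2 * π * I * τ) = (r : ℂ) ^ 2 := by
    rw [← hq, ← Complex.exp_nat_mul]; congr 1; push_cast; ring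
  have hs : Summable (fun n : ℕ => (ArithmeticFunction.sigma 3 n : ℂ) * ((r : ℂ) ^ 2) ^ n) := by
    refine Summable.of_norm_bounded (g := fun n : ℕ => (n : ℝ) ^ 4 * (r ^ 2) ^ n)
      (summable_pow_mul_geometric_of_norm_lt_one 4 ?_) fun n => ?_
    · rw [Real.norm_of_nonneg (by positivity)]; nlinarith
    · rw [norm_mul, norm_pow, norm_pow, Complex.norm_real, Real.norm_of_nonneg h0.le,
        Complex.norm_natCast]
      gcongr
      exact sigma3_bound n
  simp_rw [zpow_natCast, hq2] at hE
  have hz := tsum_zero_pnat_eq_tsum_nat hs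
  have h4 : FF τ = 2 * E₄ τ := FF_E4 τ
  have hb : ((bernoulli 4 : ℚ) : ℂ) = -1 / 30 := by
    rw [show bernoulli 4 = -1 / 30 by decide +kernel]; norm_num
  convert hs.hasSum using 1
  rw [← hz]
  have hE' : E₄ τ = 1 + 240 * ∑' n : ℕ+, (ArithmeticFunction.sigma 3 n : ℂ) * ((r : ℂ) ^ 2) ^ (n : ℕ) := by
    rw [show E₄ τ = _ from hE, hb]; norm_num
  have h5 := hF.symm.trans h4
  rw [hE'] at h5
  push_cast at h5 ⊢
  simp only [ArithmeticFunction.map_zero, Nat.cast_zero, zero_mul, zero_add]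
  linear_combination (1 / 480) * h5

lemma phi_quot {q : ℂ} (hq0 : q ≠ 0) (hq : ‖q‖ < 1) :
    phi q = EE (q ^ 2) ^ 5 / (EE q ^ 2 * EE (q ^ 4) ^ 2) := by
  have h1 := EE_ne hq
  have h2 := EE_ne (norm_pow_lt hq (n := 2) (by norm_num))
  have h4 := EE_ne (norm_pow_lt hq (n := 4) (by norm_num))
  have hn := EE_neg hq
  have hp := phi_EE hq0 hq
  rw [eq_div_iff (by positivity)]
  apply mul_right_cancel₀ h2
  linear_combination (EE q ^ 2 * EE (q ^ 4) ^ 2) * hp +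
    (EE (-q) * EE q * EE (q ^ 4) + EE (q ^ 2) ^ 3) * hn

lemma phi_neg_quot {q : ℂ} (hq0 : q ≠ 0) (hq : ‖q‖ < 1) : phi (-q) = EE q ^ 2 / EE (q ^ 2) := by
  rw [eq_div_iff (EE_ne (norm_pow_lt hq (n := 2) (by norm_num)))]
  exact phi_neg_EE hq0 hq

lemma TT_quot {q : ℂ} (hq0 : q ≠ 0) (hq : ‖q‖ < 1) : TT q = 2 * EE (q ^ 4) ^ 2 / EE (q ^ 2) := by
  rw [eq_div_iff (EE_ne (norm_pow_lt hq (n := 2) (by norm_num)))]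
  exact TT_EE hq0 hq

noncomputable def e6 (q : ℂ) : ℂ := q * (EE q ^ 2 * EE (q ^ 2) ^ 2 * EE (q ^ 3) ^ 2 * EE (q ^ 6) ^ 2)
noncomputable def e8 (q : ℂ) : ℂ := q * (EE (q ^ 2) ^ 4 * EE (q ^ 4) ^ 4)
noncomputable def e12 (q : ℂ) : ℂ :=
  q * ((EE q)⁻¹ * EE (q ^ 2) ^ 2 * EE (q ^ 3) ^ 3 * EE (q ^ 4) ^ 3 * EE (q ^ 6) ^ 2 * (EE (q ^ 12))⁻¹) -
  q ^ 2 * (EE q ^ 3 * EE (q ^ 2) ^ 2 * (EE (q ^ 3))⁻¹ * (EE (q ^ 4))⁻¹ * EE (q ^ 6) ^ 2 * EE (q ^ 12) ^ 3)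
noncomputable def e16 (q : ℂ) : ℂ :=
  q * ((EE (q ^ 2) ^ 4)⁻¹ * EE (q ^ 4) ^ 16 * (EE (q ^ 8) ^ 4)⁻¹)
noncomputable def e24 (q : ℂ) : ℂ :=
  q * ((EE q ^ 4)⁻¹ * EE (q ^ 2) ^ 11 * (EE (q ^ 3) ^ 4)⁻¹ * (EE (q ^ 4) ^ 3)⁻¹ *
    EE (q ^ 6) ^ 11 * (EE (q ^ 12) ^ 3)⁻¹)

section
variable {q : ℂ}

lemma EEp_ne (hq : ‖q‖ < 1) (n : ℕ) (hn : n ≠ 0) : EE (q ^ n) ≠ 0 := EE_ne (norm_pow_lt hq hn)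

lemma e6_ne (hq0 : q ≠ 0) (hq : ‖q‖ < 1) : e6 q ≠ 0 := by
  have h1 := EE_ne hq
  have h2 := EEp_ne hq 2 (by norm_num)
  have h3 := EEp_ne hq 3 (by norm_num)
  have h6 := EEp_ne hq 6 (by norm_num)
  rw [e6]; positivity

lemma e8_ne (hq0 : q ≠ 0) (hq : ‖q‖ < 1) : e8 q ≠ 0 := by
  have h2 := EEp_ne hq 2 (by norm_num)
  have h4 := EEp_ne hq 4 (by norm_num)
  rw [e8]; positivity

lemma e16_ne (hq0 : q ≠ 0) (hq : ‖q‖ < 1) : e16 q ≠ 0 := by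
  have h2 := EEp_ne hq 2 (by norm_num)
  have h4 := EEp_ne hq 4 (by norm_num)
  have h8 := EEp_ne hq 8 (by norm_num)
  rw [e16]; positivity

lemma e24_ne (hq0 : q ≠ 0) (hq : ‖q‖ < 1) : e24 q ≠ 0 := by
  have h1 := EE_ne hq
  have h2 := EEp_ne hq 2 (by norm_num)
  have h3 := EEp_ne hq 3 (by norm_num)
  have h4 := EEp_ne hq 4 (by norm_num)
  have h6 := EEp_ne hq 6 (by norm_num)
  have h12 := EEp_ne hq 12 (by norm_num)
  rw [e24]; positivity

lemma e6_theta (hq0 : q ≠ 0) (hq : ‖q‖ < 1) :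
    e6 q = phi (-q) ^ 2 * phi (-q ^ 3) ^ 2 * phi q * phi (q ^ 3) * (q * TT q * TT (q ^ 3)) / 4 := by
  have h1 := EE_ne hq
  have h2 := EEp_ne hq 2 (by norm_num)
  have h3 := EEp_ne hq 3 (by norm_num)
  have h4 := EEp_ne hq 4 (by norm_num)
  have h6 := EEp_ne hq 6 (by norm_num)
  have h12 := EEp_ne hq 12 (by norm_num)
  have q3 := norm_pow_lt hq (n := 3) (by norm_num)
  have q30 := pow_ne_zero 3 hq0
  rw [e6, phi_neg_quot hq0 hq, phi_neg_quot q30 q3, phi_quot hq0 hq, phi_quot q30 q3,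
    TT_quot hq0 hq, TT_quot q30 q3]
  simp only [← pow_mul, Nat.reduceMul]
  field_simp
  try ring

lemma e24_theta (hq0 : q ≠ 0) (hq : ‖q‖ < 1) :
    e24 q = phi q ^ 2 * phi (q ^ 3) ^ 2 * phi (-q ^ 2) * phi (-q ^ 6) *
      (q * TT q * TT (q ^ 3)) / 4 := by
  have h1 := EE_ne hq
  have h2 := EEp_ne hq 2 (by norm_num)
  have h3 := EEp_ne hq 3 (by norm_num)
  have h4 := EEp_ne hq 4 (by norm_num)
  have h6 := EEp_ne hq 6 (by norm_num)
  have h12 := EEp_ne hq 12 (by norm_num)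
  have q3 := norm_pow_lt hq (n := 3) (by norm_num)
  have q30 := pow_ne_zero 3 hq0
  rw [e24, phi_neg_quot (pow_ne_zero 2 hq0) (norm_pow_lt hq (n := 2) (by norm_num)),
    phi_neg_quot (pow_ne_zero 6 hq0) (norm_pow_lt hq (n := 6) (by norm_num)),
    phi_quot hq0 hq, phi_quot q30 q3, TT_quot hq0 hq, TT_quot q30 q3]
  simp only [← pow_mul, Nat.reduceMul]
  field_simp
  try ring

lemma e8_theta (hq0 : q ≠ 0) (hq : ‖q‖ < 1) :
    e8 q = q * TT (q ^ 2) ^ 2 * phi (-q ^ 2) ^ 4 * phi (q ^ 2) ^ 2 / 4 := by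
  have h2 := EEp_ne hq 2 (by norm_num)
  have h4 := EEp_ne hq 4 (by norm_num)
  have h8 := EEp_ne hq 8 (by norm_num)
  have q3 := norm_pow_lt hq (n := 2) (by norm_num)
  have q30 := pow_ne_zero 2 hq0
  rw [e8, phi_neg_quot q30 q3, phi_quot q30 q3, TT_quot q30 q3]
  simp only [← pow_mul, Nat.reduceMul]
  field_simp
  try ring

lemma e16_theta (hq0 : q ≠ 0) (hq : ‖q‖ < 1) :
    e16 q = q * TT (q ^ 2) ^ 2 * phi (-q ^ 2) ^ 2 * phi (q ^ 2) ^ 4 / 4 := by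
  have h2 := EEp_ne hq 2 (by norm_num)
  have h4 := EEp_ne hq 4 (by norm_num)
  have h8 := EEp_ne hq 8 (by norm_num)
  have q3 := norm_pow_lt hq (n := 2) (by norm_num)
  have q30 := pow_ne_zero 2 hq0
  rw [e16, phi_neg_quot q30 q3, phi_quot q30 q3, TT_quot q30 q3]
  simp only [← pow_mul, Nat.reduceMul]
  field_simp
  try ring

end

lemma TT_neg (q : ℂ) : TT (-q) = TT q := by
  rw [TT, TT]
  refine tsum_congr fun k => ?_
  exact Even.neg_zpow (by have := Int.even_mul_succ_self k; convert this using 1; ring) q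

section
variable {y : ℝ}

lemma phi_castp (h0 : 0 < y) (h1 : y < 1) {n : ℕ} (hn : n ≠ 0) : phi ((y : ℂ) ^ n) = (fP (y ^ n) : ℂ) := by
  rw [← phi_cast (pow_pos h0 n) (pow_lt_one₀ h0.le h1 hn)]; push_cast; rfl

lemma phi_neg_castp (h0 : 0 < y) (h1 : y < 1) {n : ℕ} (hn : n ≠ 0) : phi (-(y : ℂ) ^ n) = (fM (y ^ n) : ℂ) := by
  rw [← phi_neg_cast (pow_pos h0 n) (pow_lt_one₀ h0.le h1 hn)]; push_cast; rfl

lemma TT_castp (h0 : 0 < y) (h1 : y < 1) {n : ℕ} (hn : n ≠ 0) : TT ((y : ℂ) ^ n) = (fT (y ^ n) : ℂ) := by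
  rw [← TT_cast (pow_pos h0 n) (pow_lt_one₀ h0.le h1 hn)]; push_cast; rfl

lemma schroter (h0 : 0 < y) (h1 : y < 1) :
    y * fT y * fT (y ^ 3) = fP y * fP (y ^ 3) - fM y * fM (y ^ 3) := by
  have h3 : 0 < y ^ 3 := pow_pos h0 3
  have h3' : y ^ 3 < 1 := pow_lt_one₀ h0.le h1 (by norm_num)
  have := fT_mul h0 h1
  have e1 := fP_split h3 h3'
  have e2 := fM_split h3 h3'
  rw [← pow_mul] at e1 e2
  norm_num at e1 e2
  rw [fP_split h0 h1, fM_split h0 h1, e1, e2]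
  linear_combination y * this

lemma fPp_pos (h0 : 0 < y) (h1 : y < 1) {n : ℕ} (hn : n ≠ 0) : 0 < fP (y ^ n) :=
  fP_pos (pow_pos h0 n) (pow_lt_one₀ h0.le h1 hn)
lemma fMp_pos (h0 : 0 < y) (h1 : y < 1) {n : ℕ} (hn : n ≠ 0) : 0 < fM (y ^ n) :=
  fM_pos (pow_pos h0 n) (pow_lt_one₀ h0.le h1 hn)
lemma fTp_pos (h0 : 0 < y) (h1 : y < 1) {n : ℕ} (hn : n ≠ 0) : 0 < fT (y ^ n) :=
  fT_pos (pow_pos h0 n) (pow_lt_one₀ h0.le h1 hn)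

lemma e6_real (h0 : 0 < y) (h1 : y < 1) : e6 (y : ℂ) =
    ((fM y ^ 2 * fM (y ^ 3) ^ 2 * fP y * fP (y ^ 3) * (fP y * fP (y ^ 3) - fM y * fM (y ^ 3)) / 4 : ℝ) : ℂ) := by
  rw [← schroter h0 h1, e6_theta (by exact_mod_cast h0.ne') (norm_real_lt h0 h1), phi_cast h0 h1,
    phi_neg_cast h0 h1, phi_castp h0 h1 (by norm_num), phi_neg_castp h0 h1 (by norm_num),
    TT_cast h0 h1, TT_castp h0 h1 (by norm_num)]
  push_cast; ring

lemma e24_real (h0 : 0 < y) (h1 : y < 1) : e24 (y : ℂ) =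
    ((fP y ^ 2 * fP (y ^ 3) ^ 2 * fM (y ^ 2) * fM (y ^ 6) *
      (fP y * fP (y ^ 3) - fM y * fM (y ^ 3)) / 4 : ℝ) : ℂ) := by
  rw [← schroter h0 h1, e24_theta (by exact_mod_cast h0.ne') (norm_real_lt h0 h1), phi_cast h0 h1,
    phi_castp h0 h1 (by norm_num), phi_neg_castp h0 h1 (by norm_num),
    phi_neg_castp h0 h1 (by norm_num),
    TT_cast h0 h1, TT_castp h0 h1 (by norm_num)]
  push_cast; ring

lemma e24_neg (h0 : 0 < y) (h1 : y < 1) : e24 (-(y : ℂ)) =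
    ((-(fM y ^ 2 * fM (y ^ 3) ^ 2 * fM (y ^ 2) * fM (y ^ 6) *
      (fP y * fP (y ^ 3) - fM y * fM (y ^ 3))) / 4 : ℝ) : ℂ) := by
  have hy0 : (y : ℂ) ≠ 0 := by exact_mod_cast h0.ne'
  rw [← schroter h0 h1, e24_theta (neg_ne_zero.2 hy0) (by rw [norm_neg]; exact norm_real_lt h0 h1),
    show (-(y : ℂ)) ^ 3 = -(y : ℂ) ^ 3 by ring, show (-(y : ℂ)) ^ 2 = (y : ℂ) ^ 2 by ring,
    show (-(y : ℂ)) ^ 6 = (y : ℂ) ^ 6 by ring, TT_neg, TT_neg, phi_neg_cast h0 h1,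
    phi_neg_castp h0 h1 (by norm_num), phi_neg_castp h0 h1 (by norm_num),
    phi_neg_castp h0 h1 (by norm_num),
    TT_cast h0 h1, TT_castp h0 h1 (by norm_num)]
  push_cast; ring

lemma e8_real (h0 : 0 < y) (h1 : y < 1) : e8 (y : ℂ) =
    ((y * fT (y ^ 2) ^ 2 * fM (y ^ 2) ^ 4 * fP (y ^ 2) ^ 2 / 4 : ℝ) : ℂ) := by
  rw [e8_theta (by exact_mod_cast h0.ne') (norm_real_lt h0 h1), phi_castp h0 h1 (by norm_num),
    phi_neg_castp h0 h1 (by norm_num), TT_castp h0 h1 (by norm_num)]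
  push_cast; ring

lemma e16_real (h0 : 0 < y) (h1 : y < 1) : e16 (y : ℂ) =
    ((y * fT (y ^ 2) ^ 2 * fM (y ^ 2) ^ 2 * fP (y ^ 2) ^ 4 / 4 : ℝ) : ℂ) := by
  rw [e16_theta (by exact_mod_cast h0.ne') (norm_real_lt h0 h1), phi_castp h0 h1 (by norm_num),
    phi_neg_castp h0 h1 (by norm_num), TT_castp h0 h1 (by norm_num)]
  push_cast; ring

lemma TT_mul_I (h0 : 0 < y) (h1 : y < 1) : y * TT (I * y) * TT ((I * y) ^ 3) =
    2 * ((y * fT (y ^ 4)) * fP (y ^ 12) - fP (y ^ 4) * (y ^ 3 * fT (y ^ 12))) := by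
  have hy0 : (y : ℂ) ≠ 0 := by exact_mod_cast h0.ne'
  have h := TT_mul (mul_ne_zero I_ne_zero hy0) (by simpa using norm_real_lt h0 h1)
  rw [mul_assoc, h]
  simp only [mul_pow]
  have i4 : I ^ 4 = 1 := I_pow_four
  have i12 : I ^ 12 = 1 := by rw [show 12 = 4 * 3 by norm_num, pow_mul, i4, one_pow]
  rw [i4, i12, I_sq, one_mul, one_mul, phi_castp h0 h1 (by norm_num), phi_castp h0 h1 (by norm_num),
    TT_castp h0 h1 (by norm_num), TT_castp h0 h1 (by norm_num)]
  ring

lemma phi_I3 (h0 : 0 < y) (h1 : y < 1) :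
    phi ((I * y) ^ 3) = fP (y ^ 12) - I * (y ^ 3 * fT (y ^ 12)) := by
  have := phi_negI (pow_pos h0 3) (pow_lt_one₀ h0.le h1 (n := 3) (by norm_num))
  rw [← pow_mul] at this
  norm_num at this
  rw [← this, mul_pow, I_pow_three]; congr 1; ring

lemma phi_negI3 (h0 : 0 < y) (h1 : y < 1) :
    phi (-(I * y) ^ 3) = fP (y ^ 12) + I * (y ^ 3 * fT (y ^ 12)) := by
  have := phi_I (pow_pos h0 3) (pow_lt_one₀ h0.le h1 (n := 3) (by norm_num))
  rw [← pow_mul] at this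
  norm_num at this
  rw [← this, mul_pow, I_pow_three]; congr 1; ring

lemma e6_I (h0 : 0 < y) (h1 : y < 1) {a b c d : ℝ} (ha : a = fP (y ^ 4)) (hb : b = y * fT (y ^ 4))
    (hc : c = fP (y ^ 12)) (hd : d = y ^ 3 * fT (y ^ 12)) :
    (e6 (I * y) - e6 (-(I * y))) / (2 * I) =
      ((((a * c + b * d) ^ 2 + (b * c - a * d) ^ 2) * (a * c + b * d) * (b * c - a * d) / 2 : ℝ) : ℂ) := by
  have hy0 : (y : ℂ) ≠ 0 := by exact_mod_cast h0.ne'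
  have hI : (I * y : ℂ) ≠ 0 := mul_ne_zero I_ne_zero hy0
  have hn : ‖(I * y : ℂ)‖ < 1 := by simpa using norm_real_lt h0 h1
  have hm := TT_mul_I h0 h1
  rw [e6_theta hI hn, e6_theta (neg_ne_zero.2 hI) (by rwa [norm_neg]),
    show (-(I * y : ℂ)) ^ 3 = -(I * y : ℂ) ^ 3 by ring, TT_neg, TT_neg, neg_neg, neg_neg,
    phi_I3 h0 h1, phi_negI3 h0 h1, phi_I h0 h1, phi_negI h0 h1,
    show I * y * TT (I * y) * TT ((I * y) ^ 3) = I * (y * TT (I * y) * TT ((I * y) ^ 3)) by ring,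
    show -(I * y) * TT (I * y) * TT ((I * y) ^ 3) = -(I * (y * TT (I * y) * TT ((I * y) ^ 3))) by ring,
    hm, ha, hb, hc, hd]
  push_cast
  rw [div_eq_iff (by simp)]
  generalize (fP (y ^ 4) : ℂ) = a
  generalize (y * fT (y ^ 4) : ℂ) = b
  generalize (fP (y ^ 12) : ℂ) = c
  generalize (y ^ 3 * fT (y ^ 12) : ℂ) = d
  ring_nf
  simp only [show I ^ 7 = -I by rw [show 7 = 4 + 3 by norm_num, pow_add, I_pow_four, I_pow_three]; ring,
    show I ^ 5 = I by rw [pow_succ, I_pow_four, one_mul], I_pow_three,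
    show I ^ 6 = -1 by rw [show 6 = 4 + 2 by norm_num, pow_add, I_pow_four, I_sq]; ring, I_pow_four, I_sq]
  ring

lemma e24_I (h0 : 0 < y) (h1 : y < 1) {a b c d : ℝ} (ha : a = fP (y ^ 4)) (hb : b = y * fT (y ^ 4))
    (hc : c = fP (y ^ 12)) (hd : d = y ^ 3 * fT (y ^ 12)) :
    (e24 (I * y) - e24 (-(I * y))) / (2 * I) =
      ((fP (y ^ 2) * fP (y ^ 6) * (b * c - a * d) *
        ((a * c + b * d) ^ 2 - (b * c - a * d) ^ 2) / 2 : ℝ) : ℂ) := by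
  have hy0 : (y : ℂ) ≠ 0 := by exact_mod_cast h0.ne'
  have hI : (I * y : ℂ) ≠ 0 := mul_ne_zero I_ne_zero hy0
  have hn : ‖(I * y : ℂ)‖ < 1 := by simpa using norm_real_lt h0 h1
  have hm := TT_mul_I h0 h1
  have i6 : I ^ 6 = -1 := by rw [show 6 = 4 + 2 by norm_num, pow_add, I_pow_four, I_sq]; ring
  have s2 : -(I * y : ℂ) ^ 2 = (y : ℂ) ^ 2 := by rw [mul_pow, I_sq]; ring
  have s6 : -(I * y : ℂ) ^ 6 = (y : ℂ) ^ 6 := by rw [mul_pow, i6]; ring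
  rw [e24_theta hI hn, e24_theta (neg_ne_zero.2 hI) (by rwa [norm_neg]),
    show (-(I * y : ℂ)) ^ 3 = -(I * y : ℂ) ^ 3 by ring, show (-(I * y : ℂ)) ^ 2 = (I * y : ℂ) ^ 2 by ring,
    show (-(I * y : ℂ)) ^ 6 = (I * y : ℂ) ^ 6 by ring, TT_neg, TT_neg, s2, s6,
    phi_I3 h0 h1, phi_negI3 h0 h1, phi_I h0 h1, phi_negI h0 h1,
    phi_castp h0 h1 (by norm_num), phi_castp h0 h1 (by norm_num),
    show I * y * TT (I * y) * TT ((I * y) ^ 3) = I * (y * TT (I * y) * TT ((I * y) ^ 3)) by ring,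
    show -(I * y) * TT (I * y) * TT ((I * y) ^ 3) = -(I * (y * TT (I * y) * TT ((I * y) ^ 3))) by ring,
    hm, ha, hb, hc, hd]
  push_cast
  rw [div_eq_iff (by simp)]
  generalize (fP (y ^ 4) : ℂ) = a
  generalize (y * fT (y ^ 4) : ℂ) = b
  generalize (fP (y ^ 12) : ℂ) = c
  generalize (y ^ 3 * fT (y ^ 12) : ℂ) = d
  ring_nf
  simp only [show I ^ 7 = -I by rw [show 7 = 4 + 3 by norm_num, pow_add, I_pow_four, I_pow_three]; ring,
    show I ^ 5 = I by rw [pow_succ, I_pow_four, one_mul], I_pow_three, i6, I_pow_four, I_sq]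
  ring

lemma e12_real (h0 : 0 < y) (h1 : y < 1) : e12 (y : ℂ) =
    (((fP y ^ 4 + 3 * fP (y ^ 3) ^ 4) * fM y * fM (y ^ 3) *
      (fP y * fP (y ^ 3) - fM y * fM (y ^ 3)) / 16 : ℝ) : ℂ) := by
  rw [← schroter h0 h1]
  have e1 := er_pos h0 h1
  have e2 := erp_pos h0 h1 (n := 2) (by norm_num)
  have e3 := erp_pos h0 h1 (n := 3) (by norm_num)
  have e4 := erp_pos h0 h1 (n := 4) (by norm_num)
  have e6 := erp_pos h0 h1 (n := 6) (by norm_num)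
  have e12' := erp_pos h0 h1 (n := 12) (by norm_num)
  rw [e12, er_cast h0 h1, er_castp h0 h1 (by norm_num), er_castp h0 h1 (by norm_num),
    er_castp h0 h1 (by norm_num), er_castp h0 h1 (by norm_num), er_castp h0 h1 (by norm_num)]
  norm_cast
  obtain ⟨r, hr0, hr1, hr⟩ : ∃ r : ℝ, 0 < r ∧ r < 1 ∧ r ^ 4 = y := by
    refine ⟨y ^ ((4 : ℝ)⁻¹), Real.rpow_pos_of_pos h0 _, Real.rpow_lt_one h0.le h1 (by norm_num), ?_⟩
    rw [← Real.rpow_natCast, ← Real.rpow_mul h0.le]; norm_num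
  have hr12 : r ^ 12 = y ^ 3 := by rw [← hr]; ring
  obtain ⟨p, p0, p1, m1, m2, m3, m4, m5, m6, m7⟩ := Mlemma hr0 hr1 rfl rfl rfl rfl rfl rfl
  rw [hr, hr12] at m1 m2 m3 m4 m5 m6 m7
  set W := 2 * r ^ 2 * (er y * er (y ^ 4) * er (y ^ 3) * er (y ^ 12) / (er (y ^ 2) * er (y ^ 6))) with hW
  have W0 : 0 < W := by positivity
  have X0 := fP_pos h0 h1
  have Y0 := fM_pos h0 h1
  have X30 := fPp_pos h0 h1 (n := 3) (by norm_num)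
  have Y30 := fMp_pos h0 h1 (n := 3) (by norm_num)
  have Z0 : 0 < r * fT y := mul_pos hr0 (fT_pos h0 h1)
  have Z30 : 0 < r ^ 3 * fT (y ^ 3) := mul_pos (pow_pos hr0 3) (fTp_pos h0 h1 (by norm_num))
  have W2 : W ^ 2 = fM y * fM (y ^ 3) * (r * fT y) * (r ^ 3 * fT (y ^ 3)) := by
    rw [hW, fM, fM, fT, fT]
    simp only [← pow_mul, Nat.reduceMul]
    field_simp
    try ring
  have key : y * ((er y)⁻¹ * er (y ^ 2) ^ 2 * er (y ^ 3) ^ 3 * er (y ^ 4) ^ 3 * er (y ^ 6) ^ 2 * (er (y ^ 12))⁻¹) -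
     y ^ 2 * (er y ^ 3 * er (y ^ 2) ^ 2 * (er (y ^ 3))⁻¹ * (er (y ^ 4))⁻¹ * er (y ^ 6) ^ 2 * er (y ^ 12) ^ 3)
      = fP y * fP (y ^ 3) * (fM (y ^ 3) ^ 2 * (r * fT y) ^ 2 - fM y ^ 2 * (r ^ 3 * fT (y ^ 3)) ^ 2) * W / 8 := by
    have hy2 : y ^ 2 = r ^ 8 := by rw [← hr]; ring
    rw [hW, fP, fP, fM, fM, fT, fT]
    simp only [← pow_mul, Nat.reduceMul]
    have A : y * ((er y)⁻¹ * er (y ^ 2) ^ 2 * er (y ^ 3) ^ 3 * er (y ^ 4) ^ 3 * er (y ^ 6) ^ 2 * (er (y ^ 12))⁻¹)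
      = r ^ 4 * ((er y)⁻¹ * er (y ^ 2) ^ 2 * er (y ^ 3) ^ 3 * er (y ^ 4) ^ 3 * er (y ^ 6) ^ 2 * (er (y ^ 12))⁻¹) := by
      rw [hr]
    rw [A]
    generalize er y = E1 at *
    generalize er (y ^ 2) = E2 at *
    rw [hy2]
    generalize er (y ^ 3) = E3 at *
    generalize er (y ^ 4) = E4 at *
    generalize er (y ^ 6) = E6 at *
    generalize er (y ^ 12) = E12 at *
    field_simp
    try ring
  rw [key]
  have T : y * fT y * fT (y ^ 3) = (r * fT y) * (r ^ 3 * fT (y ^ 3)) := by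
    linear_combination (-fT y * fT (y ^ 3)) * hr
  rw [T]
  generalize fP y = X at *
  generalize fM y = Y at *
  generalize fP (y ^ 3) = X3 at *
  generalize fM (y ^ 3) = Y3 at *
  generalize r * fT y = Z at *
  generalize r ^ 3 * fT (y ^ 3) = Z3 at *
  clear_value W
  have k1 : X * Z ^ 3 = (2 + p) ^ 2 * X3 ^ 3 * Z3 := by
    apply mul_left_cancel₀ p0.ne'
    linear_combination (X * Z) * m2 + (2 + p) * Z3 * m4
  have k2 : (X * Y3 * Z * W) ^ 2 = ((1 + p) * (2 + p) * X3 ^ 3 * Y * Z3) ^ 2 := by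
    linear_combination (X ^ 2 * Y3 ^ 2 * Z ^ 2) * W2 + (Y3 ^ 3 * X * Y * Z3) * k1 -
      ((2 + p) ^ 2 * X3 ^ 3 * Y * Z3 ^ 2) * m7
  have k3 : X * Y3 * Z * W = (1 + p) * (2 + p) * X3 ^ 3 * Y * Z3 := by
    rwa [sq_eq_sq₀ (by positivity) (by positivity)] at k2
  have k4 : (1 + p) * (2 + p) * (Y3 ^ 2 * Z ^ 2 - Y ^ 2 * Z3 ^ 2) = 2 * (1 + p + p ^ 2) * (Y3 ^ 2 * Z ^ 2) := by
    linear_combination (-(2 + p) * Z3 ^ 2) * m3 + ((1 - p) * Y3 ^ 2) * m2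
  have k5 : X ^ 4 + 3 * X3 ^ 4 = 4 * (1 + p + p ^ 2) * X3 ^ 4 := by
    linear_combination (X ^ 2 + (1 + 2 * p) * X3 ^ 2) * m1
  rw [k5]
  have : (1 + p) * (2 + p) ≠ 0 := by positivity
  apply mul_left_cancel₀ this
  linear_combination (X * X3 * W / 8) * k4 + (1 + p + p ^ 2) * Y3 * Z * X3 / 4 * k3

end

lemma split5 {y : ℝ} (h0 : 0 < y) (h1 : y < 1) : ∀ A B : ℝ, A = fP (y ^ 4) → B = y * fT (y ^ 4) →
    fP y = A + B ∧ fM y = A - B ∧ fP (y ^ 2) ^ 2 = A ^ 2 + B ^ 2 ∧ fM (y ^ 2) ^ 2 = A ^ 2 - B ^ 2 ∧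
      y * fT (y ^ 2) ^ 2 = 2 * A * B := by
  rintro A B rfl rfl
  refine ⟨fP_split h0 h1, fM_split h0 h1, fP_sq h0 h1, ?_, ?_⟩
  · rw [← fPM h0 h1, fP_split h0 h1, fM_split h0 h1]; ring
  · rw [fT_sq (pow_pos h0 2) (pow_lt_one₀ h0.le h1 (by norm_num)), ← pow_mul]; ring

noncomputable def RE (r : ℝ) : ℝ := (fP r ^ 8 + fM r ^ 8 + r ^ 2 * fT r ^ 8) / 2

lemma RE_two {y : ℝ} (h0 : 0 < y) (h1 : y < 1) :
    RE y = fP y ^ 8 - fP y ^ 4 * fM y ^ 4 + fM y ^ 8 := by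
  obtain ⟨e1, e2, e3, e4, e5⟩ := split5 h0 h1 _ _ rfl rfl
  set A := fP (y ^ 4)
  set B := y * fT (y ^ 4)
  have h : y * fT y ^ 4 = 8 * A * B * (A ^ 2 + B ^ 2) := by
    rw [← e3, show fT y ^ 4 = (fT y ^ 2) ^ 2 by ring, fT_sq h0 h1]
    linear_combination 4 * fP (y ^ 2) ^ 2 * e5
  rw [RE, show y ^ 2 * fT y ^ 8 = (y * fT y ^ 4) ^ 2 by ring, h, e1, e2]
  ring

lemma RE_one {s : ℝ} (h0 : 0 < s) (h1 : s < 1) {y : ℝ} (hy : s ^ 2 = y) :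
    RE s = ((2 * fP y ^ 8 + 28 * fP y ^ 4 * (fP y ^ 4 - fM y ^ 4)) + 2 * (fP y ^ 4 - fM y ^ 4) ^ 2) / 2 := by
  subst hy
  obtain ⟨e1, e2, e3, e4, e5⟩ := split5 h0 h1 _ _ rfl rfl
  rw [RE_two h0 h1, e1, e2,
    show fP (s ^ 2) ^ 8 = (fP (s ^ 2) ^ 2) ^ 4 by ring, show fP (s ^ 2) ^ 4 = (fP (s ^ 2) ^ 2) ^ 2 by ring,
    show fM (s ^ 2) ^ 4 = (fM (s ^ 2) ^ 2) ^ 2 by ring, e3, e4]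
  ring

lemma fM4 {y : ℝ} (h0 : 0 < y) (h1 : y < 1) :
    fM (y ^ 4) ^ 4 = fP (y ^ 4) ^ 4 - (y * fT (y ^ 4)) ^ 4 := by
  obtain ⟨e1, e2, e3, e4, e5⟩ := split5 h0 h1 _ _ rfl rfl
  have := fPM (pow_pos h0 2) (pow_lt_one₀ h0.le h1 (n := 2) (by norm_num))
  rw [← pow_mul] at this
  rw [show fM (y ^ 4) ^ 4 = (fM (y ^ 4) ^ 2) ^ 2 by ring, ← this, mul_pow, e3, e4]; ring

lemma RE_eight {y : ℝ} (h0 : 0 < y) (h1 : y < 1) {a b : ℝ} (ha : a = fP (y ^ 4)) (hb : b = y * fT (y ^ 4)) :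
    RE (y ^ 4) = (a ^ 8 + b ^ 8 + (a ^ 4 - b ^ 4) ^ 2) / 2 := by
  have := fM4 h0 h1
  rw [← ha, ← hb] at this
  rw [RE, show fM (y ^ 4) ^ 8 = (fM (y ^ 4) ^ 4) ^ 2 by ring, this, hb, ha]; ring

lemma RE_sixteen {y : ℝ} (h0 : 0 < y) (h1 : y < 1) {a b : ℝ} (ha : a = fP (y ^ 4)) (hb : b = y * fT (y ^ 4)) :
    RE (y ^ 8) = ((2 * a ^ 8 + 12 * a ^ 4 * (a ^ 4 - b ^ 4) + 2 * (a ^ 4 - b ^ 4) ^ 2) / 16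
      + a ^ 4 * (a ^ 4 - b ^ 4)) / 2 := by
  have h4 := fM4 h0 h1
  rw [← ha, ← hb] at h4
  obtain ⟨e1, e2, e3, e4, e5⟩ := split5 (pow_pos h0 4) (pow_lt_one₀ h0.le h1 (n := 4) (by norm_num)) _ _ rfl rfl
  rw [← h4]
  rw [show (y ^ 4) ^ 2 = y ^ 8 by ring] at e3 e4 e5
  rw [RE, show fP (y ^ 8) ^ 8 = (fP (y ^ 8) ^ 2) ^ 4 by ring,
    show fM (y ^ 8) ^ 8 = (fM (y ^ 8) ^ 2) ^ 4 by ring,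
    show (y ^ 8) ^ 2 * fT (y ^ 8) ^ 8 = (y ^ 4 * fT (y ^ 8) ^ 2) ^ 4 by ring, e3, e4, e5, ha, e1, e2]
  ring

noncomputable def R6 (y : ℝ) : ℝ := fM y^2*fM (y^3)^2*fP y*fP (y^3)*(fP y*fP (y^3) - fM y*fM (y^3))/4
noncomputable def R8 (y : ℝ) : ℝ := y*fT (y^2)^2*fM (y^2)^4*fP (y^2)^2/4
noncomputable def R16 (y : ℝ) : ℝ := y*fT (y^2)^2*fM (y^2)^2*fP (y^2)^4/4
noncomputable def R12 (y : ℝ) : ℝ := (fP y^4+3*fP (y^3)^4)*fM y*fM (y^3)*(fP y*fP (y^3) - fM y*fM (y^3))/16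
noncomputable def R24 (y : ℝ) : ℝ := (fP y^2*fP (y^3)^2 + fM y^2*fM (y^3)^2)*fM (y^2)*fM (y^6)*(fP y*fP (y^3) - fM y*fM (y^3))/8

section
variable {y : ℝ}

lemma lt1 (h0 : 0 < y) (h1 : y < 1) {n : ℕ} (hn : n ≠ 0) : y ^ n < 1 := pow_lt_one₀ h0.le h1 hn

/-- fM(q⁴) fM(q¹²) = ac − bd -/
lemma fM_prod (h0 : 0 < y) (h1 : y < 1) {a b c d : ℝ} (ha : a = fP (y ^ 4)) (hb : b = y * fT (y ^ 4))
    (hc : c = fP (y ^ 12)) (hd : d = y ^ 3 * fT (y ^ 12)) : fM (y ^ 4) * fM (y ^ 12) = a * c - b * d := by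
  have := schroter (pow_pos h0 4) (lt1 h0 h1 (n := 4) (by norm_num))
  rw [← pow_mul] at this
  norm_num at this
  rw [ha, hb, hc, hd]
  linear_combination this

lemma R8_one (h0 : 0 < y) (h1 : y < 1) {a b : ℝ} (ha : a = fP (y ^ 4)) (hb : b = y * fT (y ^ 4)) :
    R8 y = a * b * (a ^ 2 - b ^ 2) ^ 2 * (a ^ 2 + b ^ 2) / 2 := by
  obtain ⟨e1, e2, e3, e4, e5⟩ := split5 h0 h1 _ _ ha hb
  rw [R8, show fM (y ^ 2) ^ 4 = (fM (y ^ 2) ^ 2) ^ 2 by ring, e5, e4, e3]; ring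

lemma R16_one (h0 : 0 < y) (h1 : y < 1) {a b : ℝ} (ha : a = fP (y ^ 4)) (hb : b = y * fT (y ^ 4)) :
    R16 y = a * b * (a ^ 2 + b ^ 2) ^ 2 * (a ^ 2 - b ^ 2) / 2 := by
  obtain ⟨e1, e2, e3, e4, e5⟩ := split5 h0 h1 _ _ ha hb
  rw [R16, show fP (y ^ 2) ^ 4 = (fP (y ^ 2) ^ 2) ^ 2 by ring, e5, e4, e3]; ring

lemma R8_two (h0 : 0 < y) (h1 : y < 1) {a b : ℝ} (ha : a = fP (y ^ 4)) (hb : b = y * fT (y ^ 4)) :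
    R8 (y ^ 2) = (a ^ 4 - b ^ 4) * a ^ 2 * b ^ 2 / 4 := by
  have h4 := fM4 h0 h1
  rw [R8, ← pow_mul, h4, ha, hb]; ring

lemma R12_one (h0 : 0 < y) (h1 : y < 1) {a b c d : ℝ} (ha : a = fP (y ^ 4)) (hb : b = y * fT (y ^ 4))
    (hc : c = fP (y ^ 12)) (hd : d = y ^ 3 * fT (y ^ 12)) :
    R12 (y ^ 4) = (a ^ 4 + 3 * c ^ 4) * (a * c - b * d) * b * d / 16 ∧
    R6 (y ^ 4) = (a * c - b * d) ^ 2 * a * b * c * d / 4 ∧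
    R6 (y ^ 8) = a * c * b ^ 2 * d ^ 2 * (a * c - b * d) / 16 := by
  have h := fM_prod h0 h1 ha hb hc hd
  have n4 := pow_pos h0 4
  have l4 := lt1 h0 h1 (n := 4) (by norm_num)
  have n12 := pow_pos h0 12
  have l12 := lt1 h0 h1 (n := 12) (by norm_num)
  refine ⟨?_, ?_, ?_⟩
  · rw [R12, ← pow_mul]; norm_num
    rw [← ha, ← hc, mul_assoc _ (fM (y ^ 4)), h]; ring
  · rw [R6, ← pow_mul]; norm_num
    rw [← ha, ← hc, ← mul_pow, h]; ring
  · have s := schroter (pow_pos h0 8) (lt1 h0 h1 (n := 8) (by norm_num))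
    have p4 := fPM n4 l4
    have p12 := fPM n12 l12
    have t4 := fT_sq n4 l4
    have t12 := fT_sq n12 l12
    rw [R6, ← s]
    simp only [← pow_mul] at *
    norm_num at *
    rw [← p4, ← p12, ← ha, ← hc]
    have hbd : b ^ 2 * d ^ 2 = y ^ 8 * (fT (y ^ 4) ^ 2 * fT (y ^ 12) ^ 2) := by rw [hb, hd]; ring
    rw [t4, t12] at hbd
    linear_combination (-(a * c * (a * c - b * d)) / 16) * hbd +
      a * c * y ^ 8 * (fP (y ^ 8) * fT (y ^ 8) * fP (y ^ 24) * fT (y ^ 24)) / 4 * h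

end

lemma quad_rel {a b c d p : ℝ} (pa : 0 < a) (pb : 0 < b) (pc : 0 < c) (pd : 0 < d) (pp : 0 < p)
    (m1 : a ^ 2 = (1 + 2 * p) * c ^ 2) (m2 : p * b ^ 2 = (2 + p) * d ^ 2)
    (m4 : a * b * d = p * (2 + p) * c ^ 3) :
    ∃ t : ℝ, 0 < t ∧ b ^ 2 = (2 + p) * t ∧ d ^ 2 = p * t ∧ a * b * t = (2 + p) * c ^ 3 * d ∧
      a * d * t = p * c ^ 3 * b ∧ (1 + 2 * p) * t ^ 2 = p * (2 + p) * c ^ 4 ∧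
      (1 + 2 * p) * (b * d) = p * (2 + p) * (a * c) ∧ (2 + p) * (a * d * c) = (1 + 2 * p) * (b * t) := by
  have hd : d ^ 2 = p * (d ^ 2 / p) := by field_simp
  have pt : 0 < d ^ 2 / p := by positivity
  generalize d ^ 2 / p = t at hd pt
  have hb : b ^ 2 = (2 + p) * t := by
    apply mul_left_cancel₀ pp.ne'
    linear_combination m2 + (2 + p) * hd
  have h5 : (1 + 2 * p) * (b * d) = p * (2 + p) * (a * c) := by
    apply mul_left_cancel₀ (pow_pos pc 2).ne'
    linear_combination a * m4 - b * d * m1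
  have h2p : (2 + p) ≠ 0 := by positivity
  refine ⟨t, pt, hb, hd, ?_, ?_, ?_, h5, ?_⟩
  · apply mul_left_cancel₀ pp.ne'
    linear_combination d * m4 - a * b * hd
  · apply mul_left_cancel₀ h2p
    linear_combination b * m4 - a * d * hb
  · apply mul_left_cancel₀ (show p * (2 + p) * c ^ 2 ≠ 0 by positivity)
    linear_combination (a * b * d + p * (2 + p) * c ^ 3) * m4 - a ^ 2 * b ^ 2 * hd - a ^ 2 * p * t * hb -
      p * (2 + p) * t ^ 2 * m1
  · apply mul_left_cancel₀ pp.ne'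
    linear_combination (1 + 2 * p) * b * hd - d * h5

lemma core_id {a b c d g h p : ℝ} (pa : 0 < a) (pb : 0 < b) (pc : 0 < c) (pd : 0 < d) (pp : 0 < p)
    (m1 : a ^ 2 = (1 + 2 * p) * c ^ 2) (m2 : p * b ^ 2 = (2 + p) * d ^ 2)
    (m4 : a * b * d = p * (2 + p) * c ^ 3) (pg : 0 < g)
    (hgg : g ^ 2 = (a ^ 2 + b ^ 2) * (c ^ 2 + d ^ 2)) (hhh : h ^ 2 = (a ^ 2 - b ^ 2) * (c ^ 2 - d ^ 2))
    (hgh : g * h = (a * c - b * d) ^ 2) :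
    (a + b) ^ 3 * (a ^ 2 + b ^ 2) * (c + d) ^ 2 * a =
    ((7/5) * ((2 * (a + b) ^ 8 + 28 * (a + b) ^ 4 * ((a + b) ^ 4 - (a - b) ^ 4) + 2 * ((a + b) ^ 4 - (a - b) ^ 4) ^ 2) / 2)
    + (-7/5) * ((a + b) ^ 8 - (a + b) ^ 4 * (a - b) ^ 4 + (a - b) ^ 8)
    + (-27/5) * ((2 * (c + d) ^ 8 + 28 * (c + d) ^ 4 * ((c + d) ^ 4 - (c - d) ^ 4) + 2 * ((c + d) ^ 4 - (c - d) ^ 4) ^ 2) / 2)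
    + (27/5) * ((c + d) ^ 8 - (c + d) ^ 4 * (c - d) ^ 4 + (c - d) ^ 8)
    + (28/5) * ((a ^ 8 + b ^ 8 + (a ^ 4 - b ^ 4) ^ 2) / 2)
    + (-448/5) * (((2 * a ^ 8 + 12 * a ^ 4 * (a ^ 4 - b ^ 4) + 2 * (a ^ 4 - b ^ 4) ^ 2) / 16 + a ^ 4 * (a ^ 4 - b ^ 4)) / 2)
    + (-108/5) * ((c ^ 8 + d ^ 8 + (c ^ 4 - d ^ 4) ^ 2) / 2)
    + (1728/5) * (((2 * c ^ 8 + 12 * c ^ 4 * (c ^ 4 - d ^ 4) + 2 * (c ^ 4 - d ^ 4) ^ 2) / 16 + c ^ 4 * (c ^ 4 - d ^ 4)) / 2)) / 240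
    + (-2/5) * ((a - b) ^ 2 * (c - d) ^ 2 * (a + b) * (c + d) * ((a + b) * (c + d) - (a - b) * (c - d)) / 4)
    + (-24) * ((a * c - b * d) ^ 2 * a * b * c * d / 4)
    + (-448/5) * (a * c * b ^ 2 * d ^ 2 * (a * c - b * d) / 16)
    + (-1/2) * (a * b * (a ^ 2 - b ^ 2) ^ 2 * (a ^ 2 + b ^ 2) / 2)
    + (-1) * ((a ^ 4 - b ^ 4) * a ^ 2 * b ^ 2 / 4)
    + (-27/2) * (c * d * (c ^ 2 - d ^ 2) ^ 2 * (c ^ 2 + d ^ 2) / 2)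
    + (-27) * ((c ^ 4 - d ^ 4) * c ^ 2 * d ^ 2 / 4)
    + 2 * (((a + b) ^ 4 + 3 * (c + d) ^ 4) * (a - b) * (c - d) * ((a + b) * (c + d) - (a - b) * (c - d)) / 16)
    + 2 * (((a ^ 2 + b ^ 2) ^ 2 + 3 * (c ^ 2 + d ^ 2) ^ 2) * h * (g - h) / 16)
    + 20 * ((a ^ 4 + 3 * c ^ 4) * (a * c - b * d) * b * d / 16)
    + (1/2) * (a * b * (a ^ 2 + b ^ 2) ^ 2 * (a ^ 2 - b ^ 2) / 2)
    + (-27/2) * (c * d * (c ^ 2 + d ^ 2) ^ 2 * (c ^ 2 - d ^ 2) / 2)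
    + (3/2) * (((a + b) ^ 2 * (c + d) ^ 2 + (a - b) ^ 2 * (c - d) ^ 2) * h * ((a + b) * (c + d) - (a - b) * (c - d)) / 8)
    + 3 * ((g ^ 2 + h ^ 2) * (a * c - b * d) * (g - h) / 8)
    + 3 * (((a*c+b*d)^2+(b*c-a*d)^2)*(a*c+b*d)*(b*c-a*d)/2)
    + (-3/2) * (g * (b*c-a*d)*((a*c+b*d)^2-(b*c-a*d)^2)/2) := by
  obtain ⟨t, pt, hb, hd, n1, n2, n3, n4, n5⟩ := quad_rel pa pb pc pd pp m1 m2 m4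
  have hQ1 : b^4+2*b^2*d^2-3*d^4-4*a*b*c*d = 0 := by
    rw [show b ^ 4 = (b ^ 2) ^ 2 by ring, show d ^ 4 = (d ^ 2) ^ 2 by ring, hb, hd]
    linear_combination 4 * n3 - 4 * c * m4
  have hQ2 : a^2*c*d-a*b^3+a*b*d^2+3*c^3*d = 0 := by
    linear_combination c * d * m1 - a * b * (hb - hd) - 2 * n1
  have hQ3 : a^2*b*c-a*b^2*d+a*d^3-b*c^3 = 0 := by
    linear_combination b * c * m1 - a * d * (hb - hd) - 2 * n2
  have hQ4 : a^2*b^2-a^2*d^2-b^2*c^2-3*c^2*d^2 = 0 := by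
    rw [m1, hb, hd]; ring
  have hQ5 : a^3*d+3*a*c^2*d-b^3*c-3*b*c*d^2 = 0 := by
    linear_combination a * d * m1 - b * c * hb - 3 * b * c * hd + 2 * c * n5
  have hQ7 : a^4+2*a^2*c^2-3*c^4-4*a*b*c*d = 0 := by
    rw [show a ^ 4 = (a ^ 2) ^ 2 by ring, m1]
    linear_combination - 4 * c * m4
  have pK : 0 < a * ((1 + p + p ^ 2) * c ^ 2 + (1 + 2 * p) * t) := by positivity
  have h12 : (1 + 2 * p) ≠ 0 := by positivity
  have kg : (1 + 2 * p) * (c * g) = a * ((1 + p + p ^ 2) * c ^ 2 + (1 + 2 * p) * t) := by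
    refine (sq_eq_sq₀ (by positivity) pK.le).1 ?_
    rw [mul_pow, mul_pow, mul_pow, hgg, m1, hb, hd]
    linear_combination (1 + 2 * p) * c ^ 2 * (p * (2 + p) - (1 + 2 * p)) * n3
  have kgG : (1 + 2 * p) * ((a^3+a*b^2+a*c^2-a*d^2)/2-b*c*d) = a * ((1 + p + p ^ 2) * c ^ 2 + (1 + 2 * p) * t) := by
    linear_combination (1 + 2 * p) / 2 * a * (m1 + hb - hd) - c * n4
  have khH : (1 + 2 * p) * ((a^3-a*b^2+a*c^2+a*d^2)/2-b*c*d) = a * ((1 + p + p ^ 2) * c ^ 2 - (1 + 2 * p) * t) := by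
    linear_combination (1 + 2 * p) / 2 * a * (m1 - hb + hd) - c * n4
  have hcg : c * g = (a^3+a*b^2+a*c^2-a*d^2)/2-b*c*d := mul_left_cancel₀ h12 (kg.trans kgG.symm)
  have kef : (1 + 2 * p) * (a * c - b * d) = (1 - p ^ 2) * (a * c) := by
    linear_combination - n4
  have hch : c * h = (a^3-a*b^2+a*c^2+a*d^2)/2-b*c*d := by
    apply mul_left_cancel₀ h12
    apply mul_left_cancel₀ pK.ne'
    rw [khH, ← kg]
    have e : (1 + 2 * p) * (c * g) * ((1 + 2 * p) * (c * h)) = c ^ 2 * ((1 + 2 * p) * (a * c - b * d)) ^ 2 := by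
      linear_combination (1 + 2 * p) ^ 2 * c ^ 2 * hgh
    rw [e, kg, kef]
    linear_combination a ^ 2 * (1 + 2 * p) * n3
  have f1 : c * (h * (g - h)) = c * ((a * c - b * d) ^ 2 - (a ^ 2 - b ^ 2) * (c ^ 2 - d ^ 2)) := by
    linear_combination c * (hgh - hhh)
  have f2 : c * ((g ^ 2 + h ^ 2) * (g - h)) = ((a ^ 2 + b ^ 2) * (c ^ 2 + d ^ 2) + (a ^ 2 - b ^ 2) * (c ^ 2 - d ^ 2)) * (a * b ^ 2 - a * d ^ 2) := by
    rw [hgg, hhh]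
    linear_combination ((a ^ 2 + b ^ 2) * (c ^ 2 + d ^ 2) + (a ^ 2 - b ^ 2) * (c ^ 2 - d ^ 2)) * (hcg - hch)
  apply mul_left_cancel₀ pc.ne'
  linear_combination (-2) * (((a ^ 2 + b ^ 2) ^ 2 + 3 * (c ^ 2 + d ^ 2) ^ 2) / 16) * f1 -
    3 * ((a * c - b * d) / 8) * f2 -
    (3/2) * (((a + b) ^ 2 * (c + d) ^ 2 + (a - b) ^ 2 * (c - d) ^ 2) * ((a + b) * (c + d) - (a - b) * (c - d)) / 8) * hch +
    (3/2) * ((b*c-a*d)*((a*c+b*d)^2-(b*c-a*d)^2)/2) * hcg +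
    ((1/60)*a^4*c + (9/5)*a^4*d + (-47/30)*a^3*b*c + (1/6)*a^3*b*d + (-37/40)*a^2*b^2*c + (-3/20)*a^2*b^2*d + (157/60)*a^2*c^3 + (391/80)*a^2*c^2*d + (13/32)*a^2*c*d^2 + (1/30)*a^2*d^3 + (-157/240)*a*b^3*c + (-37/160)*a*b^3*d + (5/2)*a*b*c^3 + (187/60)*a*b*c^2*d + (159/80)*a*b*c*d^2 + (17/32)*a*b*d^3 + (1/8)*b^2*c^3 + (-1/4)*b^2*c^2*d + (1/5)*c^5 + (93/80)*c^4*d + (39/160)*c^3*d^2 + (-4/5)*c^2*d^3)*hQ1 +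
    ((1)*a^4*c + (9/8)*a^4*d + (179/30)*a^3*b*c + (31/5)*a^3*b*d + (10/3)*a^2*b^2*c + (1/6)*a^2*b^2*d + (-41/20)*a^2*c^3 + (-113/40)*a^2*c^2*d + (-57/20)*a^2*c*d^2 + (1/4)*a^2*d^3 + (17/8)*a*b^3*c + (-3/20)*a*b^3*d + (-19/30)*a*b*c^3 + (-5/12)*a*b*d^3 + (-109/240)*b^4*c + (-37/160)*b^4*d + (3/4)*b^2*c^3 + (41/30)*b^2*c^2*d + (-51/40)*b^2*c*d^2 + (-73/80)*b^2*d^3 + (27/5)*c^5 + (117/20)*c^4*d + (63/10)*c^3*d^2 + (157/20)*c^2*d^3 + (237/80)*c*d^4 + (51/32)*d^5)*hQ2 +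
    ((-7/10)*a^5 + (-51/20)*a^4*b + (-22/5)*a^3*b^2 + (41/20)*a^3*c^2 + (-7/40)*a^2*b*c^2 + (-59/20)*a*b^2*c^2 + (3/4)*a*c^4 + (-3/8)*b*c^4)*hQ3 +
    ((-7/10)*a^4*d + (-57/40)*a^3*b*d + (-27/5)*a^2*d^3 + (-1/4)*a*b*d^3 + (-1/10)*d^5)*hQ4 +
    ((-3/4)*a*d^4)*hQ5 +
    ((7/20)*a^4*c + (3/10)*a^2*c^3 + (9/20)*c^5)*hQ7

lemma theta_id {q s : ℝ} (h0 : 0 < q) (h1 : q < 1) (s0 : 0 < s) (s1 : s < 1) (hs : s ^ 2 = q) {a b c d : ℝ}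
    (ha : a = fP (q ^ 4)) (hb : b = q * fT (q ^ 4))
    (hc : c = fP (q ^ 12)) (hd : d = q ^ 3 * fT (q ^ 12)) :
    fP q ^ 3 * fP (q ^ 2) ^ 2 * fP (q ^ 3) ^ 2 * fP (q ^ 4) =
    ((7/5) * RE s + (-7/5) * RE q + (-27/5) * RE (s ^ 3) + (27/5) * RE (q ^ 3) + (28/5) * RE (q ^ 4)
    + (-448/5) * RE (q ^ 8) + (-108/5) * RE (q ^ 12) + (1728/5) * RE (q ^ 24)) / 240
    + (-2/5) * R6 q + (-24) * R6 (q ^ 4) + (-448/5) * R6 (q ^ 8)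
    + (-1/2) * R8 q + (-1) * R8 (q ^ 2) + (-27/2) * R8 (q ^ 3) + (-27) * R8 (q ^ 6)
    + 2 * R12 q + 2 * R12 (q ^ 2) + 20 * R12 (q ^ 4) + (1/2) * R16 q + (-27/2) * R16 (q ^ 3)
    + (3/2) * R24 q + 3 * R24 (q ^ 2)
    + 3 * (((a*c+b*d)^2+(b*c-a*d)^2)*(a*c+b*d)*(b*c-a*d)/2)
    + (-3/2) * (fP (q^2)*fP (q^6)*(b*c-a*d)*((a*c+b*d)^2-(b*c-a*d)^2)/2) := by
  have q3 := pow_pos h0 3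
  have l3 := lt1 h0 h1 (n := 3) (by norm_num)
  have hc3 : c = fP ((q ^ 3) ^ 4) := by rw [hc, ← pow_mul]
  have hd3 : d = q ^ 3 * fT ((q ^ 3) ^ 4) := by rw [hd, ← pow_mul]
  obtain ⟨e1, e2, e3, e4, e5⟩ := split5 h0 h1 _ _ ha hb
  obtain ⟨k1, k2, k3, k4, k5⟩ := split5 q3 l3 _ _ hc3 hd3
  have E1 := RE_one s0 s1 hs
  have E3 := RE_one (pow_pos s0 3) (lt1 s0 s1 (n := 3) (by norm_num)) (show (s ^ 3) ^ 2 = q ^ 3 by rw [← hs]; ring)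
  have E2 := RE_two h0 h1
  have E6 := RE_two q3 l3
  have E8 := RE_eight h0 h1 ha hb
  have E24 := RE_eight q3 l3 hc3 hd3
  have E16 := RE_sixteen h0 h1 ha hb
  have E48 := RE_sixteen q3 l3 hc3 hd3
  obtain ⟨g1, g2, g3⟩ := R12_one h0 h1 ha hb hc hd
  have b1 := R8_one h0 h1 ha hb
  have b2 := R8_two h0 h1 ha hb
  have b3 := R8_one q3 l3 hc3 hd3
  have b6 := R8_two q3 l3 hc3 hd3
  have c1 := R16_one h0 h1 ha hb
  have c3 := R16_one q3 l3 hc3 hd3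
  have hM := fM_prod h0 h1 ha hb hc hd
  have p2 := fPM (pow_pos h0 2) (lt1 h0 h1 (n := 2) (by norm_num))
  have p6 := fPM (pow_pos h0 6) (lt1 h0 h1 (n := 6) (by norm_num))
  have pg2 := fPp_pos h0 h1 (n := 2) (by norm_num)
  have pg6 := fPp_pos h0 h1 (n := 6) (by norm_num)
  have pa : 0 < a := ha ▸ fPp_pos h0 h1 (n := 4) (by norm_num)
  have pc : 0 < c := hc ▸ fPp_pos h0 h1 (n := 12) (by norm_num)
  have pb : 0 < b := hb ▸ mul_pos h0 (fTp_pos h0 h1 (n := 4) (by norm_num))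
  have pd : 0 < d := hd ▸ mul_pos q3 (fTp_pos h0 h1 (n := 12) (by norm_num))
  obtain ⟨p, p0, p1, m1, m2, m3, m4, m5, m6, m7⟩ := Mlemma h0 h1 ha rfl hb hc rfl hd
  simp only [← pow_mul, Nat.reduceMul] at *
  have key := core_id (g := fP (q ^ 2) * fP (q ^ 6)) (h := fM (q ^ 2) * fM (q ^ 6)) pa pb pc pd p0 m1 m2 m4
    (by positivity) (by rw [mul_pow, e3, k3]) (by rw [mul_pow, e4, k4])
    (by rw [← hM]; linear_combination fP (q ^ 6) * fM (q ^ 6) * p2 + fM (q ^ 4) ^ 2 * p6)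
  rw [E1, E2, E3, E6, E8, E24, E16, E48, g1, g2, g3, b1, b2, b3, b6, c1, c3]
  unfold R6 R12 R24
  simp only [← pow_mul, Nat.reduceMul]
  have z1 : fP (q ^ 2) ^ 4 = (a ^ 2 + b ^ 2) ^ 2 := by rw [← e3]; ring
  have z2 : fP (q ^ 6) ^ 4 = (c ^ 2 + d ^ 2) ^ 2 := by rw [← k3]; ring
  rw [z1, z2, e3, e1, e2, k1, k2, ← ha]
  rw [show (fP (q ^ 2) * fP (q ^ 6)) ^ 2 = fP (q ^ 2) ^ 2 * fP (q ^ 6) ^ 2 by ring,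
    show (fM (q ^ 2) * fM (q ^ 6)) ^ 2 = fM (q ^ 2) ^ 2 * fM (q ^ 6) ^ 2 by ring] at key
  rw [← e3, ← k3] at key ⊢
  linear_combination key - 3 * ((fP (q ^ 2) ^ 2 * fP (q ^ 6) ^ 2 + fM (q ^ 2) ^ 2 * fM (q ^ 6) ^ 2) *
    (fP (q ^ 2) * fP (q ^ 6) - fM (q ^ 2) * fM (q ^ 6)) / 8) * hM

lemma eta_eq (z : ℂ) (k : ℕ) : dedekindEta (k * z) =
    Complex.exp (Real.pi * Complex.I * z / 12) ^ k * EE (Complex.exp (2 * Real.pi * Complex.I * z) ^ k) := by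
  rw [dedekindEta, EE, poch, ← Complex.exp_nat_mul]
  congr 1
  · congr 1; ring
  · refine tprod_congr fun m => ?_
    rw [← pow_succ', ← pow_mul, ← Complex.exp_nat_mul]
    congr 2
    push_cast; ring

lemma eta_all (z : ℂ) (hz : 0 < z.im) : ∃ u q : ℂ, u ≠ 0 ∧ q = Complex.exp (2 * Real.pi * Complex.I * z) ∧ q = u ^ 24 ∧
    ‖q‖ < 1 ∧ dedekindEta z = u * EE q ∧
    ∀ k : ℕ, dedekindEta (k * z) = u ^ k * EE (q ^ k) := by
  refine ⟨_, _, Complex.exp_ne_zero (Real.pi * Complex.I * z / 12), rfl, ?_, ?_, ?_, fun k => eta_eq z k⟩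
  · rw [← Complex.exp_nat_mul]; congr 1; push_cast; ring
  · rw [Complex.norm_exp, Real.exp_lt_one_iff]
    have : (2 * (Real.pi : ℂ) * Complex.I * z).re = -(2 * Real.pi * z.im) := by
      simp [mul_re]
    rw [this]
    have := mul_pos Real.two_pi_pos hz
    linarith
  · have := eta_eq z 1
    simpa using this

section
variable {z : ℂ} (hz : 0 < z.im)

lemma eta6 (hz : 0 < z.im) : dedekindEta z ^ (2 : ℤ) * dedekindEta (2 * z) ^ (2 : ℤ) * dedekindEta (3 * z) ^ (2 : ℤ) * dedekindEta (6 * z) ^ (2 : ℤ)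
    = e6 (Complex.exp (2 * Real.pi * Complex.I * z)) := by
  obtain ⟨u, q, hu, hq, hqu, hq1, g1, g⟩ := eta_all z hz
  have g2 := g 2
  have g3 := g 3
  have g6 := g 6
  push_cast at g2 g3 g6
  rw [← hq, e6, g1, g2, g3, g6]
  simp only [zpow_ofNat]
  generalize EE q = A1
  generalize EE (q ^ 2) = A2
  generalize EE (q ^ 3) = A3
  generalize EE (q ^ 6) = A6
  rw [hqu]; ring

lemma eta8 (hz : 0 < z.im) : dedekindEta (2 * z) ^ (4 : ℤ) * dedekindEta (4 * z) ^ (4 : ℤ)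
    = e8 (Complex.exp (2 * Real.pi * Complex.I * z)) := by
  obtain ⟨u, q, hu, hq, hqu, hq1, g1, g⟩ := eta_all z hz
  have g2 := g 2
  have g4 := g 4
  push_cast at g2 g4
  rw [← hq, e8, g2, g4]
  simp only [zpow_ofNat]
  generalize EE (q ^ 2) = A2
  generalize EE (q ^ 4) = A4
  rw [hqu]; ring

lemma eta12 (hz : 0 < z.im) : dedekindEta z ^ (-1 : ℤ) * dedekindEta (2 * z) ^ (2 : ℤ) * dedekindEta (3 * z) ^ (3 : ℤ) * dedekindEta (4 * z) ^ (3 : ℤ) *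
            dedekindEta (6 * z) ^ (2 : ℤ) * dedekindEta (12 * z) ^ (-1 : ℤ) -
          dedekindEta z ^ (3 : ℤ) * dedekindEta (2 * z) ^ (2 : ℤ) * dedekindEta (3 * z) ^ (-1 : ℤ) *
            dedekindEta (4 * z) ^ (-1 : ℤ) * dedekindEta (6 * z) ^ (2 : ℤ) * dedekindEta (12 * z) ^ (3 : ℤ)
    = e12 (Complex.exp (2 * Real.pi * Complex.I * z)) := by
  obtain ⟨u, q, hu, hq, hqu, hq1, g1, g⟩ := eta_all z hz
  have g2 := g 2
  have g3 := g 3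
  have g4 := g 4
  have g6 := g 6
  have g12 := g 12
  push_cast at g2 g3 g4 g6 g12
  rw [← hq, e12, g1, g2, g3, g4, g6, g12]
  have n1 := EE_ne hq1
  have n3 := EEp_ne hq1 3 (by norm_num)
  have n4 := EEp_ne hq1 4 (by norm_num)
  have n12 := EEp_ne hq1 12 (by norm_num)
  simp only [zpow_ofNat, zpow_neg, zpow_one]
  generalize EE q = A1 at *
  generalize EE (q ^ 2) = A2 at *
  generalize EE (q ^ 3) = A3 at *
  generalize EE (q ^ 4) = A4 at *
  generalize EE (q ^ 6) = A6 at *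
  generalize EE (q ^ 12) = A12 at *
  rw [hqu]
  field_simp

lemma eta16 (hz : 0 < z.im) : dedekindEta (2 * z) ^ (-4 : ℤ) * dedekindEta (4 * z) ^ (16 : ℤ) * dedekindEta (8 * z) ^ (-4 : ℤ)
    = e16 (Complex.exp (2 * Real.pi * Complex.I * z)) := by
  obtain ⟨u, q, hu, hq, hqu, hq1, g1, g⟩ := eta_all z hz
  have g2 := g 2
  have g4 := g 4
  have g8 := g 8
  push_cast at g2 g4 g8
  rw [← hq, e16, g2, g4, g8]
  have n2 := EEp_ne hq1 2 (by norm_num)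
  have n8 := EEp_ne hq1 8 (by norm_num)
  simp only [zpow_ofNat, zpow_neg]
  generalize EE (q ^ 2) = A2 at *
  generalize EE (q ^ 4) = A4 at *
  generalize EE (q ^ 8) = A8 at *
  rw [hqu]
  field_simp

lemma eta24 (hz : 0 < z.im) : dedekindEta z ^ (-4 : ℤ) * dedekindEta (2 * z) ^ (11 : ℤ) * dedekindEta (3 * z) ^ (-4 : ℤ) *
          dedekindEta (4 * z) ^ (-3 : ℤ) * dedekindEta (6 * z) ^ (11 : ℤ) * dedekindEta (12 * z) ^ (-3 : ℤ)
    = e24 (Complex.exp (2 * Real.pi * Complex.I * z)) := by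
  obtain ⟨u, q, hu, hq, hqu, hq1, g1, g⟩ := eta_all z hz
  have g2 := g 2
  have g3 := g 3
  have g4 := g 4
  have g6 := g 6
  have g12 := g 12
  push_cast at g2 g3 g4 g6 g12
  rw [← hq, e24, g1, g2, g3, g4, g6, g12]
  have n1 := EE_ne hq1
  have n3 := EEp_ne hq1 3 (by norm_num)
  have n4 := EEp_ne hq1 4 (by norm_num)
  have n12 := EEp_ne hq1 12 (by norm_num)
  simp only [zpow_ofNat, zpow_neg, zpow_one]
  generalize EE q = A1 at *
  generalize EE (q ^ 2) = A2 at *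
  generalize EE (q ^ 3) = A3 at *
  generalize EE (q ^ 4) = A4 at *
  generalize EE (q ^ 6) = A6 at *
  generalize EE (q ^ 12) = A12 at *
  rw [hqu]
  field_simp
end

lemma exists_z {q : ℂ} (hq0 : q ≠ 0) (hq : ‖q‖ < 1) :
    ∃ z : ℂ, 0 < z.im ∧ Complex.exp (2 * Real.pi * Complex.I * z) = q := by
  have hp : (Real.pi : ℂ) ≠ 0 := by exact_mod_cast Real.pi_ne_zero
  refine ⟨-(Complex.log q * Complex.I) / ((2 * Real.pi : ℝ) : ℂ), ?_, ?_⟩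
  · rw [Complex.div_ofReal_im]
    apply div_pos _ Real.two_pi_pos
    simp only [neg_im, mul_im, I_im, mul_one, I_re, mul_zero, add_zero, Complex.log_re]
    have := Real.log_neg (norm_pos_iff.2 hq0) hq
    linarith
  · rw [show 2 * (Real.pi : ℂ) * Complex.I * (-(Complex.log q * Complex.I) / ((2 * Real.pi : ℝ) : ℂ)) = Complex.log q by
      push_cast; field_simp; rw [I_sq]; ring, Complex.exp_log hq0]

/-- zero out the constant coefficient -/
def nz (a : ℕ → ℤ) (n : ℕ) : ℤ := if n = 0 then 0 else a n

lemma series_of {a : ℕ → ℤ} {e : ℂ → ℂ}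
    (h : ∀ z : ℂ, 0 < z.im → e (Complex.exp (2 * Real.pi * Complex.I * z)) =
      ∑' m : ℕ, (a (m + 1) : ℂ) * Complex.exp (2 * Real.pi * Complex.I * z) ^ (m + 1))
    {q : ℂ} (hq0 : q ≠ 0) (hq : ‖q‖ < 1) (hne : e q ≠ 0) :
    HasSum (fun n : ℕ => (nz a n : ℂ) * q ^ n) (e q) := by
  obtain ⟨z, hz, rfl⟩ := exists_z hq0 hq
  have h1 := h z hz
  generalize Complex.exp (2 * Real.pi * Complex.I * z) = q at *
  have hs : Summable fun m : ℕ => (a (m + 1) : ℂ) * q ^ (m + 1) := by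
    by_contra hc
    rw [tsum_eq_zero_of_not_summable hc] at h1
    exact hne h1
  have := hs.hasSum
  rw [← h1] at this
  rw [← hasSum_nat_add_iff' 1]
  refine hasSum_cong this (fun m => ?_) ?_
  · simp [nz]
  · simp [nz]

lemma hasSum_pi : ∀ (n : ℕ) (f : Fin n → ℤ → ℂ), (∀ i, Summable fun j => ‖f i j‖) →
    (Summable fun x : Fin n → ℤ => ‖∏ i, f i (x i)‖) ∧
    HasSum (fun x : Fin n → ℤ => ∏ i, f i (x i)) (∏ i, ∑' j, f i j) := by
  intro n
  induction n with
  | zero =>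
    intro f _
    constructor
    · exact Summable.of_finite
    · simp
  | succ n ih =>
    intro f hf
    obtain ⟨s1, s2⟩ := ih (fun i => f i.succ) fun i => hf i.succ
    have e : ∀ p : ℤ × (Fin n → ℤ), ∏ i, f i ((Fin.consEquiv (fun _ => ℤ)) p i) =
        f 0 p.1 * ∏ i : Fin n, f i.succ (p.2 i) := by
      intro p
      rw [Fin.prod_univ_succ]; simp
    have t1 : Summable fun p : ℤ × (Fin n → ℤ) => ‖f 0 p.1 * ∏ i : Fin n, f i.succ (p.2 i)‖ :=
      Summable.mul_norm (f := f 0) (g := fun x : Fin n → ℤ => ∏ i : Fin n, f i.succ (x i)) (hf 0) s1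
    constructor
    · rw [← (Fin.consEquiv (fun _ => ℤ)).summable_iff]
      refine t1.congr fun p => ?_
      simp only [Function.comp, e]
    · rw [← (Fin.consEquiv (fun _ => ℤ)).hasSum_iff, Fin.prod_univ_succ]
      refine hasSum_cong ((hf 0).of_norm.hasSum.mul s2 t1.of_norm) (fun p => ?_) rfl
      simp only [Function.comp, e]

lemma rep_series {q : ℝ} (h0 : 0 < q) (h1 : q < 1) (a : Fin 8 → ℕ) (ha : ∀ i, a i ≠ 0) :
    HasSum (fun n : ℕ => (repCount a n : ℂ) * (q : ℂ) ^ n) (∏ i, phi ((q : ℂ) ^ a i)) := by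
  have hq0 : (q : ℂ) ≠ 0 := by exact_mod_cast h0.ne'
  have hq := norm_real_lt h0 h1
  obtain ⟨s1, s2⟩ := hasSum_pi 8 (fun i j => ((q : ℂ) ^ a i) ^ (j ^ 2)) fun i => summable_phi (norm_pow_lt hq (ha i))
  have h := s2.tsum_fiberwise (fun x => (∑ i, (a i : ℤ) * x i ^ 2).toNat)
  refine hasSum_cong h (fun n => ?_) rfl
  have hx : ∀ x : Fin 8 → ℤ, ((∑ i, (a i : ℤ) * x i ^ 2).toNat : ℤ) = ∑ i, (a i : ℤ) * x i ^ 2 := fun x =>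
    Int.toNat_of_nonneg (sum_nonneg fun i _ => by positivity)
  have hc : ∀ x : ((fun x : Fin 8 → ℤ => (∑ i, (a i : ℤ) * x i ^ 2).toNat) ⁻¹' {n} : Set (Fin 8 → ℤ)),
      ∏ i, ((q : ℂ) ^ a i) ^ ((x : Fin 8 → ℤ) i ^ 2) = (q : ℂ) ^ n := by
    rintro ⟨x, rfl⟩
    rw [← zpow_natCast, hx]
    simp_rw [← zpow_natCast (q : ℂ) (a _), ← zpow_mul]
    induction (univ : Finset (Fin 8)) using Finset.induction_on with
    | empty => simp
    | insert i s his ih => rw [prod_insert his, sum_insert his, zpow_add₀ hq0, ih]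
  rw [tsum_congr hc, tsum_const, nsmul_eq_mul]
  congr 2
  apply Nat.card_congr
  apply Equiv.subtypeEquivRight
  intro x
  simp only [Set.mem_preimage, Set.mem_singleton_iff]
  rw [← hx x]; norm_cast

lemma dilate {f : ℕ → ℂ} {q V : ℂ} {k : ℕ} (hk : k ≠ 0) (h : HasSum (fun n : ℕ => f n * (q ^ k) ^ n) V) :
    HasSum (fun n : ℕ => (if k ∣ n then f (n / k) else 0) * q ^ n) V := by
  have hi : Function.Injective fun n : ℕ => k * n := fun x y h => Nat.eq_of_mul_eq_mul_left (Nat.pos_of_ne_zero hk) h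
  rw [← hi.hasSum_iff]
  · refine hasSum_cong h (fun n => ?_) rfl
    simp [Nat.mul_div_cancel_left n (Nat.pos_of_ne_zero hk), pow_mul]
  · intro n hn
    rw [if_neg, zero_mul]
    rintro ⟨m, rfl⟩
    exact hn ⟨m, rfl⟩

lemma coeff_zero {c : ℕ → ℂ} (h : ∀ q : ℝ, 0 < q → q < 1 → HasSum (fun n : ℕ => c n * (q : ℂ) ^ n) 0) (n : ℕ) :
    c n = 0 := by
  have hb : HasFPowerSeriesAt (fun z : ℂ => ∑' n, c n * z ^ n) (FormalMultilinearSeries.ofScalars ℂ c) 0 := by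
    refine ⟨ENNReal.ofReal (1 / 2), ?_⟩
    refine { r_le := ?_, r_pos := by simp, hasSum := ?_ }
    · have hs := (h (1 / 2) (by norm_num) (by norm_num)).summable
      have := FormalMultilinearSeries.le_radius_of_summable_norm (FormalMultilinearSeries.ofScalars ℂ c) (r := (1 / 2 : NNReal)) ?_
      · convert this using 1
        rw [ENNReal.ofReal]; congr 1
        ext; norm_num
      · have := hs.norm
        refine this.congr fun n => ?_
        rw [FormalMultilinearSeries.ofScalars_norm, norm_mul, norm_pow]
        norm_num
    · intro z hz
      have hz' : ‖z‖ < 1 / 2 := by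
        rw [Metric.eball_ofReal] at hz
        simpa using hz
      have hs : Summable fun n => c n * z ^ n := by
        have hs := (h (1 / 2) (by norm_num) (by norm_num)).summable.norm
        refine Summable.of_norm_bounded hs fun n => ?_
        rw [norm_mul, norm_mul, norm_pow, norm_pow]
        gcongr
        norm_num; linarith
      simp only [zero_add]
      refine hasSum_cong hs.hasSum (fun n => ?_) rfl
      simp [mul_comm]
  have hz : ∃ᶠ z in nhdsWithin (0 : ℂ) {0}ᶜ, (fun z : ℂ => ∑' n, c n * z ^ n) z = 0 := by
    have ht : Filter.Tendsto (fun k : ℕ => (((1 / (k + 2 : ℝ)) : ℝ) : ℂ)) Filter.atTop (nhdsWithin (0 : ℂ) {0}ᶜ) := by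
      rw [tendsto_nhdsWithin_iff]
      constructor
      · have := tendsto_one_div_add_atTop_nhds_zero_nat (𝕜 := ℝ)
        have h2 := (this.comp (Filter.tendsto_add_atTop_nat 1))
        have h3 := (Complex.continuous_ofReal.tendsto 0).comp h2
        simp only [Complex.ofReal_zero] at h3
        refine h3.congr fun k => ?_
        simp only [Function.comp]
        push_cast
        ring
      · refine Filter.Eventually.of_forall fun k => ?_
        simp only [Set.mem_compl_iff, Set.mem_singleton_iff]
        have : (1 / (k + 2 : ℝ)) ≠ 0 := by positivity
        exact_mod_cast this
    refine ht.frequently (Filter.Frequently.of_forall fun k => ?_)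
    refine (h _ (by positivity) ?_).tsum_eq
    rw [div_lt_one (by positivity)]
    have : (0 : ℝ) ≤ k := by positivity
    linarith
  have h0 := hb.analyticAt.frequently_zero_iff_eventually_zero.1 hz
  have h1 : FormalMultilinearSeries.ofScalars ℂ c = 0 := (hb.congr h0).eq_zero
  have h2 : (FormalMultilinearSeries.ofScalars ℂ c).coeff n = 0 := by rw [h1]; rfl
  simpa using h2

lemma Dv_series {f : ℕ → ℤ} {q V : ℂ} {k : ℕ} (hk : k ≠ 0) (h : HasSum (fun n : ℕ => (f n : ℂ) * (q ^ k) ^ n) V) :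
    HasSum (fun n : ℕ => ((Dv f k n : ℚ) : ℂ) * q ^ n) V := by
  refine hasSum_cong (dilate (f := fun n => (f n : ℂ)) hk h) (fun n => ?_) rfl
  unfold Dv
  split_ifs <;> simp

lemma Dv_real {f : ℕ → ℤ} {V : ℝ → ℝ}
    (h : ∀ r : ℝ, 0 < r → r < 1 → HasSum (fun n : ℕ => (f n : ℂ) * (r : ℂ) ^ n) ((V r : ℝ) : ℂ))
    {q : ℝ} (h0 : 0 < q) (h1 : q < 1) (k : ℕ) (hk : k ≠ 0) :
    HasSum (fun n : ℕ => ((Dv f k n : ℚ) : ℂ) * (q : ℂ) ^ n) ((V (q ^ k) : ℝ) : ℂ) := by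
  apply Dv_series hk
  have := h (q ^ k) (pow_pos h0 k) (lt1 h0 h1 hk)
  push_cast at this
  exact this

lemma sigma_series {q r : ℝ} (r0 : 0 < r) (r1 : r < 1) (k : ℕ) (hk : k ≠ 0) (hr : r ^ 2 = q ^ k) :
    HasSum (fun n : ℕ => ((Dv sigma3 k n : ℚ) : ℂ) * (q : ℂ) ^ n) (((RE r - 1) / 240 : ℝ) : ℂ) := by
  apply Dv_series hk
  have hr' : (q : ℂ) ^ k = (r : ℂ) ^ 2 := by exact_mod_cast hr.symm
  rw [hr']
  refine hasSum_cong (E4_series r0 r1) (fun n => ?_) rfl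
  congr 1
  rw [sigma3, ArithmeticFunction.sigma_apply]
  push_cast; rfl

lemma Dv_one (f : ℕ → ℤ) (n : ℕ) : Dv f 1 n = f n := by simp [Dv]

lemma chi4_series {a : ℕ → ℤ} {q V W : ℂ} (h : HasSum (fun n : ℕ => (a n : ℂ) * q ^ n) V)
    (h2 : HasSum (fun n : ℕ => (a n : ℂ) * (-q) ^ n) W) :
    HasSum (fun n : ℕ => ((chi4 n * a n : ℤ) : ℂ) * q ^ n) ((V - W) / 2) := by
  refine hasSum_cong ((h.sub h2).mul_right (1 / 2)) (fun n => ?_) (by ring)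
  rw [chi4]
  rcases Nat.even_or_odd n with hn | hn
  · rw [hn.neg_pow, if_neg (by rw [Nat.even_iff.1 hn]; norm_num)]; simp
  · rw [hn.neg_pow, if_pos (Nat.odd_iff.1 hn)]; push_cast; ring

lemma chiM_val (n : ℕ) : (Complex.I ^ n - (-Complex.I) ^ n) / (2 * Complex.I) = (chiMinus4 n : ℂ) := by
  have h4 : (Complex.I : ℂ) ^ 4 = 1 := Complex.I_pow_four
  have h4' : (-Complex.I : ℂ) ^ 4 = 1 := by rw [Even.neg_pow ⟨2, rfl⟩, h4]
  have hI := Complex.I_ne_zero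
  have e1 : (n : ZMod 4) = ((n % 4 : ℕ) : ZMod 4) := by simp
  rw [chiMinus4, e1]
  conv_lhs => rw [← Nat.mod_add_div n 4, pow_add, pow_add, pow_mul, pow_mul, h4, h4']
  have : n % 4 < 4 := Nat.mod_lt _ (by norm_num)
  generalize n % 4 = m at *
  have c0 : ZMod.χ₄ ((0 : ℕ) : ZMod 4) = 0 := by decide
  have c1 : ZMod.χ₄ ((1 : ℕ) : ZMod 4) = 1 := by decide
  have c2 : ZMod.χ₄ ((2 : ℕ) : ZMod 4) = 0 := by decide
  have c3 : ZMod.χ₄ ((3 : ℕ) : ZMod 4) = -1 := by decide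
  interval_cases m
  · rw [c0]; simp
  · rw [c1]; field_simp; simp; ring
  · rw [c2]; simp
  · rw [c3, show (-Complex.I) ^ 3 = Complex.I by rw [pow_succ, neg_sq, Complex.I_sq]; ring,
      Complex.I_pow_three]
    field_simp; simp; ring

lemma chiM_series {a : ℕ → ℤ} {q V W : ℂ} (h : HasSum (fun n : ℕ => (a n : ℂ) * (Complex.I * q) ^ n) V)
    (h2 : HasSum (fun n : ℕ => (a n : ℂ) * (-(Complex.I * q)) ^ n) W) :
    HasSum (fun n : ℕ => ((chiMinus4 n * a n : ℤ) : ℂ) * q ^ n) ((V - W) / (2 * Complex.I)) := by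
  refine hasSum_cong ((h.sub h2).mul_right (1 / (2 * Complex.I))) (fun n => ?_) (by ring)
  push_cast
  rw [← chiM_val, show -(Complex.I * q) = (-Complex.I) * q by ring, mul_pow, mul_pow]
  ring

lemma Dv_nz (a : ℕ → ℤ) {n : ℕ} (hn : 0 < n) {k : ℕ} (hk : k ≠ 0) : Dv (nz a) k n = Dv a k n := by
  unfold Dv
  split_ifs with h
  · rw [nz, if_neg]
    obtain ⟨m, rfl⟩ := h
    rw [Nat.mul_div_cancel_left _ (Nat.pos_of_ne_zero hk)]
    rintro rfl
    simp at hn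
  · rfl

lemma Dv_nz_chi (a : ℕ → ℤ) {n : ℕ} (hn : 0 < n) {k : ℕ} (hk : k ≠ 0) :
    Dv (fun m => chi4 m * nz a m) k n = Dv (fun m => chi4 m * a m) k n := by
  unfold Dv
  split_ifs with h
  · simp only [nz]
    rw [if_neg]
    obtain ⟨m, rfl⟩ := h
    rw [Nat.mul_div_cancel_left _ (Nat.pos_of_ne_zero hk)]
    rintro rfl
    simp at hn
  · rfl

lemma R12_pos {y : ℝ} (h0 : 0 < y) (h1 : y < 1) : 0 < R12 y := by
  have a := fP_pos h0 h1
  have b := fM_pos h0 h1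
  have c := fT_pos h0 h1
  have a3 := fPp_pos h0 h1 (n := 3) (by norm_num)
  have b3 := fMp_pos h0 h1 (n := 3) (by norm_num)
  have c3 := fTp_pos h0 h1 (n := 3) (by norm_num)
  rw [R12, ← schroter h0 h1]
  positivity

lemma e24_odd {y : ℝ} (h0 : 0 < y) (h1 : y < 1) : (e24 (y : ℂ) - e24 (-(y : ℂ))) / 2 = (R24 y : ℂ) := by
  rw [e24_real h0 h1, e24_neg h0 h1, R24]
  push_cast; ring

noncomputable def defect (a6 a8 a12 a16 a24 : ℕ → ℤ) (n : ℕ) : ℚ :=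
    (repCount ![1, 1, 1, 2, 2, 3, 3, 4] n : ℚ) -
    (((7 : ℚ) / 5) * Dv sigma3 1 n
      + ((-7 : ℚ) / 5) * Dv sigma3 2 n
      + ((-27 : ℚ) / 5) * Dv sigma3 3 n
      + ((27 : ℚ) / 5) * Dv sigma3 6 n
      + ((28 : ℚ) / 5) * Dv sigma3 8 n
      + ((-448 : ℚ) / 5) * Dv sigma3 16 n
      + ((-108 : ℚ) / 5) * Dv sigma3 24 n
      + ((1728 : ℚ) / 5) * Dv sigma3 48 n
      + ((-2 : ℚ) / 5) * Dv a6 1 n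
      + (-24 : ℚ) * Dv a6 4 n
      + ((-448 : ℚ) / 5) * Dv a6 8 n
      + ((-1 : ℚ) / 2) * Dv a8 1 n
      + (-1 : ℚ) * Dv a8 2 n
      + ((-27 : ℚ) / 2) * Dv a8 3 n
      + (-27 : ℚ) * Dv a8 6 n
      + (2 : ℚ) * Dv a12 1 n
      + (2 : ℚ) * Dv a12 2 n
      + (20 : ℚ) * Dv a12 4 n
      + ((1 : ℚ) / 2) * Dv a16 1 n
      + ((-27 : ℚ) / 2) * Dv a16 3 n
      + ((3 : ℚ) / 2) * Dv (fun m => chi4 m * a24 m) 1 n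
      + (3 : ℚ) * Dv (fun m => chi4 m * a24 m) 2 n
      + (3 : ℚ) * ((chiMinus4 n * a6 n : ℤ) : ℚ)
      + ((-3 : ℚ) / 2) * ((chiMinus4 n * a24 n : ℤ) : ℚ)) - (if n = 0 then 1 else 0)

theorem formula_nz (a6 a8 a12 a16 a24 : ℕ → ℤ)
    (H6 : ∀ q : ℂ, q ≠ 0 → ‖q‖ < 1 → HasSum (fun n : ℕ => (a6 n : ℂ) * q ^ n) (e6 q))
    (H24 : ∀ q : ℂ, q ≠ 0 → ‖q‖ < 1 → HasSum (fun n : ℕ => (a24 n : ℂ) * q ^ n) (e24 q))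
    (H8 : ∀ r : ℝ, 0 < r → r < 1 → HasSum (fun n : ℕ => (a8 n : ℂ) * (r : ℂ) ^ n) ((R8 r : ℝ) : ℂ))
    (H12 : ∀ r : ℝ, 0 < r → r < 1 → HasSum (fun n : ℕ => (a12 n : ℂ) * (r : ℂ) ^ n) ((R12 r : ℝ) : ℂ))
    (H16 : ∀ r : ℝ, 0 < r → r < 1 → HasSum (fun n : ℕ => (a16 n : ℂ) * (r : ℂ) ^ n) ((R16 r : ℝ) : ℂ))
    (n : ℕ) :
    defect a6 a8 a12 a16 a24 n = 0 := by
  have hX : ∀ r : ℝ, 0 < r → r < 1 → HasSum (fun n : ℕ => ((chi4 n * a24 n : ℤ) : ℂ) * (r : ℂ) ^ n) ((R24 r : ℝ) : ℂ) := by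
    intro r r0 r1
    rw [← e24_odd r0 r1]
    have hr0 : (r : ℂ) ≠ 0 := by exact_mod_cast r0.ne'
    have hr1 := norm_real_lt r0 r1
    exact chi4_series (H24 _ hr0 hr1) (H24 _ (neg_ne_zero.2 hr0) (by rwa [norm_neg]))
  have hR6 : ∀ r : ℝ, 0 < r → r < 1 → HasSum (fun n : ℕ => (a6 n : ℂ) * (r : ℂ) ^ n) ((R6 r : ℝ) : ℂ) := by
    intro r r0 r1
    rw [R6, ← e6_real r0 r1]
    exact H6 _ (by exact_mod_cast r0.ne') (norm_real_lt r0 r1)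
  rw [← Rat.cast_inj (α := ℂ), Rat.cast_zero]
  refine coeff_zero (c := fun n => ((defect a6 a8 a12 a16 a24 n : ℚ) : ℂ)) (fun q h0 h1 => ?_) n
  have hq0 : (q : ℂ) ≠ 0 := by exact_mod_cast h0.ne'
  have hq1 := norm_real_lt h0 h1
  have hI0 : Complex.I * (q : ℂ) ≠ 0 := mul_ne_zero Complex.I_ne_zero hq0
  have hI1 : ‖Complex.I * (q : ℂ)‖ < 1 := by rwa [norm_mul, Complex.norm_I, one_mul]
  have s0 : 0 < √q := Real.sqrt_pos.2 h0
  have s1 : √q < 1 := by rw [Real.sqrt_lt' one_pos]; linarith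
  have hs : √q ^ 2 = q := Real.sq_sqrt h0.le
  have r1 := sigma_series (q := q) s0 s1 1 (by norm_num) (by rw [hs, pow_one])
  have r2 := sigma_series (q := q) h0 h1 2 (by norm_num) rfl
  have r3 := sigma_series (q := q) (pow_pos s0 3) (lt1 s0 s1 (by norm_num)) 3 (by norm_num) (by rw [← pow_mul, mul_comm 3 2, pow_mul, hs])
  have r6 := sigma_series (q := q) (pow_pos h0 3) (lt1 h0 h1 (by norm_num)) 6 (by norm_num) (by ring)
  have r8 := sigma_series (q := q) (pow_pos h0 4) (lt1 h0 h1 (by norm_num)) 8 (by norm_num) (by ring)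
  have r16 := sigma_series (q := q) (pow_pos h0 8) (lt1 h0 h1 (by norm_num)) 16 (by norm_num) (by ring)
  have r24 := sigma_series (q := q) (pow_pos h0 12) (lt1 h0 h1 (by norm_num)) 24 (by norm_num) (by ring)
  have r48 := sigma_series (q := q) (pow_pos h0 24) (lt1 h0 h1 (by norm_num)) 48 (by norm_num) (by ring)
  have x1 := Dv_real hX h0 h1 1 (by norm_num)
  have x2 := Dv_real hX h0 h1 2 (by norm_num)
  have t1 := Dv_real hR6 h0 h1 1 (by norm_num)
  have t4 := Dv_real hR6 h0 h1 4 (by norm_num)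
  have t8 := Dv_real hR6 h0 h1 8 (by norm_num)
  have u1 := Dv_real H8 h0 h1 1 (by norm_num)
  have u2 := Dv_real H8 h0 h1 2 (by norm_num)
  have u3 := Dv_real H8 h0 h1 3 (by norm_num)
  have u6 := Dv_real H8 h0 h1 6 (by norm_num)
  have v1 := Dv_real H12 h0 h1 1 (by norm_num)
  have v2 := Dv_real H12 h0 h1 2 (by norm_num)
  have v4 := Dv_real H12 h0 h1 4 (by norm_num)
  have w1 := Dv_real H16 h0 h1 1 (by norm_num)
  have w3 := Dv_real H16 h0 h1 3 (by norm_num)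
  have y6 := chiM_series (H6 _ hI0 hI1) (H6 _ (neg_ne_zero.2 hI0) (by rwa [norm_neg]))
  have y24 := chiM_series (H24 _ hI0 hI1) (H24 _ (neg_ne_zero.2 hI0) (by rwa [norm_neg]))
  rw [e6_I h0 h1 rfl rfl rfl rfl] at y6
  rw [e24_I h0 h1 rfl rfl rfl rfl] at y24
  have rep := rep_series h0 h1 ![1, 1, 1, 2, 2, 3, 3, 4] (by decide)
  have one : HasSum (fun n : ℕ => ((if n = 0 then 1 else 0 : ℂ)) * (q : ℂ) ^ n) 1 := by
    have := hasSum_ite_eq (0 : ℕ) (1 : ℂ)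
    refine hasSum_cong this (fun n => ?_) rfl
    split_ifs with h
    · simp [h]
    · simp
  have key := theta_id h0 h1 s0 s1 hs rfl rfl rfl rfl
  have tot := (((((((((((((((((((((((((r1.mul_left (7/5)).add (r2.mul_left (-7/5))).add (r3.mul_left (-27/5))).add
    (r6.mul_left (27/5))).add (r8.mul_left (28/5))).add (r16.mul_left (-448/5))).add (r24.mul_left (-108/5))).add
    (r48.mul_left (1728/5))).add (t1.mul_left (-2/5))).add (t4.mul_left (-24))).add (t8.mul_left (-448/5))).add
    (u1.mul_left (-1/2))).add (u2.mul_left (-1))).add (u3.mul_left (-27/2))).add (u6.mul_left (-27))).add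
    (v1.mul_left 2)).add (v2.mul_left 2)).add (v4.mul_left 20)).add (w1.mul_left (1/2))).add (w3.mul_left (-27/2))).add
    (x1.mul_left (3/2))).add (x2.mul_left 3)).add (y6.mul_left 3)).add (y24.mul_left (-3/2))))
  refine hasSum_cong ((rep.sub tot).sub one) (fun n => ?_) ?_
  · have hite : (((if n = 0 then 1 else 0 : ℚ)) : ℂ) = if n = 0 then 1 else 0 := by split_ifs <;> simp
    unfold defect
    rw [Rat.cast_sub, hite]
    push_cast
    ring
  · have hrep : ∏ i, phi ((q : ℂ) ^ (![1, 1, 1, 2, 2, 3, 3, 4] : Fin 8 → ℕ) i) =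
        ((fP q ^ 3 * fP (q ^ 2) ^ 2 * fP (q ^ 3) ^ 2 * fP (q ^ 4) : ℝ) : ℂ) := by
      simp only [Fin.prod_univ_eight]
      simp only [Matrix.cons_val, pow_one]
      rw [phi_cast h0 h1, phi_castp h0 h1 (n := 2) (by norm_num), phi_castp h0 h1 (n := 3) (by norm_num),
        phi_castp h0 h1 (n := 4) (by norm_num)]
      push_cast; ring
    rw [hrep, key]
    push_cast
    simp only [pow_one]
    ring

theorem final_formula
    (a6 a8 a12 a16 a24 : ℕ → ℤ)
    (ha6 : ∀ z : ℂ, 0 < z.im →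
      dedekindEta z ^ (2 : ℤ) * dedekindEta (2 * z) ^ (2 : ℤ) * dedekindEta (3 * z) ^ (2 : ℤ) * dedekindEta (6 * z) ^ (2 : ℤ)
        = ∑' m : ℕ, (a6 (m + 1) : ℂ) * Complex.exp (2 * Real.pi * Complex.I * z) ^ (m + 1))
    (ha8 : ∀ z : ℂ, 0 < z.im →
      dedekindEta (2 * z) ^ (4 : ℤ) * dedekindEta (4 * z) ^ (4 : ℤ)
        = ∑' m : ℕ, (a8 (m + 1) : ℂ) * Complex.exp (2 * Real.pi * Complex.I * z) ^ (m + 1))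
    (ha12 : ∀ z : ℂ, 0 < z.im →
      dedekindEta z ^ (-1 : ℤ) * dedekindEta (2 * z) ^ (2 : ℤ) * dedekindEta (3 * z) ^ (3 : ℤ) * dedekindEta (4 * z) ^ (3 : ℤ) *
            dedekindEta (6 * z) ^ (2 : ℤ) * dedekindEta (12 * z) ^ (-1 : ℤ) -
          dedekindEta z ^ (3 : ℤ) * dedekindEta (2 * z) ^ (2 : ℤ) * dedekindEta (3 * z) ^ (-1 : ℤ) *
            dedekindEta (4 * z) ^ (-1 : ℤ) * dedekindEta (6 * z) ^ (2 : ℤ) * dedekindEta (12 * z) ^ (3 : ℤ)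
        = ∑' m : ℕ, (a12 (m + 1) : ℂ) * Complex.exp (2 * Real.pi * Complex.I * z) ^ (m + 1))
    (ha16 : ∀ z : ℂ, 0 < z.im →
      dedekindEta (2 * z) ^ (-4 : ℤ) * dedekindEta (4 * z) ^ (16 : ℤ) * dedekindEta (8 * z) ^ (-4 : ℤ)
        = ∑' m : ℕ, (a16 (m + 1) : ℂ) * Complex.exp (2 * Real.pi * Complex.I * z) ^ (m + 1))
    (ha24 : ∀ z : ℂ, 0 < z.im →
      dedekindEta z ^ (-4 : ℤ) * dedekindEta (2 * z) ^ (11 : ℤ) * dedekindEta (3 * z) ^ (-4 : ℤ) *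
          dedekindEta (4 * z) ^ (-3 : ℤ) * dedekindEta (6 * z) ^ (11 : ℤ) * dedekindEta (12 * z) ^ (-3 : ℤ)
        = ∑' m : ℕ, (a24 (m + 1) : ℂ) * Complex.exp (2 * Real.pi * Complex.I * z) ^ (m + 1))
    (n : ℕ) (hn : 0 < n) : defect a6 a8 a12 a16 a24 n = 0 := by
  have key := formula_nz (nz a6) (nz a8) (nz a12) (nz a16) (nz a24) ?_ ?_ ?_ ?_ ?_ n
  · have hn0 : n ≠ 0 := hn.ne'
    have c6 : nz a6 n = a6 n := if_neg hn0
    have c24 : nz a24 n = a24 n := if_neg hn0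
    unfold defect at key ⊢
    simpa only [Dv_nz _ hn (k := 1) (by norm_num), Dv_nz _ hn (k := 2) (by norm_num),
      Dv_nz _ hn (k := 3) (by norm_num), Dv_nz _ hn (k := 4) (by norm_num), Dv_nz _ hn (k := 6) (by norm_num),
      Dv_nz _ hn (k := 8) (by norm_num), Dv_nz_chi _ hn (k := 1) (by norm_num),
      Dv_nz_chi _ hn (k := 2) (by norm_num), c6, c24] using key
  · intro q hq0 hq
    exact series_of (fun z hz => (eta6 hz).symm.trans (ha6 z hz)) hq0 hq (e6_ne hq0 hq)
  · intro q hq0 hq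
    exact series_of (fun z hz => (eta24 hz).symm.trans (ha24 z hz)) hq0 hq (e24_ne hq0 hq)
  · intro r r0 r1
    have hq0 : (r : ℂ) ≠ 0 := by exact_mod_cast r0.ne'
    have hq := norm_real_lt r0 r1
    rw [R8, ← e8_real r0 r1]
    exact series_of (fun z hz => (eta8 hz).symm.trans (ha8 z hz)) hq0 hq (e8_ne hq0 hq)
  · intro r r0 r1
    have hq0 : (r : ℂ) ≠ 0 := by exact_mod_cast r0.ne'
    have hq := norm_real_lt r0 r1
    have he : e12 (r : ℂ) = (R12 r : ℂ) := e12_real r0 r1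
    rw [← he]
    refine series_of (fun z hz => (eta12 hz).symm.trans (ha12 z hz)) hq0 hq ?_
    rw [he]
    exact_mod_cast (R12_pos r0 r1).ne'
  · intro r r0 r1
    have hq0 : (r : ℂ) ≠ 0 := by exact_mod_cast r0.ne'
    have hq := norm_real_lt r0 r1
    rw [R16, ← e16_real r0 r1]
    exact series_of (fun z hz => (eta16 hz).symm.trans (ha16 z hz)) hq0 hq (e16_ne hq0 hq)

theorem representation_formula_13
    (a6 a8 a12 a16 a24 : ℕ → ℤ)
    (ha6 : ∀ z : ℂ, 0 < z.im →
      dedekindEta z ^ (2 : ℤ) * dedekindEta (2 * z) ^ (2 : ℤ) * dedekindEta (3 * z) ^ (2 : ℤ) * dedekindEta (6 * z) ^ (2 : ℤ)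
        = ∑' m : ℕ, (a6 (m + 1) : ℂ) * Complex.exp (2 * Real.pi * Complex.I * z) ^ (m + 1))
    (ha8 : ∀ z : ℂ, 0 < z.im →
      dedekindEta (2 * z) ^ (4 : ℤ) * dedekindEta (4 * z) ^ (4 : ℤ)
        = ∑' m : ℕ, (a8 (m + 1) : ℂ) * Complex.exp (2 * Real.pi * Complex.I * z) ^ (m + 1))
    (ha12 : ∀ z : ℂ, 0 < z.im →
      dedekindEta z ^ (-1 : ℤ) * dedekindEta (2 * z) ^ (2 : ℤ) * dedekindEta (3 * z) ^ (3 : ℤ) * dedekindEta (4 * z) ^ (3 : ℤ) *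
            dedekindEta (6 * z) ^ (2 : ℤ) * dedekindEta (12 * z) ^ (-1 : ℤ) -
          dedekindEta z ^ (3 : ℤ) * dedekindEta (2 * z) ^ (2 : ℤ) * dedekindEta (3 * z) ^ (-1 : ℤ) *
            dedekindEta (4 * z) ^ (-1 : ℤ) * dedekindEta (6 * z) ^ (2 : ℤ) * dedekindEta (12 * z) ^ (3 : ℤ)
        = ∑' m : ℕ, (a12 (m + 1) : ℂ) * Complex.exp (2 * Real.pi * Complex.I * z) ^ (m + 1))
    (ha16 : ∀ z : ℂ, 0 < z.im →
      dedekindEta (2 * z) ^ (-4 : ℤ) * dedekindEta (4 * z) ^ (16 : ℤ) * dedekindEta (8 * z) ^ (-4 : ℤ)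
        = ∑' m : ℕ, (a16 (m + 1) : ℂ) * Complex.exp (2 * Real.pi * Complex.I * z) ^ (m + 1))
    (ha24 : ∀ z : ℂ, 0 < z.im →
      dedekindEta z ^ (-4 : ℤ) * dedekindEta (2 * z) ^ (11 : ℤ) * dedekindEta (3 * z) ^ (-4 : ℤ) *
          dedekindEta (4 * z) ^ (-3 : ℤ) * dedekindEta (6 * z) ^ (11 : ℤ) * dedekindEta (12 * z) ^ (-3 : ℤ)
        = ∑' m : ℕ, (a24 (m + 1) : ℂ) * Complex.exp (2 * Real.pi * Complex.I * z) ^ (m + 1))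
    (n : ℕ) (hn : 0 < n) :
    (repCount ![1, 1, 1, 2, 2, 3, 3, 4] n : ℚ) =
    (((7 : ℚ) / 5) * (sigma3 n : ℚ)
      + ((-7 : ℚ) / 5) * Dv sigma3 2 n
      + ((-27 : ℚ) / 5) * Dv sigma3 3 n
      + ((27 : ℚ) / 5) * Dv sigma3 6 n
      + ((28 : ℚ) / 5) * Dv sigma3 8 n
      + ((-448 : ℚ) / 5) * Dv sigma3 16 n
      + ((-108 : ℚ) / 5) * Dv sigma3 24 n
      + ((1728 : ℚ) / 5) * Dv sigma3 48 n
      + ((-2 : ℚ) / 5) * (a6 n : ℚ)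
      + (-24 : ℚ) * Dv a6 4 n
      + ((-448 : ℚ) / 5) * Dv a6 8 n
      + ((-1 : ℚ) / 2) * (a8 n : ℚ)
      + (-1 : ℚ) * Dv a8 2 n
      + ((-27 : ℚ) / 2) * Dv a8 3 n
      + (-27 : ℚ) * Dv a8 6 n
      + (2 : ℚ) * (a12 n : ℚ)
      + (2 : ℚ) * Dv a12 2 n
      + (20 : ℚ) * Dv a12 4 n
      + ((1 : ℚ) / 2) * (a16 n : ℚ)
      + ((-27 : ℚ) / 2) * Dv a16 3 n
      + ((3 : ℚ) / 2) * ((chi4 n * a24 n : ℤ) : ℚ)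
      + (3 : ℚ) * Dv (fun m => chi4 m * a24 m) 2 n
      + (3 : ℚ) * ((chiMinus4 n * a6 n : ℤ) : ℚ)
      + ((-3 : ℚ) / 2) * ((chiMinus4 n * a24 n : ℤ) : ℚ)) := by
  have h := final_formula a6 a8 a12 a16 a24 ha6 ha8 ha12 ha16 ha24 n hn
  unfold defect at h
  rw [if_neg hn.ne', sub_zero, sub_eq_zero] at h
  simp only [Dv_one] at h
  exact h
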